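/- arXiv:1602.07084 — 3 statements merged into one kernel-verified Lean document; each statement's English description precedes it below -/
import Mathlib

section
/- Let 1 < p < 2, let N be a closed subspace of the real sequence space ℓ_p, and suppose that the quotient Banach space Y = ℓ_p / N fails the approximation property. Then there exists a closed subspace Z of the real space c₀ such that, setting X = Y ⊕∞ Z, some compact bounded linear operator on X does not belong to the operator-norm closure of NRA(X); that is, K(X) is not contained in the closure of NRA(X). -/
open scoped ENNReal ZeroAtInfty

/-- The numerical radius of a bounded linear operator `T` on a real Banach space `X`:
`v(T) = sup { |x*(T x)| : ‖x‖ = 1, ‖x*‖ = 1, x*(x) = 1 }`. -/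
noncomputable def numRadius {X : Type*} [NormedAddCommGroup X] [NormedSpace ℝ X]
    (T : X →L[ℝ] X) : ℝ :=
  sSup {r : ℝ | ∃ (x : X) (f : X →L[ℝ] ℝ), ‖x‖ = 1 ∧ ‖f‖ = 1 ∧ f x = 1 ∧ r = |f (T x)|}

/-- `T` attains its numerical radius. -/
def AttainsNumRadius {X : Type*} [NormedAddCommGroup X] [NormedSpace ℝ X]
    (T : X →L[ℝ] X) : Prop :=
  ∃ (x : X) (f : X →L[ℝ] ℝ), ‖x‖ = 1 ∧ ‖f‖ = 1 ∧ f x = 1 ∧ |f (T x)| = numRadius T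

/-- The space of bounded linear operators on `X`, with instances resolved through the
norm structure of `X`. -/
abbrev CLM (X : Type*) [NormedAddCommGroup X] [NormedSpace ℝ X] := X →L[ℝ] X

/-- A Banach space has the approximation property if every compact set can be uniformly
approximated by the image of a finite-rank bounded linear operator. -/
def HasApproximationProperty (X : Type*) [NormedAddCommGroup X] [NormedSpace ℝ X] : Prop :=
  ∀ K : Set X, IsCompact K → ∀ ε : ℝ, 0 < ε →
    ∃ R : X →L[ℝ] X, FiniteDimensional ℝ (LinearMap.range (R : X →ₗ[ℝ] X)) ∧
      ∀ x ∈ K, ‖x - R x‖ < ε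

lemma hasDerivAt_mul_abs_rpow {r : ℝ} (hr : 0 < r) (x : ℝ) :
    HasDerivAt (fun s : ℝ => s * |s| ^ r) ((r + 1) * |x| ^ r) x := by
  rcases eq_or_ne x 0 with rfl | hx
  · rw [hasDerivAt_iff_tendsto_slope]
    simp only [abs_zero, Real.zero_rpow hr.ne', mul_zero]
    have h1 : Filter.Tendsto (fun s : ℝ => |s| ^ r) (nhdsWithin 0 {0}ᶜ) (nhds 0) := by
      have : Continuous (fun s : ℝ => |s| ^ r) := continuous_abs.rpow_const fun _ => Or.inr hr.le
      simpa [Real.zero_rpow hr.ne'] using (this.tendsto 0).mono_left nhdsWithin_le_nhds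
    refine h1.congr' ?_
    filter_upwards [self_mem_nhdsWithin] with s hs
    have hs' : s ≠ 0 := hs
    simp [slope_def_field]
    field_simp
  · have h2 := (hasDerivAt_id x).mul ((hasDerivAt_abs hx).rpow_const (p := r)
      (Or.inl (abs_ne_zero.2 hx)))
    refine h2.congr_deriv ?_
    have hs : x * SignType.sign x = |x| := by
      rw [mul_comm]; exact sign_mul_self x
    rw [Real.rpow_sub_one (abs_ne_zero.2 hx)]
    simp only [id]
    have : |x| ≠ 0 := abs_ne_zero.2 hx
    field_simp
    linear_combination r * hs

lemma abs_mul_abs_rpow {q : ℝ} (hq : 2 < q) (x : ℝ) : |x * |x| ^ (q - 2)| = |x| ^ (q - 1) := by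
  rw [abs_mul, abs_of_nonneg (Real.rpow_nonneg (abs_nonneg x) _)]
  rcases eq_or_ne x 0 with rfl | hx
  · simp [Real.zero_rpow (by linarith : q - 1 ≠ 0)]
  · rw [show q - 1 = 1 + (q - 2) by ring, Real.rpow_add (abs_pos.2 hx), Real.rpow_one]

lemma mul_self_mul_abs_rpow {q : ℝ} (hq : 2 < q) (x : ℝ) : x * (x * |x| ^ (q - 2)) = |x| ^ q := by
  rcases eq_or_ne x 0 with rfl | hx
  · simp [Real.zero_rpow (by linarith : q ≠ 0)]
  · rw [← mul_assoc, ← abs_mul_abs_self x, show |x| ^ q = |x| ^ (1 + (1 + (q - 2))) by ring_nf,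
      Real.rpow_add (abs_pos.2 hx), Real.rpow_add (abs_pos.2 hx), Real.rpow_one]
    ring

lemma abs_mul_abs_rpow_rpow {p q : ℝ} (hpq : p.HolderConjugate q) (hq : 2 < q) (x : ℝ) :
    ‖x * |x| ^ (q - 2)‖ ^ p = |x| ^ q := by
  rw [Real.norm_eq_abs, abs_mul_abs_rpow hq, ← Real.rpow_mul (abs_nonneg x),
    hpq.symm.sub_one_mul_conj]

section
variable {p : ℝ≥0∞} [Fact (1 ≤ p)] {q : ℝ}

lemma lp_apply_single (F : lp (fun _ : ℕ => ℝ) p →L[ℝ] ℝ) (n : ℕ) (c : ℝ) :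
    F (lp.single p n c) = F (lp.single p n 1) * c := by
  have h : lp.single (E := fun _ : ℕ => ℝ) p n c = c • lp.single p n (1 : ℝ) := by
    rw [← lp.single_smul, smul_eq_mul, mul_one]
  rw [h, map_smul, smul_eq_mul, mul_comm]

lemma lp_hasSum_apply (hp : p ≠ ⊤) (F : lp (fun _ : ℕ => ℝ) p →L[ℝ] ℝ)
    (x : lp (fun _ : ℕ => ℝ) p) : HasSum (fun n => F (lp.single p n 1) * x n) (F x) := by
  have h := (lp.hasSum_single hp x).mapL F
  simpa only [lp_apply_single F _ (x _)] using h

lemma sum_abs_apply_single_rpow_le (hpq : p.toReal.HolderConjugate q) (hq : 2 < q)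
    (F : lp (fun _ : ℕ => ℝ) p →L[ℝ] ℝ) (s : Finset ℕ) :
    ∑ n ∈ s, |F (lp.single p n 1)| ^ q ≤ ‖F‖ ^ q := by
  set a : ℕ → ℝ := fun n => F (lp.single p n 1) with ha
  set u : lp (fun _ : ℕ => ℝ) p := ∑ n ∈ s, lp.single p n (a n * |a n| ^ (q - 2)) with hu
  have hu1 : ‖u‖ ^ p.toReal = ∑ n ∈ s, |a n| ^ q := by
    rw [hu, lp.norm_sum_single hpq.pos]
    exact Finset.sum_congr rfl fun n _ => abs_mul_abs_rpow_rpow hpq hq _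
  have hu2 : F u = ∑ n ∈ s, |a n| ^ q := by
    rw [hu, map_sum]
    refine Finset.sum_congr rfl fun n _ => ?_
    rw [← mul_self_mul_abs_rpow hq (a n), lp_apply_single]
  change ∑ n ∈ s, |a n| ^ q ≤ _
  rw [← hu1]
  rcases eq_or_ne u 0 with h0 | h0
  · rw [h0, norm_zero, Real.zero_rpow hpq.ne_zero]; positivity
  have hpos : 0 < ‖u‖ := norm_pos_iff.2 h0
  have h1 : ‖u‖ ^ p.toReal ≤ ‖F‖ * ‖u‖ := by
    rw [hu1, ← hu2]; exact (le_abs_self _).trans (F.le_opNorm u)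
  have h2 : ‖u‖ ^ (p.toReal - 1) ≤ ‖F‖ := by
    rw [Real.rpow_sub_one hpos.ne', div_le_iff₀ hpos]; exact h1
  rw [← hpq.sub_one_mul_conj, Real.rpow_mul hpos.le]
  exact Real.rpow_le_rpow (by positivity) h2 hpq.symm.nonneg

lemma summable_abs_apply_single_rpow (hpq : p.toReal.HolderConjugate q) (hq : 2 < q)
    (F : lp (fun _ : ℕ => ℝ) p →L[ℝ] ℝ) : Summable fun n => |F (lp.single p n 1)| ^ q :=
  summable_of_sum_le (fun _ => by positivity) (sum_abs_apply_single_rpow_le hpq hq F)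

/-- The element of `ℓ_p` at which a functional `F`, seen as a sequence in `ℓ_q`, attains its
norm. -/
noncomputable def lpDualityMap (hpq : p.toReal.HolderConjugate q) (hq : 2 < q)
    (F : lp (fun _ : ℕ => ℝ) p →L[ℝ] ℝ) : lp (fun _ : ℕ => ℝ) p :=
  ⟨fun n => F (lp.single p n 1) * |F (lp.single p n 1)| ^ (q - 2), memℓp_gen <| by
    simpa only [abs_mul_abs_rpow_rpow hpq hq] using summable_abs_apply_single_rpow hpq hq F⟩

variable (hpq : p.toReal.HolderConjugate q) (hq : 2 < q) (F : lp (fun _ : ℕ => ℝ) p →L[ℝ] ℝ)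

lemma lpDualityMap_apply (n : ℕ) : lpDualityMap hpq hq F n =
    F (lp.single p n 1) * |F (lp.single p n 1)| ^ (q - 2) := rfl

lemma apply_lpDualityMap (hp : p ≠ ⊤) :
    F (lpDualityMap hpq hq F) = ∑' n, |F (lp.single p n 1)| ^ q := by
  rw [← (lp_hasSum_apply hp F _).tsum_eq]
  simp only [lpDualityMap_apply, mul_self_mul_abs_rpow hq]

lemma norm_lpDualityMap (hp : p ≠ ⊤) :
    ‖lpDualityMap hpq hq F‖ = (F (lpDualityMap hpq hq F)) ^ (1 / p.toReal) := by
  rw [apply_lpDualityMap hpq hq F hp, lp.norm_eq_tsum_rpow hpq.pos]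
  simp only [lpDualityMap_apply, abs_mul_abs_rpow_rpow hpq hq]

lemma apply_lpDualityMap_nonneg (hp : p ≠ ⊤) : 0 ≤ F (lpDualityMap hpq hq F) := by
  rw [apply_lpDualityMap hpq hq F hp]
  exact tsum_nonneg fun _ => by positivity

lemma norm_le_apply_lpDualityMap_rpow (hp : p ≠ ⊤) :
    ‖F‖ ≤ (F (lpDualityMap hpq hq F)) ^ (1 / q) := by
  refine F.opNorm_le_bound (Real.rpow_nonneg (apply_lpDualityMap_nonneg hpq hq F hp) _) fun y => ?_
  have hs := summable_abs_apply_single_rpow hpq hq F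
  have hy : Summable fun n => ‖y n‖ ^ p.toReal := (lp.memℓp y).summable hpq.pos
  obtain ⟨h1, h2⟩ := Real.summable_and_inner_le_Lp_mul_Lq_tsum_of_nonneg hpq.symm
    (fun n => abs_nonneg (F (lp.single p n 1))) (fun n => norm_nonneg (y n)) hs hy
  rw [apply_lpDualityMap hpq hq F hp, lp.norm_eq_tsum_rpow hpq.pos]
  refine le_trans ?_ h2
  have h3 := lp_hasSum_apply hp F y
  rw [← h3.tsum_eq]
  have e : ∀ n, |F (lp.single p n 1)| * ‖y n‖ = ‖F (lp.single p n 1) * y n‖ := fun n => by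
    rw [norm_mul, Real.norm_eq_abs (F _)]
  simp only [e] at h1 ⊢
  exact norm_tsum_le_tsum_norm h1

lemma apply_lpDualityMap_eq (hp : p ≠ ⊤) :
    F (lpDualityMap hpq hq F) = ‖F‖ * ‖lpDualityMap hpq hq F‖ := by
  refine le_antisymm ((le_abs_self _).trans (F.le_opNorm _)) ?_
  have h0 := apply_lpDualityMap_nonneg hpq hq F hp
  refine (mul_le_mul_of_nonneg_right (norm_le_apply_lpDualityMap_rpow hpq hq F hp)
    (norm_nonneg _)).trans ?_
  rw [norm_lpDualityMap hpq hq F hp, ← Real.rpow_add_of_nonneg h0 hpq.symm.one_div_nonneg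
    hpq.one_div_nonneg, hpq.symm.one_div_add_one_div]
  simp

lemma apply_lpDualityMap_pos (hp : p ≠ ⊤) (hF : F ≠ 0) : 0 < F (lpDualityMap hpq hq F) := by
  refine (apply_lpDualityMap_nonneg hpq hq F hp).lt_of_ne fun h => ?_
  have := norm_le_apply_lpDualityMap_rpow hpq hq F hp
  rw [← h, Real.zero_rpow hpq.symm.one_div_ne_zero] at this
  exact hF (norm_le_zero_iff.1 this)

lemma differentiableAt_apply_lpDualityMap (hp : p ≠ ⊤) (G H : lp (fun _ : ℕ => ℝ) p →L[ℝ] ℝ) :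
    DifferentiableAt ℝ (fun t : ℝ => G (lpDualityMap hpq hq (F + t • H))) 0 := by
  set a : ℕ → ℝ := fun n => F (lp.single p n 1) with ha
  set b : ℕ → ℝ := fun n => H (lp.single p n 1) with hb
  set c : ℕ → ℝ := fun n => G (lp.single p n 1) with hc
  have hx : ∀ (t : ℝ) n, lpDualityMap hpq hq (F + t • H) n =
      (a n + t * b n) * |a n + t * b n| ^ (q - 2) := fun t n => by
    simp [lpDualityMap_apply, ha, hb]
  have hG : (fun t : ℝ => G (lpDualityMap hpq hq (F + t • H))) =
      fun t => ∑' n, c n * ((a n + t * b n) * |a n + t * b n| ^ (q - 2)) := by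
    funext t
    rw [← (lp_hasSum_apply hp G _).tsum_eq]
    simp only [hx, hc]
  rw [hG]
  have hsum : Summable fun n => (q - 1) * (|c n| + |a n| + |b n|) ^ q := by
    refine Summable.mul_left _ ?_
    have hq1 : 1 ≤ q := by linarith
    exact Real.summable_Lp_add_of_nonneg hq1 (fun n => by positivity) (fun n => by positivity)
      (Real.summable_Lp_add_of_nonneg hq1 (fun n => by positivity) (fun n => by positivity)
        (summable_abs_apply_single_rpow hpq hq G) (summable_abs_apply_single_rpow hpq hq F))
      (summable_abs_apply_single_rpow hpq hq H)
  have h0 : Summable fun n => c n * ((a n + 0 * b n) * |a n + 0 * b n| ^ (q - 2)) := by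
    have := (lp_hasSum_apply hp G (lpDualityMap hpq hq (F + (0 : ℝ) • H))).summable
    simpa only [hx] using this
  refine (hasDerivAt_tsum_of_isPreconnected (𝕜 := ℝ) hsum Metric.isOpen_ball
    (convex_ball (0 : ℝ) 1).isPreconnected (g' := fun n t => c n * (((q - 2) + 1) *
      |a n + t * b n| ^ (q - 2) * b n)) ?_ ?_ (Metric.mem_ball_self one_pos) h0
      (Metric.mem_ball_self one_pos)).differentiableAt
  · intro n t _
    have h1 : HasDerivAt (fun t : ℝ => a n + t * b n) (b n) t := by
      simpa using ((hasDerivAt_id t).mul_const (b n)).const_add (a n)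
    exact ((hasDerivAt_mul_abs_rpow (by linarith : 0 < q - 2) _).comp t h1).const_mul (c n)
  · intro n t ht
    have ht1 : |t| ≤ 1 := by
      rw [Metric.mem_ball, dist_zero_right, Real.norm_eq_abs] at ht; exact ht.le
    set M := |c n| + |a n| + |b n| with hM
    have hM0 : 0 ≤ M := by positivity
    have h1 : |a n + t * b n| ≤ M := by
      refine (abs_add_le _ _).trans ?_
      rw [abs_mul]
      have := mul_le_mul_of_nonneg_right ht1 (abs_nonneg (b n))
      have := abs_nonneg (c n)
      linarith
    have hcM : |c n| ≤ M := by
      have := abs_nonneg (a n); have := abs_nonneg (b n); linarith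
    have hbM : |b n| ≤ M := by
      have := abs_nonneg (a n); have := abs_nonneg (c n); linarith
    have h2 : |a n + t * b n| ^ (q - 2) ≤ M ^ (q - 2) :=
      Real.rpow_le_rpow (abs_nonneg _) h1 (by linarith)
    have h3 : M * (M * M ^ (q - 2)) = M ^ q := by
      have := mul_self_mul_abs_rpow hq M
      rwa [abs_of_nonneg hM0] at this
    have hq1 : 0 ≤ q - 1 := by linarith
    rw [← h3, norm_mul, norm_mul, norm_mul, Real.norm_eq_abs, Real.norm_eq_abs, Real.norm_eq_abs,
      Real.norm_eq_abs, abs_of_nonneg (by linarith : 0 ≤ q - 2 + 1),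
      abs_of_nonneg (Real.rpow_nonneg (abs_nonneg (a n + t * b n)) (q - 2))]
    calc |c n| * ((q - 2 + 1) * |a n + t * b n| ^ (q - 2) * |b n|)
        ≤ M * ((q - 2 + 1) * M ^ (q - 2) * M) := by gcongr
      _ = (q - 1) * (M * (M * M ^ (q - 2))) := by ring

end

/-- A normed space whose norming points for functionals can be chosen so that they depend
weakly differentiably on the functional along lines. -/
def HasDifferentiableDualityMap (Y : Type*) [NormedAddCommGroup Y] [NormedSpace ℝ Y] : Prop :=
  ∃ J : (Y →L[ℝ] ℝ) → Y, (∀ f, f ≠ 0 → ‖J f‖ = 1 ∧ f (J f) = ‖f‖) ∧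
    ∀ f g h : Y →L[ℝ] ℝ, f ≠ 0 → DifferentiableAt ℝ (fun t : ℝ => g (J (f + t • h))) 0

lemma norm_comp_mkQL {M : Type*} [NormedAddCommGroup M] [NormedSpace ℝ M] (N : Submodule ℝ M)
    [IsClosed (N : Set M)] (f : M ⧸ N →L[ℝ] ℝ) : ‖f.comp N.mkQL‖ = ‖f‖ := by
  refine le_antisymm (ContinuousLinearMap.opNorm_le_bound _ (norm_nonneg f) fun x => ?_)
    (ContinuousLinearMap.opNorm_le_bound f (norm_nonneg (f.comp N.mkQL)) fun y => ?_)
  · exact (f.le_opNorm _).trans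
      (mul_le_mul_of_nonneg_left (Submodule.Quotient.norm_mk_le N x) (norm_nonneg f))
  · refine le_of_forall_pos_le_add fun ε hε => ?_
    obtain ⟨x, rfl, hx⟩ := Submodule.Quotient.norm_mk_lt (S := N) y
      (show 0 < ε / (‖f.comp N.mkQL‖ + 1) by positivity)
    have h1 := (f.comp N.mkQL).le_opNorm x
    refine h1.trans ?_
    have h2 := mul_le_mul_of_nonneg_left hx.le (norm_nonneg (f.comp N.mkQL))
    refine h2.trans ?_
    rw [mul_add]
    gcongr
    rw [mul_div_assoc', div_le_iff₀ (by positivity)]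
    nlinarith

lemma hasDifferentiableDualityMap_quotient_lp {p : ℝ≥0∞} (hp1 : 1 < p) (hp2 : p < 2)
    [Fact (1 ≤ p)] (N : Submodule ℝ (lp (fun _ : ℕ => ℝ) p))
    [IsClosed (N : Set (lp (fun _ : ℕ => ℝ) p))] :
    HasDifferentiableDualityMap (lp (fun _ : ℕ => ℝ) p ⧸ N) := by
  have hp : p ≠ ⊤ := (hp2.trans ENNReal.ofNat_lt_top).ne
  have h1 : 1 < p.toReal := by
    simpa using (ENNReal.toReal_lt_toReal ENNReal.one_ne_top hp).2 hp1
  have h2 : p.toReal < 2 := by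
    simpa using (ENNReal.toReal_lt_toReal hp ENNReal.ofNat_ne_top).2 hp2
  have hpq := Real.HolderConjugate.conjExponent h1
  set q := p.toReal.conjExponent with hq_def
  have hq : 2 < q := by
    rw [hq_def, Real.conjExponent, lt_div_iff₀ (by linarith)]; linarith
  set x := lpDualityMap hpq hq with hx
  have hF0 : ∀ f : lp (fun _ : ℕ => ℝ) p ⧸ N →L[ℝ] ℝ, f ≠ 0 → f.comp N.mkQL ≠ 0 :=
    fun f hf h => hf (ContinuousLinearMap.ext fun y => by
      obtain ⟨x, rfl⟩ := N.mkQ_surjective y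
      exact DFunLike.congr_fun h x)
  refine ⟨fun f => N.mkQL (‖x (f.comp N.mkQL)‖⁻¹ • x (f.comp N.mkQL)), fun f hf => ?_,
    fun f g h hf => ?_⟩
  · set F := f.comp N.mkQL with hF
    have hpos := apply_lpDualityMap_pos hpq hq F hp (hF0 f hf)
    have hmul := apply_lpDualityMap_eq hpq hq F hp
    have hxpos : 0 < ‖x F‖ := by
      refine (norm_nonneg _).lt_of_ne fun h => ?_
      rw [← hx, ← h, mul_zero] at hmul
      exact hpos.ne' hmul
    have hval : f (N.mkQL (‖x F‖⁻¹ • x F)) = ‖f‖ := by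
      change F (‖x F‖⁻¹ • x F) = ‖f‖
      rw [map_smul, hmul, hF, norm_comp_mkQL, ← hF, smul_eq_mul]
      field_simp
      rfl
    refine ⟨le_antisymm ?_ ?_, hval⟩
    · refine (Submodule.Quotient.norm_mk_le N _).trans ?_
      rw [norm_smul, norm_inv, norm_norm, inv_mul_cancel₀ hxpos.ne']
    · have h3 := (le_abs_self _).trans (f.le_opNorm (N.mkQL (‖x F‖⁻¹ • x F)))
      rw [hval] at h3
      have : 0 < ‖f‖ := norm_pos_iff.2 hf
      nlinarith
  · set F := f.comp N.mkQL with hF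
    set G := g.comp N.mkQL with hG
    set H := h.comp N.mkQL with hH
    have e : ∀ t : ℝ, (f + t • h).comp N.mkQL = F + t • H := fun t => by ext; rfl
    have hval : ∀ t : ℝ, g (N.mkQL (‖x ((f + t • h).comp N.mkQL)‖⁻¹ •
        x ((f + t • h).comp N.mkQL))) =
        ((F (x (F + t • H)) + t * H (x (F + t • H))) ^ (1 / p.toReal))⁻¹ * G (x (F + t • H)) := by
      intro t
      rw [e]
      change G (‖x (F + t • H)‖⁻¹ • x (F + t • H)) = _
      rw [map_smul, norm_lpDualityMap hpq hq _ hp]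
      simp [hx]
    simp only [hval]
    have hpos := apply_lpDualityMap_pos hpq hq F hp (hF0 f hf)
    have hdN : DifferentiableAt ℝ (fun t : ℝ => F (x (F + t • H)) + t * H (x (F + t • H))) 0 :=
      (differentiableAt_apply_lpDualityMap hpq hq F hp F H).add
        (differentiableAt_id.mul (differentiableAt_apply_lpDualityMap hpq hq F hp H H))
    have hN0 : (fun t : ℝ => F (x (F + t • H)) + t * H (x (F + t • H))) 0 ≠ 0 := by
      simpa [hx] using hpos.ne'
    refine DifferentiableAt.mul ((hdN.rpow_const (Or.inl hN0)).inv ?_)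
      (differentiableAt_apply_lpDualityMap hpq hq F hp G H)
    have : 0 < (fun t : ℝ => F (x (F + t • H)) + t * H (x (F + t • H))) 0 := by
      simpa [hx] using hpos
    exact (Real.rpow_pos_of_pos this _).ne'

section
variable {Y : Type*} [NormedAddCommGroup Y] [NormedSpace ℝ Y]

lemma eventually_add_smul_ne_zero {f : Y →L[ℝ] ℝ} (hf : f ≠ 0) (h : Y →L[ℝ] ℝ) :
    ∀ᶠ t : ℝ in nhds 0, f + t • h ≠ 0 := by
  have hc : Continuous fun t : ℝ => f + t • h := by fun_prop
  exact hc.continuousAt.eventually_ne (by simpa using hf)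

lemma differentiableAt_norm_of_dualityMap {J : (Y →L[ℝ] ℝ) → Y}
    (hJ1 : ∀ f, f ≠ 0 → ‖J f‖ = 1 ∧ f (J f) = ‖f‖)
    (hJ2 : ∀ f g h : Y →L[ℝ] ℝ, f ≠ 0 → DifferentiableAt ℝ (fun t : ℝ => g (J (f + t • h))) 0)
    {f : Y →L[ℝ] ℝ} (hf : f ≠ 0) (h : Y →L[ℝ] ℝ) :
    DifferentiableAt ℝ (fun t : ℝ => ‖f + t • h‖) 0 := by
  have hd : DifferentiableAt ℝ (fun t : ℝ => f (J (f + t • h)) + t * h (J (f + t • h))) 0 :=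
    (hJ2 f f h hf).add (differentiableAt_id.mul (hJ2 f h h hf))
  refine hd.congr_of_eventuallyEq ?_
  filter_upwards [eventually_add_smul_ne_zero hf h] with t ht
  rw [← (hJ1 _ ht).2]
  simp

lemma norming_point_unique {J : (Y →L[ℝ] ℝ) → Y}
    (hJ1 : ∀ f, f ≠ 0 → ‖J f‖ = 1 ∧ f (J f) = ‖f‖)
    (hJ2 : ∀ f g h : Y →L[ℝ] ℝ, f ≠ 0 → DifferentiableAt ℝ (fun t : ℝ => g (J (f + t • h))) 0)
    {f : Y →L[ℝ] ℝ} (hf : ‖f‖ = 1) {y : Y} (hy : ‖y‖ = 1) (hfy : f y = 1) : J f = y := by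
  have hf0 : f ≠ 0 := by rintro rfl; simp at hf
  rw [SeparatingDual.eq_iff_forall_dual_eq (R := ℝ)]
  intro h
  have key : ∀ x : Y, ‖x‖ = 1 → f x = 1 → deriv (fun t : ℝ => ‖f + t • h‖) 0 = h x := by
    intro x hx hfx
    have hd := (differentiableAt_norm_of_dualityMap hJ1 hJ2 hf0 h).hasDerivAt.sub
      ((hasDerivAt_id (0 : ℝ)).mul_const (h x))
    have hmin : IsLocalMin ((fun t : ℝ => ‖f + t • h‖) - fun t : ℝ => id t * h x) 0 := by
      refine Filter.Eventually.of_forall fun t => ?_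
      have := (le_abs_self _).trans ((f + t • h).le_opNorm x)
      simp [hx, hfx, hf] at this ⊢
      linarith
    have := hmin.hasDerivAt_eq_zero hd
    linarith
  rw [← key y hy hfy, ← key (J f) (hJ1 f hf0).1 ((hJ1 f hf0).2.trans hf)]

lemma apply_eq_zero_of_isMax {Z : Type*} [NormedAddCommGroup Z] [NormedSpace ℝ Z]
    (hY : HasDifferentiableDualityMap Y) (A : Y →L[ℝ] Y) (B : Z →L[ℝ] Y)
    {f : Y →L[ℝ] ℝ} (hf : ‖f‖ = 1) {y : Y} (hy : ‖y‖ = 1) (hfy : f y = 1) {z : Z} {σ : ℝ}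
    (hσ : σ ≠ 0)
    (hmax : ∀ (f' : Y →L[ℝ] ℝ) (y' : Y) (z' : Z), ‖f'‖ = 1 → ‖y'‖ = 1 → f' y' = 1 → ‖z'‖ ≤ 1 →
      σ * f' (A y' + B z') ≤ σ * f (A y + B z))
    {w : Z} (hw1 : ‖z + w‖ ≤ 1) (hw2 : ‖z - w‖ ≤ 1) : B w = 0 := by
  obtain ⟨J, hJ1, hJ2⟩ := hY
  have hf0 : f ≠ 0 := by rintro rfl; simp at hf
  have hJf : J f = y := norming_point_unique hJ1 hJ2 hf hy hfy
  have hfw : f (B w) = 0 := by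
    have h1 := hmax f y (z + w) hf hy hfy hw1
    have h2 := hmax f y (z - w) hf hy hfy hw2
    simp only [map_add, map_sub, mul_add, mul_sub] at h1 h2
    exact (mul_eq_zero.1 (by linarith : σ * f (B w) = 0)).resolve_left hσ
  rw [SeparatingDual.eq_zero_iff_forall_dual_eq_zero (R := ℝ)]
  intro h
  set m : ℝ → ℝ := fun t => σ * ((f (A (J (f + t • h))) + t * h (A (J (f + t • h)))) +
    (f (B z) + t * h (B z))) - ‖f + t • h‖ * (σ * f (A y + B z)) with hm
  have hmd : DifferentiableAt ℝ m 0 := by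
    refine DifferentiableAt.sub (DifferentiableAt.const_mul (DifferentiableAt.add
      ((hJ2 f (f.comp A) h hf0).add (differentiableAt_id.mul (hJ2 f (h.comp A) h hf0))) ?_) σ)
      ((differentiableAt_norm_of_dualityMap hJ1 hJ2 hf0 h).mul_const _)
    fun_prop
  have hm0 : m 0 = 0 := by simp [hm, hJf, hf]
  have hle : ∀ᶠ t : ℝ in nhds 0, m t + t * (σ * h (B w)) ≤ 0 ∧ m t - t * (σ * h (B w)) ≤ 0 := by
    filter_upwards [eventually_add_smul_ne_zero hf0 h] with t ht
    obtain ⟨hn, hv⟩ := hJ1 _ ht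
    have hpos : 0 < ‖f + t • h‖ := norm_pos_iff.2 ht
    have key : ∀ z' : Z, ‖z'‖ ≤ 1 → σ * ((f + t • h) (A (J (f + t • h)) + B z')) ≤
        ‖f + t • h‖ * (σ * f (A y + B z)) := by
      intro z' hz'
      have := hmax (‖f + t • h‖⁻¹ • (f + t • h)) (J (f + t • h)) z'
        (by rw [norm_smul, norm_inv, norm_norm, inv_mul_cancel₀ hpos.ne']) hn
        (by rw [_root_.smul_apply, hv, smul_eq_mul, inv_mul_cancel₀ hpos.ne']) hz'
      rw [_root_.smul_apply, smul_eq_mul, mul_left_comm, inv_mul_le_iff₀ hpos] at this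
      exact this
    have k1 := key _ hw1
    have k2 := key _ hw2
    simp only [_root_.add_apply, _root_.smul_apply, smul_eq_mul, map_add,
      map_sub, hfw] at k1 k2
    simp only [hm, map_add]
    constructor <;> linarith
  have hlin : HasDerivAt (fun t : ℝ => t * (σ * h (B w))) (σ * h (B w)) 0 := by
    simpa using (hasDerivAt_id (0 : ℝ)).mul_const (σ * h (B w))
  have e1 : deriv m 0 + σ * h (B w) = 0 :=
    IsLocalMax.hasDerivAt_eq_zero (f := m + fun t : ℝ => t * (σ * h (B w)))
      (hle.mono fun t ht => by simpa [hm0] using ht.1) (hmd.hasDerivAt.add hlin)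
  have e2 : deriv m 0 - σ * h (B w) = 0 :=
    IsLocalMax.hasDerivAt_eq_zero (f := m - fun t : ℝ => t * (σ * h (B w)))
      (hle.mono fun t ht => by simpa [hm0] using ht.2) (hmd.hasDerivAt.sub hlin)
  exact (mul_eq_zero.1 (by linarith : σ * h (B w) = 0)).resolve_left hσ

lemma C0_eventually_abs_le (z : C₀(ℕ, ℝ)) {ε : ℝ} (hε : 0 < ε) :
    ∃ k : ℕ, ∀ n, k ≤ n → |z n| ≤ ε := by
  have h : Filter.Tendsto z (Filter.cocompact ℕ) (nhds 0) := zero_at_infty z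
  rw [Filter.cocompact_eq_cofinite, Nat.cofinite_eq_atTop, Metric.tendsto_atTop] at h
  obtain ⟨k, hk⟩ := h ε hε
  exact ⟨k, fun n hn => by simpa using (hk n hn).le⟩

lemma C0_norm_le_iff (z : C₀(ℕ, ℝ)) {c : ℝ} (hc : 0 ≤ c) : ‖z‖ ≤ c ↔ ∀ n, |z n| ≤ c := by
  rw [← ZeroAtInftyContinuousMap.norm_toBCF_eq_norm, BoundedContinuousFunction.norm_le hc]
  rfl

lemma finiteDimensional_range_of_ker_le {E V W : Type*} [AddCommGroup E] [Module ℝ E]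
    [AddCommGroup V] [Module ℝ V] [FiniteDimensional ℝ V] [AddCommGroup W] [Module ℝ W]
    (ρ : E →ₗ[ℝ] V) (B : E →ₗ[ℝ] W) (h : LinearMap.ker ρ ≤ LinearMap.ker B) :
    FiniteDimensional ℝ (LinearMap.range B) := by
  have : FiniteDimensional ℝ (E ⧸ LinearMap.ker ρ) :=
    LinearEquiv.finiteDimensional ρ.quotKerEquivRange.symm
  rw [← Submodule.range_liftQ (LinearMap.ker ρ) B h]
  infer_instance

lemma finiteDimensional_range_of_forall_perturbation {Z : Type*} [NormedAddCommGroup Z]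
    [NormedSpace ℝ Z] (ι : Z →ₗᵢ[ℝ] C₀(ℕ, ℝ)) (B : Z →L[ℝ] Y) {z : Z} (hz : ‖z‖ ≤ 1)
    (hB : ∀ w : Z, ‖z + w‖ ≤ 1 → ‖z - w‖ ≤ 1 → B w = 0) :
    FiniteDimensional ℝ (LinearMap.range (B : Z →ₗ[ℝ] Y)) := by
  obtain ⟨k, hk⟩ := C0_eventually_abs_le (ι z) (ε := 1 / 2) (by norm_num)
  have hι : ∀ (w : Z) {c : ℝ}, 0 ≤ c → (‖w‖ ≤ c ↔ ∀ n, |ι w n| ≤ c) := fun w c hc => by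
    rw [← ι.norm_map, C0_norm_le_iff _ hc]
  have hz' := (hι z zero_le_one).1 hz
  let ρ : Z →ₗ[ℝ] (Fin k → ℝ) :=
    { toFun := fun w i => ι w i
      map_add' := fun _ _ => by ext; simp
      map_smul' := fun _ _ => by ext; simp }
  refine finiteDimensional_range_of_ker_le ρ (B : Z →ₗ[ℝ] Y) fun w hw => ?_
  have hw0 : ∀ n < k, ι w n = 0 := fun n hn => congrFun hw ⟨n, hn⟩
  have hs : 0 < 2 * (‖w‖ + 1) := by positivity
  set c : ℝ := (2 * (‖w‖ + 1))⁻¹ with hc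
  have hcw : ∀ n, |c * ι w n| ≤ 1 / 2 := by
    intro n
    have := (hι w (norm_nonneg _)).1 le_rfl n
    rw [abs_mul, hc, abs_of_pos (inv_pos.2 hs), inv_mul_le_iff₀ hs]
    linarith
  have hpm : ∀ n, |ι z n + c * ι w n| ≤ 1 ∧ |ι z n - c * ι w n| ≤ 1 := by
    intro n
    rcases lt_or_ge n k with hn | hn
    · simpa [hw0 n hn] using hz' n
    · have h1 := abs_le.1 (hk n hn)
      have h2 := abs_le.1 (hcw n)
      constructor <;> rw [abs_le] <;> constructor <;> linarith
  have h0 : B (c • w) = 0 := hB (c • w)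
    ((hι _ zero_le_one).2 fun n => by simpa using (hpm n).1)
    ((hι _ zero_le_one).2 fun n => by simpa using (hpm n).2)
  rw [map_smul, smul_eq_zero] at h0
  exact h0.resolve_left (inv_pos.2 hs).ne'

lemma le_numRadius {X : Type*} [NormedAddCommGroup X] [NormedSpace ℝ X] (S : X →L[ℝ] X)
    {x : X} {f : X →L[ℝ] ℝ} (hx : ‖x‖ = 1) (hf : ‖f‖ = 1) (hfx : f x = 1) :
    |f (S x)| ≤ numRadius S := by
  refine le_csSup ⟨‖S‖, ?_⟩ ⟨x, f, hx, hf, hfx, rfl⟩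
  rintro r ⟨y, g, hy, hg, -, rfl⟩
  have h1 := g.le_opNorm (S y)
  have h2 := S.le_opNorm y
  rw [hg, one_mul] at h1
  rw [hy, mul_one] at h2
  exact h1.trans h2

section
variable {Z : Type*} [NormedAddCommGroup Z] [NormedSpace ℝ Z]

lemma norm_eq_of_apply_le {X : Type*} [NormedAddCommGroup X] [NormedSpace ℝ X] {f : X →L[ℝ] ℝ}
    {x : X} {c : ℝ} (hx : ‖x‖ ≤ 1) (hfx : f x = c) (hle : ∀ y, ‖y‖ ≤ 1 → f y ≤ c) :
    ‖f‖ = c := by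
  have hc : 0 ≤ c := by simpa using hle 0 (by simp)
  refine le_antisymm (f.opNorm_le_of_unit_norm hc fun y hy => ?_) ?_
  · rw [Real.norm_eq_abs, abs_le]
    have := hle (-y) (by rw [norm_neg, hy])
    rw [map_neg] at this
    exact ⟨by linarith, hle y hy.le⟩
  · rw [← hfx]
    refine (le_abs_self _).trans ((f.le_opNorm x).trans ?_)
    exact mul_le_of_le_one_right (norm_nonneg _) hx

/-- The canonical inclusion of the second summand in `Y ⊕∞ Z`. -/
noncomputable def supInr (Y Z : Type*) [NormedAddCommGroup Y] [NormedSpace ℝ Y]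
    [NormedAddCommGroup Z] [NormedSpace ℝ Z] : Z →L[ℝ] WithLp ∞ (Y × Z) :=
  ((WithLp.prodContinuousLinearEquiv ∞ ℝ Y Z).symm : Y × Z →L[ℝ] WithLp ∞ (Y × Z)).comp
    (ContinuousLinearMap.inr ℝ Y Z)

/-- The canonical inclusion of the first summand in `Y ⊕∞ Z`. -/
noncomputable def supInl (Y Z : Type*) [NormedAddCommGroup Y] [NormedSpace ℝ Y]
    [NormedAddCommGroup Z] [NormedSpace ℝ Z] : Y →L[ℝ] WithLp ∞ (Y × Z) :=
  ((WithLp.prodContinuousLinearEquiv ∞ ℝ Y Z).symm : Y × Z →L[ℝ] WithLp ∞ (Y × Z)).comp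
    (ContinuousLinearMap.inl ℝ Y Z)

lemma supInl_add_supInr (x : WithLp ∞ (Y × Z)) :
    supInl Y Z (WithLp.fstL ∞ ℝ Y Z x) + supInr Y Z (WithLp.sndL ∞ ℝ Y Z x) = x := by
  refine (WithLp.prodContinuousLinearEquiv ∞ ℝ Y Z).injective ?_
  ext <;> simp [supInl, supInr]

lemma sup_norm_le {x : WithLp ∞ (Y × Z)} {c : ℝ} :
    ‖x‖ ≤ c ↔ ‖WithLp.fstL ∞ ℝ Y Z x‖ ≤ c ∧ ‖WithLp.sndL ∞ ℝ Y Z x‖ ≤ c := by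
  rw [WithLp.prod_norm_eq_sup]; exact sup_le_iff

@[simp] lemma fst_supInl (y : Y) : (supInl Y Z y).fst = y := rfl
@[simp] lemma fst_supInr (z : Z) : (supInr Y Z z).fst = 0 := rfl
@[simp] lemma snd_supInl (y : Y) : (supInl Y Z y).snd = 0 := rfl
@[simp] lemma snd_supInr (z : Z) : (supInr Y Z z).snd = z := rfl

lemma norm_supInl_add_supInr_le {y : Y} {z : Z} (hy : ‖y‖ ≤ 1) (hz : ‖z‖ ≤ 1) :
    ‖supInl Y Z y + supInr Y Z z‖ ≤ 1 := by
  rw [sup_norm_le]; simp [hy, hz]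

lemma abs_apply_fst_le_numRadius (S : CLM (WithLp ∞ (Y × Z))) {f : Y →L[ℝ] ℝ} {y : Y} {z : Z}
    (hf : ‖f‖ = 1) (hy : ‖y‖ = 1) (hfy : f y = 1) (hz : ‖z‖ ≤ 1) :
    |f (WithLp.fstL ∞ ℝ Y Z (S (supInl Y Z y + supInr Y Z z)))| ≤ numRadius S := by
  set x := supInl Y Z y + supInr Y Z z with hx
  set F := f.comp (WithLp.fstL ∞ ℝ Y Z) with hF
  have hFx : F x = 1 := by simp [hF, hx, hfy]
  have hx1 : ‖x‖ ≤ 1 := norm_supInl_add_supInr_le hy.le hz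
  refine le_numRadius S (f := F) (le_antisymm hx1 ?_)
    (norm_eq_of_apply_le hx1 hFx fun v hv => ?_) hFx
  · rw [← hy]; exact (le_of_eq (by simp [hx])).trans (sup_norm_le.1 (le_refl ‖x‖)).1
  · refine (le_abs_self _).trans ((f.le_opNorm _).trans ?_)
    rw [hf, one_mul]
    exact (sup_norm_le.1 hv).1

lemma finiteDimensional_range_of_attainsNumRadius (hY : HasDifferentiableDualityMap Y)
    (ι : Z →ₗᵢ[ℝ] C₀(ℕ, ℝ)) (S : CLM (WithLp ∞ (Y × Z))) (hS : AttainsNumRadius S) {η : ℝ}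
    (hη : ∀ x, ‖x‖ ≤ 1 → ‖(S x).snd‖ ≤ η) (hηS : η < numRadius S) :
    FiniteDimensional ℝ (LinearMap.range
      (((WithLp.fstL ∞ ℝ Y Z).comp (S.comp (supInr Y Z)) : Z →L[ℝ] Y) : Z →ₗ[ℝ] Y)) := by
  obtain ⟨x, f, hx, hf, hfx, hv⟩ := hS
  obtain ⟨hx1, hx2⟩ : ‖x.fst‖ ≤ 1 ∧ ‖x.snd‖ ≤ 1 := sup_norm_le.1 hx.le
  set y := x.fst
  set z := x.snd
  have hxyz : supInl Y Z y + supInr Y Z z = x := supInl_add_supInr x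
  set g := f.comp (supInl Y Z)
  set k := f.comp (supInr Y Z)
  have hgk : ∀ u : WithLp ∞ (Y × Z), f u = g u.fst + k u.snd := fun u => by
    conv_lhs => rw [← supInl_add_supInr u]
    rw [map_add]; rfl
  have hf1 : ∀ a b, ‖a‖ ≤ 1 → ‖b‖ ≤ 1 → g a + k b ≤ 1 := fun a b ha hb => by
    have h1 := (le_abs_self _).trans (f.le_opNorm (supInl Y Z a + supInr Y Z b))
    have h2 := norm_supInl_add_supInr_le ha hb
    rw [hf, one_mul, map_add] at h1
    exact h1.trans h2
  have hsum : g y + k z = 1 := by rw [← hfx, hgk]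
  have hgn : ‖g‖ = g y := norm_eq_of_apply_le hx1 rfl fun a ha => by
    linarith [hf1 a z ha hx2]
  have hkn : ‖k‖ = k z := norm_eq_of_apply_le hx2 rfl fun b hb => by
    linarith [hf1 y b hx1 hb]
  have hα0 : 0 ≤ g y := hgn ▸ norm_nonneg _
  have hβ0 : 0 ≤ k z := hkn ▸ norm_nonneg _
  rw [hgk] at hv
  have hksnd : |k (S x).snd| ≤ k z * η := by
    refine (k.le_opNorm _).trans ?_
    rw [hkn]
    exact mul_le_mul_of_nonneg_left (hη x hx.le) hβ0
  rcases hα0.eq_or_lt with h0 | hα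
  · have hg0 : g = 0 := by rw [← norm_eq_zero, hgn, ← h0]
    have hβ1 : k z = 1 := by linarith
    rw [hg0, zero_apply, zero_add] at hv
    rw [hβ1, one_mul] at hksnd
    linarith
  set e : Y →L[ℝ] ℝ := (g y)⁻¹ • g with he
  have hey : e y = 1 := by simp [he, hα.ne']
  have hen : ‖e‖ = 1 := by
    rw [he, norm_smul, hgn, norm_inv, Real.norm_of_nonneg hα0, inv_mul_cancel₀ hα.ne']
  have hyn : ‖y‖ = 1 := by
    refine le_antisymm hx1 ?_
    have := (le_abs_self _).trans (e.le_opNorm y)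
    rwa [hey, hen, one_mul] at this
  have hge : ∀ a, g a = g y * e a := fun a => by
    simp [he, hα.ne']
  have hle : |e (S x).fst| ≤ numRadius S := by
    have := abs_apply_fst_le_numRadius S hen hyn hey hx2
    rwa [hxyz] at this
  have heq : |e (S x).fst| = numRadius S := by
    refine le_antisymm hle ?_
    have h1 : |g (S x).fst + k (S x).snd| ≤ g y * |e (S x).fst| + k z * η := by
      refine (abs_add_le _ _).trans (add_le_add ?_ hksnd)
      rw [hge, abs_mul, abs_of_pos hα]
    rw [hv] at h1
    have h2 : k z * η ≤ k z * numRadius S := mul_le_mul_of_nonneg_left hηS.le hβ0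
    have h3 : g y * numRadius S ≤ g y * |e (S x).fst| := by
      have : numRadius S = g y * numRadius S + k z * numRadius S := by
        rw [← add_mul, hsum, one_mul]
      linarith
    exact le_of_mul_le_mul_left h3 hα
  obtain ⟨σ, hσ, hσe⟩ : ∃ σ : ℝ, |σ| = 1 ∧ σ * e (S x).fst = numRadius S := by
    rcases abs_choice (e (S x).fst) with h | h
    · exact ⟨1, by simp, by rw [one_mul, ← h, heq]⟩
    · exact ⟨-1, by simp, by rw [← heq, h]; ring⟩
  have hsplit : ∀ a b, ((WithLp.fstL ∞ ℝ Y Z).comp (S.comp (supInl Y Z))) a +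
      ((WithLp.fstL ∞ ℝ Y Z).comp (S.comp (supInr Y Z))) b =
      WithLp.fstL ∞ ℝ Y Z (S (supInl Y Z a + supInr Y Z b)) := fun a b => by
    simp
  refine finiteDimensional_range_of_forall_perturbation ι _ hx2 fun w hw1 hw2 =>
    apply_eq_zero_of_isMax hY ((WithLp.fstL ∞ ℝ Y Z).comp (S.comp (supInl Y Z))) _ hen hyn hey
      (σ := σ) (by rintro rfl; simp at hσ) (fun f' y' z' hf' hy' hfy' hz' => ?_) hw1 hw2
  rw [hsplit, hsplit, hxyz]
  refine le_trans ?_ hσe.ge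
  refine (le_abs_self _).trans ?_
  rw [abs_mul, hσ, one_mul]
  exact abs_apply_fst_le_numRadius S hf' hy' hfy' hz'

end
end

lemma exists_finite_net {E ι : Type*} [Fintype ι] (Φ : E → ι → ℝ) {s : Set E} {C : ℝ}
    (hC : ∀ e ∈ s, ∀ i, |Φ e i| ≤ C) {δ : ℝ} (hδ : 0 < δ) :
    ∃ t ⊆ s, t.Finite ∧ ∀ e ∈ s, ∃ e' ∈ t, ∀ i, |Φ e i - Φ e' i| ≤ δ := by
  have hb : TotallyBounded (Φ '' s) := by
    refine ((isCompact_univ_pi fun _ : ι => isCompact_Icc (a := -C) (b := C)).totallyBounded).subset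
      ?_
    rintro _ ⟨e, he, rfl⟩ i -
    exact abs_le.1 (hC e he i)
  obtain ⟨t, hts, htf, ht⟩ := Set.exists_subset_image_finite_and.1
    (Metric.finite_approx_of_totallyBounded hb δ hδ)
  refine ⟨t, hts, htf, fun e he => ?_⟩
  obtain ⟨_, ⟨e', he', rfl⟩, hd⟩ := Set.mem_iUnion₂.1 (ht ⟨e, he, rfl⟩)
  refine ⟨e', he', fun i => ?_⟩
  rw [← Real.dist_eq]
  exact (dist_le_pi_dist _ _ i).trans (Metric.mem_ball.1 hd).le

lemma exists_seq_of_finite_layers {V : Type*} [Zero V] {L : ℕ → Set V} (hL : ∀ k, (L k).Finite) :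
    ∃ f : ℕ → V, (∀ k, ∀ v ∈ L k, ∃ n, f n = v) ∧
      ∀ k, ∀ᶠ n in Filter.atTop, f n = 0 ∨ ∃ j, k ≤ j ∧ f n ∈ L j := by
  have : ∀ k, Countable (L k) := fun k => (hL k).countable.to_subtype
  have : ∀ k, Finite (L k) := fun k => (hL k).to_subtype
  obtain ⟨φ, hφ⟩ := Countable.exists_injective_nat (Σ k, L k)
  refine ⟨Function.extend φ (fun s => (s.2 : V)) 0, fun k v hv => ⟨φ ⟨k, v, hv⟩, ?_⟩, fun k => ?_⟩
  · rw [hφ.extend_apply]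
  · have hfin : (φ '' ⋃ j ∈ Set.Iio k, Set.range (Sigma.mk j)).Finite :=
      ((Set.finite_Iio k).biUnion fun j _ => Set.finite_range _).image φ
    rw [← Nat.cofinite_eq_atTop]
    filter_upwards [hfin.compl_mem_cofinite] with n hn
    by_cases h : ∃ s, φ s = n
    · obtain ⟨⟨j, v⟩, rfl⟩ := h
      refine Or.inr ⟨j, ?_, ?_⟩
      · by_contra hj
        exact hn ⟨_, Set.mem_biUnion (Set.mem_Iio.2 (not_le.1 hj)) ⟨v, rfl⟩, rfl⟩
      · rw [hφ.extend_apply]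
        exact v.2
    · exact Or.inl (Function.extend_apply' _ _ _ h)

section
variable {Y : Type*} [NormedAddCommGroup Y] [NormedSpace ℝ Y]

lemma exists_finite_dual_net {K : Set Y} (hK : IsCompact K) {ε : ℝ} (hε : 0 < ε) :
    ∃ F : Set (Y →L[ℝ] ℝ), F.Finite ∧
      ∀ h : Y →L[ℝ] ℝ, ‖h‖ ≤ 1 → ∃ g ∈ F, ∀ x ∈ K, |h x - g x| ≤ ε := by
  obtain ⟨t, htK, htf, ht⟩ := Metric.finite_approx_of_totallyBounded hK.totallyBounded (ε / 3)
    (by positivity)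
  obtain ⟨C, hC⟩ := hK.isBounded.exists_norm_le
  have := htf.fintype
  obtain ⟨F, hF1, hFf, hF⟩ := exists_finite_net (fun (h : Y →L[ℝ] ℝ) (i : t) => h i)
    (s := Metric.closedBall 0 1) (C := C) (fun h hh i => by
      refine (h.le_opNorm _).trans ((mul_le_of_le_one_left (norm_nonneg _) ?_).trans
        (hC _ (htK i.2)))
      simpa using hh) (show 0 < ε / 3 by positivity)
  refine ⟨F, hFf, fun h hh => ?_⟩
  obtain ⟨g, hg, hgh⟩ := hF h (by simpa using hh)
  refine ⟨g, hg, fun x hx => ?_⟩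
  obtain ⟨y, hy, hxy⟩ := Set.mem_iUnion₂.1 (ht hx)
  rw [Metric.mem_ball, dist_eq_norm] at hxy
  have hg1 : ‖g‖ ≤ 1 := by simpa using hF1 hg
  have hle : ∀ u : Y →L[ℝ] ℝ, ‖u‖ ≤ 1 → |u x - u y| ≤ ε / 3 := fun u hu => by
    rw [← map_sub]
    exact (u.le_opNorm _).trans ((mul_le_of_le_one_left (norm_nonneg _) hu).trans hxy.le)
  have h1 := abs_le.1 (hle h hh)
  have h2 := abs_le.1 (hle g hg1)
  have h3 := abs_le.1 (hgh ⟨y, hy⟩)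
  rw [abs_le]
  constructor <;> linarith [h1.1, h1.2, h2.1, h2.2, h3.1, h3.2]

lemma tendsto_apply_of_mem_span {K : Set Y} {u : ℕ → Y →L[ℝ] ℝ} {h : Y →L[ℝ] ℝ}
    (hu : ∀ x ∈ K, Filter.Tendsto (fun n => u n x) Filter.atTop (nhds (h x))) {y : Y}
    (hy : y ∈ Submodule.span ℝ K) :
    Filter.Tendsto (fun n => u n y) Filter.atTop (nhds (h y)) := by
  induction hy using Submodule.span_induction with
  | mem x hx => exact hu x hx
  | zero => simp
  | add x y _ _ hx hy => simpa using hx.add hy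
  | smul a x _ hx => simpa using hx.const_mul a

lemma exists_null_seq_of_isCompact {K : Set Y} (hK : IsCompact K) :
    ∃ (f : ℕ → Y →L[ℝ] ℝ) (F : ℕ → Set (Y →L[ℝ] ℝ)), (∀ k, (F k).Finite) ∧
      (∀ ε > 0, ∀ᶠ n in Filter.atTop, ∀ x ∈ K, |f n x| ≤ ε) ∧
      (∀ g ∈ F 0, ∃ n, f n = g) ∧
      ∀ (k : ℕ) (h : Y →L[ℝ] ℝ), ‖h‖ ≤ 1 → ∃ g ∈ F k, ∀ y ∈ Submodule.span ℝ K, ∀ M : ℝ,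
        (∀ n, |f n y| ≤ M) → |h y| ≤ |g y| + (1 / 2) ^ k * M := by
  choose F hFf hF using fun k : ℕ =>
    exists_finite_dual_net hK (show (0 : ℝ) < (1 / 4) ^ k by positivity)
  let D : ℕ → Set (Y →L[ℝ] ℝ) := fun k => (fun q : (Y →L[ℝ] ℝ) × (Y →L[ℝ] ℝ) =>
    (2 : ℝ) ^ (k + 1) • (q.2 - q.1)) ''
      {q ∈ F k ×ˢ F (k + 1) | ∀ x ∈ K, |q.2 x - q.1 x| ≤ 2 * (1 / 4) ^ k}
  let L : ℕ → Set (Y →L[ℝ] ℝ) := fun k => Nat.casesOn k (F 0) D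
  have hDf : ∀ k, (D k).Finite := fun k =>
    ((((hFf k).prod (hFf (k + 1))).subset (Set.sep_subset _ _)).image _)
  obtain ⟨f, hfL, hf⟩ := exists_seq_of_finite_layers (L := L)
    (fun k => by cases k with | zero => exact hFf 0 | succ k => exact hDf k)
  have hDK : ∀ k, ∀ v ∈ D k, ∀ x ∈ K, |v x| ≤ 4 * (1 / 2) ^ k := by
    rintro k _ ⟨q, ⟨-, hq⟩, rfl⟩ x hx
    have h1 := hq x hx
    have h2 : ((2 : ℝ) ^ (k + 1) • (q.2 - q.1)) x = 2 ^ (k + 1) * (q.2 x - q.1 x) := rfl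
    rw [h2, abs_mul, abs_of_pos (by positivity : (0 : ℝ) < 2 ^ (k + 1))]
    refine (mul_le_mul_of_nonneg_left h1 (by positivity)).trans_eq ?_
    rw [show (1 / 4 : ℝ) ^ k = (1 / 2) ^ k * (1 / 2) ^ k by rw [← mul_pow]; norm_num]
    have : (2 : ℝ) ^ k * (1 / 2) ^ k = 1 := by rw [← mul_pow]; norm_num
    linear_combination 4 * (1 / 2) ^ k * this
  refine ⟨f, F, hFf, fun ε hε => ?_, fun g hg => hfL 0 g hg, fun k h hh => ?_⟩
  · obtain ⟨m, hm⟩ := exists_pow_lt_of_lt_one (show 0 < ε / 4 by positivity)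
      (show (1 / 2 : ℝ) < 1 by norm_num)
    filter_upwards [hf (m + 1)] with n hn x hx
    rcases hn with hn | ⟨j, hj, hn⟩
    · simp [hn, hε.le]
    · obtain ⟨i, rfl⟩ : ∃ i, j = i + 1 := ⟨j - 1, by omega⟩
      refine (hDK i _ hn x hx).trans ?_
      have : (1 / 2 : ℝ) ^ i ≤ (1 / 2) ^ m :=
        pow_le_pow_of_le_one (by norm_num) (by norm_num) (by omega)
      linarith
  · choose g hgF hg using fun k => hF k h hh
    refine ⟨g k, hgF k, fun y hy M hM => ?_⟩
    have hstep : ∀ j, |g (j + 1) y - g j y| ≤ (1 / 2) ^ (j + 1) * M := by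
      intro j
      have hmem : (2 : ℝ) ^ (j + 1) • (g (j + 1) - g j) ∈ L (j + 1) := by
        refine ⟨(g j, g (j + 1)), ⟨⟨hgF j, hgF (j + 1)⟩, fun x hx => ?_⟩, rfl⟩
        have h1 := abs_le.1 (hg j x hx)
        have h2 := abs_le.1 (hg (j + 1) x hx)
        have h3 : (1 / 4 : ℝ) ^ (j + 1) ≤ (1 / 4) ^ j :=
          pow_le_pow_of_le_one (by norm_num) (by norm_num) (by omega)
        rw [abs_le]
        constructor <;> linarith [h1.1, h1.2, h2.1, h2.2]
      obtain ⟨n, hn⟩ := hfL (j + 1) _ hmem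
      have h4 := hM n
      have h5 : ((2 : ℝ) ^ (j + 1) • (g (j + 1) - g j)) y =
        2 ^ (j + 1) * (g (j + 1) y - g j y) := rfl
      rw [hn, h5, abs_mul, abs_of_pos (by positivity : (0 : ℝ) < 2 ^ (j + 1))] at h4
      rw [one_div, inv_pow, inv_mul_eq_div, le_div_iff₀ (by positivity), mul_comm]
      exact h4
    have htel : ∀ i, |g (k + i) y - g k y| ≤ ((1 / 2) ^ k - (1 / 2) ^ (k + i)) * M := by
      intro i
      induction i with
      | zero => simp
      | succ i ih =>
        have h1 := abs_le.1 (hstep (k + i))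
        have h2 := abs_le.1 ih
        rw [pow_succ] at h1
        rw [← add_assoc, pow_succ, abs_le]
        constructor <;> linarith [h1.1, h1.2, h2.1, h2.2]
    have hM0 : 0 ≤ M := (abs_nonneg _).trans (hM 0)
    have hlim : Filter.Tendsto (fun n => g n y) Filter.atTop (nhds (h y)) := by
      refine tendsto_apply_of_mem_span (fun x hx => ?_) hy
      refine tendsto_iff_dist_tendsto_zero.2 (squeeze_zero (fun _ => dist_nonneg) (fun n => ?_)
        (tendsto_pow_atTop_nhds_zero_of_lt_one (r := (1 / 4 : ℝ)) (by norm_num) (by norm_num)))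
      rw [dist_comm, Real.dist_eq]
      exact hg n x hx
    have hlim' := ((Filter.tendsto_add_atTop_iff_nat k).2 hlim).abs
    refine le_of_tendsto hlim' (Filter.Eventually.of_forall fun i => ?_)
    have h1 := htel i
    rw [add_comm k i] at h1
    have h2 : ((1 / 2) ^ k - (1 / 2) ^ (i + k)) * M ≤ (1 / 2) ^ k * M := by
      refine mul_le_mul_of_nonneg_right ?_ hM0
      have : (0 : ℝ) < (1 / 2) ^ (i + k) := by positivity
      linarith
    have h3 := abs_sub_abs_le_abs_sub (g (i + k) y) (g k y)
    linarith

lemma isCompactOperator_of_finite_functionals [CompleteSpace Y] {Z : Type*}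
    [NormedAddCommGroup Z] [NormedSpace ℝ Z] (T : Z →L[ℝ] Y) {F : ℕ → Set (Y →L[ℝ] ℝ)}
    (hFf : ∀ k, (F k).Finite)
    (hF : ∀ (k : ℕ) (h : Y →L[ℝ] ℝ), ‖h‖ ≤ 1 → ∃ g ∈ F k, ∀ z,
      |h (T z)| ≤ |g (T z)| + (1 / 2) ^ k * ‖z‖) : IsCompactOperator T := by
  have hTB : TotallyBounded (T '' Metric.closedBall 0 1) := by
    refine Metric.totallyBounded_iff.2 fun ε hε => ?_
    obtain ⟨k, hk⟩ := exists_pow_lt_of_lt_one (show 0 < ε / 4 by positivity)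
      (show (1 / 2 : ℝ) < 1 by norm_num)
    have := (hFf k).fintype
    obtain ⟨C, hC⟩ := ((hFf k).image fun g => ‖g.comp T‖).bddAbove
    obtain ⟨t, ht1, htf, ht⟩ := exists_finite_net (fun (z : Z) (g : F k) => (g : Y →L[ℝ] ℝ) (T z))
      (s := Metric.closedBall 0 1) (C := C) (fun z hz g =>
        ((((g : Y →L[ℝ] ℝ).comp T).le_opNorm z).trans
          (mul_le_of_le_one_right (norm_nonneg _) (by simpa using hz))).trans (hC ⟨g, g.2, rfl⟩))
      (show 0 < ε / 4 by positivity)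
    refine ⟨T '' t, htf.image T, ?_⟩
    rintro _ ⟨z, hz, rfl⟩
    obtain ⟨z', hz', hzz⟩ := ht z hz
    refine Set.mem_iUnion₂.2 ⟨T z', ⟨z', hz', rfl⟩, ?_⟩
    obtain ⟨h, hh, hval⟩ := exists_dual_vector'' ℝ (T (z - z'))
    obtain ⟨g, hg, hle⟩ := hF k h hh
    have h1 := hle (z - z')
    have h2 := hzz ⟨g, hg⟩
    have hn : ‖z - z'‖ ≤ 2 := by
      have h3 : ‖z‖ ≤ 1 := by simpa using hz
      have h4 : ‖z'‖ ≤ 1 := by simpa using ht1 hz'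
      linarith [norm_sub_le z z']
    have h5 : (1 / 2 : ℝ) ^ k * ‖z - z'‖ ≤ (1 / 2) ^ k * 2 :=
      mul_le_mul_of_nonneg_left hn (by positivity)
    rw [hval, RCLike.ofReal_real_eq_id, id, abs_norm] at h1
    simp only [← map_sub] at h2
    rw [Metric.mem_ball, dist_eq_norm, ← map_sub]
    linarith
  exact (isCompactOperator_iff_isCompact_closure_image_closedBall (T : Z →ₗ[ℝ] Y) zero_lt_one).2
    (hTB.closure.isCompact_of_isClosed isClosed_closure)

end

/-- The unit vectors of `c₀`. -/
noncomputable def C0single (m : ℕ) : C₀(ℕ, ℝ) where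
  toFun := Pi.single m 1
  continuous_toFun := continuous_of_discreteTopology
  zero_at_infty' := by
    rw [Filter.cocompact_eq_cofinite, Nat.cofinite_eq_atTop]
    refine tendsto_const_nhds.congr' ?_
    filter_upwards [Filter.eventually_gt_atTop m] with n hn
    exact (Pi.single_eq_of_ne (M := fun _ => ℝ) hn.ne' 1).symm

lemma sum_smul_C0single_apply (a : ℕ → ℝ) (n k : ℕ) :
    (∑ m ∈ Finset.range n, a m • C0single m) k = if k < n then a k else 0 := by
  induction n with
  | zero => simp
  | succ n ih =>
    have h : C0single n k = Pi.single (M := fun _ => ℝ) n 1 k := rfl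
    rw [Finset.sum_range_succ, ZeroAtInftyContinuousMap.add_apply, ih,
      ZeroAtInftyContinuousMap.smul_apply, h]
    rcases lt_trichotomy k n with hk | rfl | hk
    · simp [hk, hk.trans (Nat.lt_succ_self n), Pi.single_eq_of_ne hk.ne]
    · simp
    · simp [hk.not_gt, Nat.not_lt.2 hk, Pi.single_eq_of_ne hk.ne']

section
variable {Y : Type*} [NormedAddCommGroup Y] [NormedSpace ℝ Y]

lemma norm_apply_sub_sum_le (W : C₀(ℕ, ℝ) →L[ℝ] Y) (c : C₀(ℕ, ℝ)) {n : ℕ} {ε : ℝ} (hε : 0 ≤ ε)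
    (hc : ∀ m, n ≤ m → |c m| ≤ ε) :
    ‖W c - ∑ m ∈ Finset.range n, c m • W (C0single m)‖ ≤ ‖W‖ * ε := by
  have h : W c - ∑ m ∈ Finset.range n, c m • W (C0single m) =
      W (c - ∑ m ∈ Finset.range n, c m • C0single m) := by
    simp [map_sum]
  rw [h]
  refine (W.le_opNorm _).trans (mul_le_mul_of_nonneg_left ?_ (norm_nonneg _))
  refine (C0_norm_le_iff _ hε).2 fun k => ?_
  rw [ZeroAtInftyContinuousMap.sub_apply, sum_smul_C0single_apply]
  split_ifs with hk
  · simpa using hε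
  · simpa using hc k (not_lt.1 hk)

/-- The linear map into `c₀` given by a sequence of functionals which is pointwise null. -/
noncomputable def toC0 (E : Submodule ℝ Y) (f : ℕ → Y →L[ℝ] ℝ)
    (hf : ∀ y ∈ E, Filter.Tendsto (fun n => f n y) Filter.atTop (nhds 0)) : E →ₗ[ℝ] C₀(ℕ, ℝ) where
  toFun y :=
    { toFun := fun n => f n y
      continuous_toFun := continuous_of_discreteTopology
      zero_at_infty' := by
        rw [Filter.cocompact_eq_cofinite, Nat.cofinite_eq_atTop]
        exact hf y y.2 }
  map_add' x y := by ext n; simp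
  map_smul' a x := by ext n; simp

lemma finiteDimensional_range_sum_smulRight {X : Type*} [NormedAddCommGroup X] [NormedSpace ℝ X]
    (s : Finset ℕ) (f : ℕ → X →L[ℝ] ℝ) (v : ℕ → Y) :
    FiniteDimensional ℝ (LinearMap.range
      ((∑ m ∈ s, (f m).smulRight (v m) : X →L[ℝ] Y) : X →ₗ[ℝ] Y)) := by
  have : FiniteDimensional ℝ (Submodule.span ℝ (v '' s)) :=
    FiniteDimensional.span_of_finite ℝ (s.finite_toSet.image v)
  refine Submodule.finiteDimensional_of_le (S₂ := Submodule.span ℝ (v '' s)) ?_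
  rintro _ ⟨x, rfl⟩
  simp only [ContinuousLinearMap.coe_coe, sum_apply, ContinuousLinearMap.smulRight_apply]
  exact Submodule.sum_mem _ fun m hm =>
    Submodule.smul_mem _ _ (Submodule.subset_span ⟨m, hm, rfl⟩)

lemma exists_extension_of_finiteDimensional_range {Z X : Type*} [NormedAddCommGroup Z]
    [NormedSpace ℝ Z] [NormedAddCommGroup X] [NormedSpace ℝ X] (i : Z →ₗᵢ[ℝ] X) (R : Z →L[ℝ] Y)
    (hR : FiniteDimensional ℝ (LinearMap.range (R : Z →ₗ[ℝ] Y))) :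
    ∃ W : X →L[ℝ] Y, ∀ z, R z = W (i z) := by
  let R' : LinearMap.range i.toLinearMap →ₗ[ℝ] Y :=
    (R : Z →ₗ[ℝ] Y).comp (i.equivRange.symm.toLinearEquiv : _ →ₗ[ℝ] Z)
  have hRi : ∀ z, R' ⟨i z, z, rfl⟩ = R z := fun z =>
    congrArg R (i.equivRange.symm_apply_apply z)
  have hcont : Continuous R' := R.continuous.comp i.equivRange.symm.continuous
  have hfd : FiniteDimensional ℝ (LinearMap.range R') :=
    Submodule.finiteDimensional_of_le (LinearMap.range_comp_le_range _ _)
  obtain ⟨W, hW⟩ := ContinuousLinearMap.exist_extension_of_finiteDimensional_range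
    (⟨R', hcont⟩ : LinearMap.range i.toLinearMap →L[ℝ] Y)
  exact ⟨W, fun z => (hRi z).symm.trans (DFunLike.congr_fun hW ⟨i z, z, rfl⟩)⟩

/-- The bounded linear maps between two normed spaces, with instances resolved through the
norm structures. -/
abbrev NormedCLM (X Y : Type*) [NormedAddCommGroup X] [NormedSpace ℝ X]
    [NormedAddCommGroup Y] [NormedSpace ℝ Y] := X →L[ℝ] Y

lemma exists_isCompactOperator_not_approximable_of_dense [CompleteSpace Y] {K : Set Y}
    (hK : IsCompact K) {ε : ℝ} (hε : 0 < ε)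
    (hKε : ∀ R : Y →L[ℝ] Y, FiniteDimensional ℝ (LinearMap.range (R : Y →ₗ[ℝ] Y)) →
      ∃ x ∈ K, ε ≤ ‖x - R x‖)
    {f : ℕ → Y →L[ℝ] ℝ} {F : ℕ → Set (Y →L[ℝ] ℝ)} (hFf : ∀ k, (F k).Finite)
    (hfK : ∀ ε > 0, ∀ᶠ n in Filter.atTop, ∀ x ∈ K, |f n x| ≤ ε)
    (hF0 : ∀ g ∈ F 0, ∃ n, f n = g)
    (hF : ∀ (k : ℕ) (h : Y →L[ℝ] ℝ), ‖h‖ ≤ 1 → ∃ g ∈ F k, ∀ y ∈ Submodule.span ℝ K, ∀ M : ℝ,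
      (∀ n, |f n y| ≤ M) → |h y| ≤ |g y| + (1 / 2) ^ k * M)
    {Z : Type*} [NormedAddCommGroup Z] [NormedSpace ℝ Z] (i : Z →ₗᵢ[ℝ] C₀(ℕ, ℝ))
    (e : Submodule.span ℝ K →ₗ[ℝ] Z) (hdense : DenseRange e)
    (hie : ∀ y n, i (e y) n = f n y) :
    ∃ T : Z →L[ℝ] Y, IsCompactOperator T ∧ ∃ δ > 0, ∀ R : Z →L[ℝ] Y,
      FiniteDimensional ℝ (LinearMap.range (R : Z →ₗ[ℝ] Y)) → δ ≤ ‖T - R‖ := by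
  have hnorm : ∀ (y : Submodule.span ℝ K) {c : ℝ}, 0 ≤ c → (‖e y‖ ≤ c ↔ ∀ n, |f n y| ≤ c) :=
    fun y c hc => by
      rw [← i.norm_map, C0_norm_le_iff _ hc]
      simp only [hie]
  have hle_norm : ∀ (y : Submodule.span ℝ K) n, |f n y| ≤ ‖e y‖ := fun y =>
    (hnorm y (norm_nonneg _)).1 le_rfl
  have hbound : ∃ C, ∀ y, ‖(Submodule.span ℝ K).subtype y‖ ≤ C * ‖e y‖ := by
    refine ⟨2, fun y => ?_⟩
    obtain ⟨h, hh, hval⟩ := exists_dual_vector'' ℝ (y : Y)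
    obtain ⟨g, hg, hle⟩ := hF 0 h hh
    obtain ⟨n, rfl⟩ := hF0 g hg
    have h1 := hle y y.2 _ (hle_norm y)
    have h2 := hle_norm y n
    rw [hval, RCLike.ofReal_real_eq_id, id, abs_norm] at h1
    rw [Submodule.subtype_apply]
    linarith
  let T : Z →L[ℝ] Y := (Submodule.span ℝ K).subtype.extendOfNorm e
  have hT : ∀ y : Submodule.span ℝ K, T (e y) = y := fun y =>
    LinearMap.extendOfNorm_eq hdense hbound y
  refine ⟨T, ?_, ?_⟩
  · refine isCompactOperator_of_finite_functionals T hFf fun k h hh => ?_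
    obtain ⟨g, hg, hle⟩ := hF k h hh
    refine ⟨g, hg, fun z => ?_⟩
    refine hdense.induction_on z (isClosed_le (by fun_prop) (by fun_prop)) fun y => ?_
    rw [hT]
    exact hle y y.2 _ (hle_norm y)
  · obtain ⟨M, hM0, hM⟩ : ∃ M : ℝ, 0 < M ∧ ∀ y : Submodule.span ℝ K, (y : Y) ∈ K → ‖e y‖ ≤ M := by
      obtain ⟨n, hn⟩ := Filter.eventually_atTop.1 (hfK 1 one_pos)
      obtain ⟨C, hC⟩ := hK.isBounded.exists_norm_le
      have hpos : 0 ≤ ∑ m ∈ Finset.range n, ‖f m‖ * |C| := by positivity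
      refine ⟨1 + ∑ m ∈ Finset.range n, ‖f m‖ * |C|, by positivity, fun y hy => ?_⟩
      refine (hnorm y (by positivity)).2 fun m => ?_
      rcases lt_or_ge m n with hm | hm
      · have h1 := (f m).le_opNorm y
        have h2 : ‖f m‖ * ‖(y : Y)‖ ≤ ‖f m‖ * |C| :=
          mul_le_mul_of_nonneg_left ((hC y hy).trans (le_abs_self C)) (norm_nonneg _)
        have h3 := Finset.single_le_sum (f := fun m => ‖f m‖ * |C|) (fun _ _ => by positivity)
          (Finset.mem_range.2 hm)
        rw [Real.norm_eq_abs] at h1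
        linarith
      · linarith [hn m hm y hy]
    refine ⟨ε / 2 / M, by positivity, fun R hR => ?_⟩
    obtain ⟨W, hW⟩ := exists_extension_of_finiteDimensional_range i R hR
    obtain ⟨n, hn⟩ := Filter.eventually_atTop.1
      (hfK (ε / 2 / (‖W‖ + 1)) (by positivity))
    obtain ⟨x, hx, hxε⟩ := hKε _ (finiteDimensional_range_sum_smulRight (Finset.range n) f
      fun m => W (C0single m))
    let y : Submodule.span ℝ K := ⟨x, Submodule.subset_span hx⟩
    have hRy : R (e y) = W (i (e y)) := by rw [hW]
    have h1 : ‖W (i (e y)) - ∑ m ∈ Finset.range n, f m x • W (C0single m)‖ ≤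
        ‖W‖ * (ε / 2 / (‖W‖ + 1)) := by
      have := norm_apply_sub_sum_le W (i (e y)) (n := n) (ε := ε / 2 / (‖W‖ + 1)) (by positivity)
        fun m hm => by rw [hie]; exact hn m hm x hx
      simpa only [hie] using this
    have h2 : ‖W‖ * (ε / 2 / (‖W‖ + 1)) ≤ ε / 2 := by
      rw [mul_div_assoc', div_le_iff₀ (by positivity)]
      nlinarith [norm_nonneg W]
    have h3 : ‖x - W (i (e y))‖ ≤ ‖T - R‖ * M := by
      rw [← hRy, show x = T (e y) from (hT y).symm, ← sub_apply]
      exact ((T - R).le_opNorm _).trans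
        (mul_le_mul_of_nonneg_left (hM y hx) (norm_nonneg _))
    simp only [sum_apply, ContinuousLinearMap.smulRight_apply] at hxε
    rw [div_le_iff₀ hM0]
    have h4 := norm_add_le (x - W (i (e y)))
      (W (i (e y)) - ∑ m ∈ Finset.range n, f m x • W (C0single m))
    rw [sub_add_sub_cancel] at h4
    linarith

lemma exists_isCompactOperator_not_approximable [CompleteSpace Y]
    (hY : ¬ HasApproximationProperty Y) :
    ∃ Z : Submodule ℝ C₀(ℕ, ℝ), IsClosed (Z : Set C₀(ℕ, ℝ)) ∧
      ∃ T : NormedCLM Z Y, IsCompactOperator T ∧ ∃ δ > 0, ∀ R : NormedCLM Z Y,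
        FiniteDimensional ℝ (LinearMap.range (R : Z →ₗ[ℝ] Y)) → δ ≤ ‖T - R‖ := by
  simp only [HasApproximationProperty, not_forall, not_exists, not_and, not_lt, exists_prop] at hY
  obtain ⟨K, hK, ε, hε, hKε⟩ := hY
  obtain ⟨f, F, hFf, hfK, hF0, hF⟩ := exists_null_seq_of_isCompact hK
  set E := Submodule.span ℝ K
  have hfE : ∀ y ∈ E, Filter.Tendsto (fun n => f n y) Filter.atTop (nhds 0) := fun y hy => by
    refine tendsto_apply_of_mem_span (h := 0) (fun x hx => ?_) hy
    rw [zero_apply, Metric.tendsto_nhds]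
    intro η hη
    filter_upwards [hfK (η / 2) (by positivity)] with n hn
    rw [Real.dist_eq, sub_zero]
    linarith [hn x hx]
  set ι := toC0 E f hfE
  set Z := (LinearMap.range ι).topologicalClosure
  let e : E →ₗ[ℝ] Z := ι.codRestrict Z fun y =>
    (LinearMap.range ι).le_topologicalClosure ⟨y, rfl⟩
  have hdense : DenseRange e := by
    intro z
    rw [closure_subtype, ← Set.range_comp]
    exact z.2
  exact ⟨Z, (LinearMap.range ι).isClosed_topologicalClosure,
    exists_isCompactOperator_not_approximable_of_dense hK hε hKε hFf hfK hF0 hF Z.subtypeₗᵢ e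
      hdense fun _ _ => rfl⟩

end

lemma supInl_comp_notMem_closure_attainsNumRadius {Y Z : Type*} [NormedAddCommGroup Y]
    [NormedSpace ℝ Y] [NormedAddCommGroup Z] [NormedSpace ℝ Z]
    (hY : HasDifferentiableDualityMap Y) (ι : Z →ₗᵢ[ℝ] C₀(ℕ, ℝ)) (T : Z →L[ℝ] Y) {δ : ℝ}
    (hδ : 0 < δ) (hT : ∀ R : Z →L[ℝ] Y,
      FiniteDimensional ℝ (LinearMap.range (R : Z →ₗ[ℝ] Y)) → δ ≤ ‖T - R‖) :
    (supInl Y Z).comp (T.comp (WithLp.sndL ∞ ℝ Y Z)) ∉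
      closure {S : CLM (WithLp ∞ (Y × Z)) | AttainsNumRadius S} := by
  intro hmem
  obtain ⟨z, hz, hTz⟩ : ∃ z : Z, ‖z‖ ≤ 1 ∧ T z ≠ 0 := by
    by_contra! h
    have h0 : T = 0 := norm_eq_zero.1 (le_antisymm
      (T.opNorm_le_of_unit_norm le_rfl fun z hz => by simp [h z hz.le]) (norm_nonneg _))
    have := hT 0 (by
      rw [ContinuousLinearMap.toLinearMap_zero, LinearMap.range_zero]
      infer_instance)
    rw [h0, sub_zero, norm_zero] at this
    exact hδ.not_ge this
  have hTz0 : 0 < ‖T z‖ := norm_pos_iff.2 hTz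
  set η := min (δ / 2) (‖T z‖ / 3) with hη
  have hη0 : 0 < η := by positivity
  have hη1 : η < δ := (min_le_left _ _).trans_lt (by linarith)
  have hη2 : η ≤ ‖T z‖ / 3 := min_le_right _ _
  obtain ⟨S, hS, hdist⟩ := Metric.mem_closure_iff.1 hmem η hη0
  set U : CLM (WithLp ∞ (Y × Z)) := (supInl Y Z).comp (T.comp (WithLp.sndL ∞ ℝ Y Z)) with hU
  have hUa : ∀ x, U x = supInl Y Z (T x.snd) := fun _ => rfl
  rw [dist_eq_norm] at hdist
  have hdiff : ∀ x, ‖x‖ ≤ 1 → ‖U x - S x‖ ≤ η := fun x hx =>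
    (((U - S).le_opNorm x).trans (mul_le_of_le_one_right (norm_nonneg _) hx)).trans hdist.le
  have hsnd : ∀ x, ‖x‖ ≤ 1 → ‖(S x).snd‖ ≤ η := fun x hx => by
    have := (sup_norm_le.1 (hdiff x hx)).2
    simpa [hUa] using this
  have hfst : ∀ x, ‖x‖ ≤ 1 → ‖T x.snd - (S x).fst‖ ≤ η := fun x hx => by
    have := (sup_norm_le.1 (hdiff x hx)).1
    simpa [hUa] using this
  have hrad : η < numRadius S := by
    obtain ⟨g, hg, hgT⟩ := exists_dual_vector ℝ (T z) hTz0.ne'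
    rw [RCLike.ofReal_real_eq_id, id] at hgT
    obtain ⟨J, hJ, -⟩ := hY
    have hg0 : g ≠ 0 := by rintro rfl; simp at hg
    obtain ⟨hJ1, hJ2⟩ := hJ g hg0
    have h1 := abs_apply_fst_le_numRadius S hg hJ1 (hJ2.trans hg) hz
    set x := supInl Y Z (J g) + supInr Y Z z with hx
    have h2 := hfst x (norm_supInl_add_supInr_le hJ1.le hz)
    have hxz : x.snd = z := by simp [hx]
    rw [hxz] at h2
    have h3 := (le_abs_self _).trans (g.le_opNorm (T z - (S x).fst))
    rw [hg, one_mul, map_sub, hgT] at h3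
    have h4 := le_abs_self (g (S x).fst)
    change |g (S x).fst| ≤ _ at h1
    linarith
  have hfin := finiteDimensional_range_of_attainsNumRadius hY ι S hS hsnd hrad
  have hle : ‖T - (WithLp.fstL ∞ ℝ Y Z).comp (S.comp (supInr Y Z))‖ ≤ η := by
    refine ContinuousLinearMap.opNorm_le_of_unit_norm hη0.le fun w hw => ?_
    have hw1 : ‖supInr Y Z w‖ ≤ 1 := sup_norm_le.2 ⟨by simp, by simp [hw]⟩
    exact hfst _ hw1
  linarith [hT _ hfin]

set_option maxHeartbeats 2000000 in
set_option synthInstance.maxHeartbeats 1000000 in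
/-- Given `1 < p < 2` and a quotient `Y` of `ℓ_p` failing the approximation property,
there is a closed subspace `Z` of `c₀` such that some compact operator on
`X = Y ⊕∞ Z` is not in the operator-norm closure of the numerical radius attaining
operators on `X`. -/
theorem compact_not_approx_NRA_of_quotient_lp_without_AP
    (p : ℝ≥0∞) (hp1 : 1 < p) (hp2 : p < 2) [Fact (1 ≤ p)]
    (N : Submodule ℝ (lp (fun _ : ℕ => ℝ) p)) [IsClosed (N : Set (lp (fun _ : ℕ => ℝ) p))]
    (hY : ¬ HasApproximationProperty (lp (fun _ : ℕ => ℝ) p ⧸ N)) :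
    ∃ Z : Submodule ℝ C₀(ℕ, ℝ), IsClosed (Z : Set C₀(ℕ, ℝ)) ∧
      ∃ T : CLM (WithLp ∞ ((lp (fun _ : ℕ => ℝ) p ⧸ N) × Z)),
        IsCompactOperator T ∧
          T ∉ closure {S : CLM (WithLp ∞ ((lp (fun _ : ℕ => ℝ) p ⧸ N) × Z)) |
            AttainsNumRadius S} := by
  obtain ⟨Z, hZ, T, hTc, δ, hδ, hT⟩ := exists_isCompactOperator_not_approximable hY
  exact ⟨Z, hZ, _, (hTc.comp_clm (WithLp.sndL ∞ ℝ _ Z)).clm_comp (supInl _ Z),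
    supInl_comp_notMem_closure_attainsNumRadius
      (hasDifferentiableDualityMap_quotient_lp hp1 hp2 N) Z.subtypeₗᵢ T hδ hT⟩
end

section
/- Let Y and Z be real Banach spaces, let X = Y ⊕∞ Z, and let P_Y and P_Z be the canonical projections from X onto Y and Z respectively (viewed as operators on X). Then for every bounded linear operator T on X, v(T) = max( v(P_Y T), v(P_Z T) ). -/
open scoped ENNReal

section NumRadius

variable {X : Type*} [NormedAddCommGroup X] [NormedSpace ℝ X]

theorem abs_apply_le_numRadius (T : X →L[ℝ] X) {x : X} {f : X →L[ℝ] ℝ}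
    (hx : ‖x‖ = 1) (hf : ‖f‖ = 1) (hfx : f x = 1) : |f (T x)| ≤ numRadius T := by
  refine le_csSup ⟨‖T‖, ?_⟩ ⟨x, f, hx, hf, hfx, rfl⟩
  rintro r ⟨x, f, hx, hf, -, rfl⟩
  have h₁ := f.le_opNorm (T x)
  have h₂ := T.le_opNorm x
  rw [hf, one_mul, Real.norm_eq_abs] at h₁
  rw [hx, mul_one] at h₂
  exact h₁.trans h₂

theorem numRadius_nonneg (T : X →L[ℝ] X) : 0 ≤ numRadius T := by
  refine Real.sSup_nonneg ?_
  rintro r ⟨x, f, -, -, -, rfl⟩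
  exact abs_nonneg _

theorem numRadius_le {T : X →L[ℝ] X} {c : ℝ} (hc : 0 ≤ c)
    (h : ∀ (x : X) (f : X →L[ℝ] ℝ), ‖x‖ = 1 → ‖f‖ = 1 → f x = 1 → |f (T x)| ≤ c) :
    numRadius T ≤ c := by
  refine Real.sSup_le ?_ hc
  rintro r ⟨x, f, hx, hf, hfx, rfl⟩
  exact h x f hx hf hfx

/-- A functional attaining its norm at a unit vector bounds values of `T` there by
the numerical radius, up to the norm of the functional. -/
theorem abs_apply_le_norm_mul_numRadius (T : X →L[ℝ] X) {x : X} {f : X →L[ℝ] ℝ}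
    (hx : ‖x‖ = 1) (hfx : f x = ‖f‖) : |f (T x)| ≤ ‖f‖ * numRadius T := by
  rcases eq_or_ne f 0 with rfl | hf
  · simp
  have hf' : 0 < ‖f‖ := norm_pos_iff.mpr hf
  have h := abs_apply_le_numRadius T (f := ‖f‖⁻¹ • f) hx
    (by rw [norm_smul, norm_inv, norm_norm, inv_mul_cancel₀ hf'.ne'])
    (by simp [hfx, hf'.ne'])
  simp only [smul_apply, smul_eq_mul, abs_mul, abs_inv, abs_norm] at h
  rwa [inv_mul_le_iff₀ hf'] at h

variable {P Q : X →L[ℝ] X}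

theorem norm_comp_add_norm_comp_le (hmax : ∀ x y, ‖P x + Q y‖ ≤ max ‖x‖ ‖y‖)
    (f : X →L[ℝ] ℝ) : ‖f ∘L P‖ + ‖f ∘L Q‖ ≤ ‖f‖ := by
  have key (x y : X) (hx : ‖x‖ ≤ 1) (hy : ‖y‖ ≤ 1) : f (P x) + f (Q y) ≤ ‖f‖ := by
    rw [← map_add]
    refine (le_abs_self _).trans (f.le_of_opNorm_le_of_le le_rfl
      ((hmax x y).trans (max_le hx hy)) |>.trans_eq (mul_one _))
  have bound (g : X →L[ℝ] ℝ) (c : ℝ) (h : ∀ x, ‖x‖ ≤ 1 → g x ≤ c) : ‖g‖ ≤ c := by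
    have hc : 0 ≤ c := by simpa using h 0 (by simp)
    refine g.opNorm_le_of_unit_norm hc fun x hx ↦ abs_le.mpr ⟨?_, h x hx.le⟩
    have := h (-x) (by rw [norm_neg, hx])
    rw [map_neg] at this
    linarith
  have hP (y : X) (hy : ‖y‖ ≤ 1) : ‖f ∘L P‖ ≤ ‖f‖ - f (Q y) :=
    bound _ _ fun x hx ↦ le_sub_iff_add_le.mpr (key x y hx hy)
  have hQ : ‖f ∘L Q‖ ≤ ‖f‖ - ‖f ∘L P‖ :=
    bound _ _ fun y hy ↦ le_sub_comm.mp (hP y hy)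
  linarith

theorem apply_eq_norm_comp (hadd : ∀ x, P x + Q x = x)
    (hmax : ∀ x y, ‖P x + Q y‖ ≤ max ‖x‖ ‖y‖) {x : X} {f : X →L[ℝ] ℝ}
    (hx : ‖x‖ = 1) (hfx : f x = ‖f‖) : f (P x) = ‖f ∘L P‖ ∧ f (Q x) = ‖f ∘L Q‖ := by
  have le_norm (g : X →L[ℝ] ℝ) : g x ≤ ‖g‖ := by
    simpa [hx] using (le_abs_self _).trans (g.le_opNorm x)
  have hP : f (P x) ≤ ‖f ∘L P‖ := le_norm (f ∘L P)
  have hQ : f (Q x) ≤ ‖f ∘L Q‖ := le_norm (f ∘L Q)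
  have hsum := norm_comp_add_norm_comp_le hmax f
  have hval : f (P x) + f (Q x) = ‖f‖ := by rw [← map_add, hadd, hfx]
  constructor <;> linarith

theorem numRadius_comp_le (hadd : ∀ x, P x + Q x = x)
    (hmax : ∀ x y, ‖P x + Q y‖ ≤ max ‖x‖ ‖y‖) (T : X →L[ℝ] X) :
    numRadius (P ∘L T) ≤ numRadius T := by
  refine numRadius_le (numRadius_nonneg T) fun x f hx hf hfx ↦ ?_
  have hval := (apply_eq_norm_comp hadd hmax hx (hfx.trans hf.symm)).1
  have hnorm := norm_comp_add_norm_comp_le hmax f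
  have hle : ‖f ∘L P‖ ≤ 1 := by linarith [norm_nonneg (f ∘L Q)]
  exact (abs_apply_le_norm_mul_numRadius T (f := f ∘L P) hx hval).trans
    (mul_le_of_le_one_left (numRadius_nonneg T) hle)

theorem numRadius_le_max_comp (hadd : ∀ x, P x + Q x = x)
    (hmax : ∀ x y, ‖P x + Q y‖ ≤ max ‖x‖ ‖y‖) (hP : ∀ x, P (P x) = P x)
    (hQ : ∀ x, Q (Q x) = Q x) (T : X →L[ℝ] X) :
    numRadius T ≤ max (numRadius (P ∘L T)) (numRadius (Q ∘L T)) := by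
  set m := max (numRadius (P ∘L T)) (numRadius (Q ∘L T))
  have hm₀ : 0 ≤ m := (numRadius_nonneg _).trans (le_max_left _ _)
  refine numRadius_le hm₀ fun x f hx hf hfx ↦ ?_
  obtain ⟨hvP, hvQ⟩ := apply_eq_norm_comp hadd hmax hx (hfx.trans hf.symm)
  have hnorm := norm_comp_add_norm_comp_le hmax f
  have h₁ := abs_apply_le_norm_mul_numRadius (P ∘L T) (f := f ∘L P) hx hvP
  have h₂ := abs_apply_le_norm_mul_numRadius (Q ∘L T) (f := f ∘L Q) hx hvQ
  simp only [ContinuousLinearMap.comp_apply, hP, hQ] at h₁ h₂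
  calc |f (T x)| = |f (P (T x)) + f (Q (T x))| := by rw [← map_add, hadd]
    _ ≤ |f (P (T x))| + |f (Q (T x))| := abs_add_le _ _
    _ ≤ ‖f ∘L P‖ * m + ‖f ∘L Q‖ * m := by
      gcongr
      · exact h₁.trans (by gcongr; exact le_max_left _ _)
      · exact h₂.trans (by gcongr; exact le_max_right _ _)
    _ = (‖f ∘L P‖ + ‖f ∘L Q‖) * m := by ring
    _ ≤ m := mul_le_of_le_one_left hm₀ (hnorm.trans_eq hf)

end NumRadius

/-- For `X = Y ⊕∞ Z` and the canonical projections `P_Y`, `P_Z` from `X` onto `Y` and `Z`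
(viewed as operators on `X`), every bounded linear operator `T` on `X` satisfies
`v(T) = max (v (P_Y T)) (v (P_Z T))`. -/
theorem numRadius_eq_max_of_prodLinfty
    {Y : Type*} [NormedAddCommGroup Y] [NormedSpace ℝ Y] [CompleteSpace Y]
    {Z : Type*} [NormedAddCommGroup Z] [NormedSpace ℝ Z] [CompleteSpace Z]
    (PY PZ : WithLp ∞ (Y × Z) →L[ℝ] WithLp ∞ (Y × Z))
    (hPY : ∀ x : WithLp ∞ (Y × Z), PY x =
      (WithLp.prodContinuousLinearEquiv ∞ ℝ Y Z).symm
        (((WithLp.prodContinuousLinearEquiv ∞ ℝ Y Z) x).1, 0))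
    (hPZ : ∀ x : WithLp ∞ (Y × Z), PZ x =
      (WithLp.prodContinuousLinearEquiv ∞ ℝ Y Z).symm
        (0, ((WithLp.prodContinuousLinearEquiv ∞ ℝ Y Z) x).2))
    (T : WithLp ∞ (Y × Z) →L[ℝ] WithLp ∞ (Y × Z)) :
    numRadius T = max (numRadius (PY ∘L T)) (numRadius (PZ ∘L T)) := by
  have hadd (x : WithLp ∞ (Y × Z)) : PY x + PZ x = x := by
    rw [hPY, hPZ, ← map_add, ContinuousLinearEquiv.symm_apply_eq,
      Prod.mk_add_mk, add_zero, zero_add]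
  have hmax (x y : WithLp ∞ (Y × Z)) : ‖PY x + PZ y‖ ≤ max ‖x‖ ‖y‖ := by
    rw [hPY, hPZ, ← map_add, WithLp.prod_norm_eq_sup, WithLp.prod_norm_eq_sup x,
      WithLp.prod_norm_eq_sup y]
    simpa using sup_le_sup (le_sup_left : ‖x.fst‖ ≤ ‖x.fst‖ ⊔ ‖x.snd‖)
      (le_sup_right : ‖y.snd‖ ≤ ‖y.fst‖ ⊔ ‖y.snd‖)
  have hY (x : WithLp ∞ (Y × Z)) : PY (PY x) = PY x := by simp [hPY]
  have hZ (x : WithLp ∞ (Y × Z)) : PZ (PZ x) = PZ x := by simp [hPZ]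
  refine le_antisymm (numRadius_le_max_comp hadd hmax hY hZ T)
    (max_le (numRadius_comp_le hadd hmax T) (numRadius_comp_le (Q := PY) ?_ ?_ T))
  · exact fun x ↦ (add_comm _ _).trans (hadd x)
  · intro x y
    rw [add_comm, max_comm]
    exact hmax y x
end

section
/- Let C[0,1] be the real Banach space of continuous real-valued functions on [0,1] with the supremum norm and L₁[0,1] the real Banach space of Lebesgue-integrable functions on [0,1]. Then for X = C[0,1] ⊕₁ L₁[0,1], the set NRA(X) ∩ K(X) is dense in K(X) with respect to the operator norm; likewise, for Y = C[0,1] ⊕∞ L₁[0,1], the set NRA(Y) ∩ K(Y) is dense in K(Y) with respect to the operator norm. -/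
open scoped ENNReal unitInterval

/-- A continuous linear map `P` that fixes a finite set `V` of vectors and a finite set `F` of
functionals, where every `f ∈ F` has modulus one on every `v ∈ V`, the set `V` generates the image
of the unit ball and the set `F` is norming for the range. -/
structure IsFramed {X : Type*} [NormedAddCommGroup X] [NormedSpace ℝ X]
    (P : X →L[ℝ] X) (V : Set X) (F : Set (X →L[ℝ] ℝ)) : Prop where
  finite_vectors : V.Finite
  finite_functionals : F.Finite
  nonempty_vectors : V.Nonempty
  nonempty_functionals : F.Nonempty
  norm_vector_le : ∀ v ∈ V, ‖v‖ ≤ 1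
  norm_functional_le : ∀ f ∈ F, ∀ x, |f x| ≤ ‖x‖
  map_vector : ∀ v ∈ V, P v = v
  functional_comp : ∀ f ∈ F, ∀ x, f (P x) = f x
  abs_apply : ∀ f ∈ F, ∀ v ∈ V, |f v| = 1
  generating : ∀ (g : X →L[ℝ] ℝ) (c : ℝ), (∀ v ∈ V, |g v| ≤ c) → ∀ x, |g (P x)| ≤ c * ‖x‖
  norming : ∀ (y : X) (c : ℝ), (∀ f ∈ F, |f y| ≤ c) → ‖P y‖ ≤ c

/-- Finitely many vectors and functionals are almost fixed by some framed projection. -/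
def HasFramedApproximation (X : Type*) [NormedAddCommGroup X] [NormedSpace ℝ X] : Prop :=
  ∀ (A : Set X) (B : Set (X →L[ℝ] ℝ)), A.Finite → B.Finite → ∀ ε > 0,
    ∃ P : X →L[ℝ] X, (∃ V F, IsFramed P V F) ∧
      (∀ a ∈ A, ‖P a - a‖ ≤ ε) ∧ ∀ φ ∈ B, ∀ x, |φ (P x) - φ x| ≤ ε * ‖x‖

namespace IsFramed

variable {X : Type*} [NormedAddCommGroup X] [NormedSpace ℝ X]
  {P : X →L[ℝ] X} {V : Set X} {F : Set (X →L[ℝ] ℝ)}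

lemma norm_apply_le (h : IsFramed P V F) (x : X) : ‖P x‖ ≤ ‖x‖ :=
  h.norming x _ fun f hf => h.norm_functional_le f hf x

lemma attainsNumRadius (h : IsFramed P V F) (T : X →L[ℝ] X) :
    AttainsNumRadius (P ∘L T ∘L P) := by
  obtain ⟨⟨f, v⟩, hfv, hmax⟩ := (h.finite_functionals.prod h.finite_vectors).exists_maximalFor
    (fun q : (X →L[ℝ] ℝ) × X => |q.1 (T q.2)|) _
    (h.nonempty_functionals.prod h.nonempty_vectors)
  obtain ⟨hf, hv⟩ : f ∈ F ∧ v ∈ V := hfv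
  have hle : ∀ f' ∈ F, ∀ v' ∈ V, |f' (T v')| ≤ |f (T v)| := fun f' hf' v' hv' =>
    (le_total _ _).elim id fun hh => hmax (j := (f', v')) ⟨hf', hv'⟩ hh
  have hbound : ∀ x, ‖(P ∘L T ∘L P) x‖ ≤ |f (T v)| * ‖x‖ := fun x =>
    h.norming (T (P x)) _ fun f' hf' => h.generating (f' ∘L T) _ (hle f' hf') x
  have hfv1 : |f v| = 1 := h.abs_apply f hf v hv
  have hv1 : ‖v‖ = 1 := le_antisymm (h.norm_vector_le v hv)
    (hfv1 ▸ h.norm_functional_le f hf v)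
  have hf1 : ‖f‖ = 1 := by
    refine le_antisymm (f.opNorm_le_bound zero_le_one fun x => ?_) ?_
    · simpa using h.norm_functional_le f hf x
    · have := f.le_opNorm v
      rw [hv1, mul_one, Real.norm_eq_abs, hfv1] at this
      exact this
  have key : ∃ (x : X) (g : X →L[ℝ] ℝ), ‖x‖ = 1 ∧ ‖g‖ = 1 ∧ g x = 1 ∧
      |g ((P ∘L T ∘L P) x)| = |f (T v)| := by
    have hval : f ((P ∘L T ∘L P) v) = f (T v) := by
      simp [h.functional_comp f hf, h.map_vector v hv]
    rcases eq_or_eq_neg_of_abs_eq hfv1 with h1 | h1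
    · exact ⟨v, f, hv1, hf1, h1, by rw [hval]⟩
    · exact ⟨v, -f, hv1, by rwa [norm_neg], by simp [h1], by
        rw [neg_apply, hval, abs_neg]⟩
  have hsup : numRadius (P ∘L T ∘L P) = |f (T v)| := by
    refine IsGreatest.csSup_eq ⟨?_, ?_⟩
    · obtain ⟨x, g, hx, hg, hgx, hh⟩ := key
      exact ⟨x, g, hx, hg, hgx, hh.symm⟩
    · rintro r ⟨x, g, hx, hg, -, rfl⟩
      calc |g ((P ∘L T ∘L P) x)| ≤ ‖g‖ * ‖(P ∘L T ∘L P) x‖ := g.le_opNorm _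
        _ ≤ |f (T v)| := by simpa [hg, hx] using hbound x
  obtain ⟨x, g, hx, hg, hgx, hh⟩ := key
  exact ⟨x, g, hx, hg, hgx, hh.trans hsup.symm⟩

end IsFramed

lemma HasFramedApproximation.mem_closure {X : Type*} [NormedAddCommGroup X] [NormedSpace ℝ X]
    (hX : HasFramedApproximation X) {T : X →L[ℝ] X} (hT : IsCompactOperator T) :
    T ∈ closure {S : X →L[ℝ] X | AttainsNumRadius S ∧ IsCompactOperator S} := by
  rw [Metric.mem_closure_iff]
  intro ε hε
  obtain ⟨δ, hδ, hδε⟩ : ∃ δ > 0, 10 * δ < ε := ⟨ε / 20, by positivity, by linarith⟩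
  have htb : TotallyBounded (T '' Metric.closedBall 0 1) :=
    (hT.isCompact_closure_image_closedBall 1).totallyBounded.subset subset_closure
  obtain ⟨A, hA, hcov⟩ := Metric.totallyBounded_iff.1 htb δ hδ
  have near : ∀ (P : X →L[ℝ] X) (V : Set X) (F : Set (X →L[ℝ] ℝ)), IsFramed P V F →
      (∀ a ∈ A, ‖P a - a‖ ≤ δ) → ∀ x, ‖P (T x) - T x‖ ≤ 3 * δ * ‖x‖ := by
    intro P V F hP hPA
    have h1 : ‖P ∘L T - T‖ ≤ 3 * δ := by
      refine ContinuousLinearMap.opNorm_le_of_unit_norm (by positivity) fun x hx => ?_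
      have hmem : T x ∈ T '' Metric.closedBall 0 1 := ⟨x, by simp [hx], rfl⟩
      obtain ⟨a, ha, hxa⟩ : ∃ a ∈ A, T x ∈ Metric.ball a δ := by simpa using hcov hmem
      rw [Metric.mem_ball, dist_eq_norm] at hxa
      have e : (P ∘L T - T) x = P (T x - a) + (P a - a) - (T x - a) := by
        simp
      rw [e]
      calc _ ≤ ‖P (T x - a) + (P a - a)‖ + ‖T x - a‖ := norm_sub_le _ _
        _ ≤ ‖P (T x - a)‖ + ‖P a - a‖ + ‖T x - a‖ := by gcongr; exact norm_add_le _ _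
        _ ≤ 3 * δ := by linarith [hP.norm_apply_le (T x - a), hPA a ha]
    exact fun x => (P ∘L T - T).le_of_opNorm_le h1 x
  obtain ⟨P₀, ⟨V₀, F₀, h₀⟩, hA₀, -⟩ := hX A ∅ hA Set.finite_empty δ hδ
  obtain ⟨P, ⟨V, F, hP⟩, hPA, hPB⟩ := hX A ((fun f => f ∘L T) '' F₀) hA
    (h₀.finite_functionals.image _) δ hδ
  refine ⟨P ∘L T ∘L P, ⟨hP.attainsNumRadius T, (hT.comp_clm P).clm_comp P⟩, ?_⟩
  rw [dist_comm, dist_eq_norm]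
  refine lt_of_le_of_lt (ContinuousLinearMap.opNorm_le_bound _ (by positivity) fun x => ?_) hδε
  have e : (P ∘L T ∘L P - T) x = P (P₀ (T (P x - x)) - (P₀ (T (P x - x)) - T (P x - x)))
      + (P (T x) - T x) := by
    simp
  have n1 : ‖P₀ (T (P x - x))‖ ≤ δ * ‖x‖ := h₀.norming _ _ fun f hf => by
    simpa using hPB _ ⟨f, hf, rfl⟩ x
  have n2 : ‖P₀ (T (P x - x)) - T (P x - x)‖ ≤ 3 * δ * (2 * ‖x‖) :=
    (near P₀ V₀ F₀ h₀ hA₀ _).trans (by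
      gcongr
      linarith [norm_sub_le (P x) x, hP.norm_apply_le x])
  rw [e]
  calc _ ≤ ‖P (P₀ (T (P x - x)) - (P₀ (T (P x - x)) - T (P x - x)))‖ + ‖P (T x) - T x‖ :=
        norm_add_le _ _
    _ ≤ (‖P₀ (T (P x - x))‖ + ‖P₀ (T (P x - x)) - T (P x - x)‖) + ‖P (T x) - T x‖ := by
        gcongr
        exact (hP.norm_apply_le _).trans (norm_sub_le _ _)
    _ ≤ 10 * δ * ‖x‖ := by linarith [near P V F hP hPA x]

lemma toLp_eq_add {X Z : Type*} [AddCommGroup X] [AddCommGroup Z] (p : ℝ≥0∞) (x : X) (z : Z) :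
    WithLp.toLp p (x, z) = WithLp.toLp p (x, 0) + WithLp.toLp p (0, z) := by
  rw [← WithLp.toLp_add]; simp

lemma norm_toLp_le {X Z : Type*} [NormedAddCommGroup X] [NormedAddCommGroup Z] (p : ℝ≥0∞)
    [Fact (1 ≤ p)] (x : X) (z : Z) : ‖WithLp.toLp p (x, z)‖ ≤ ‖x‖ + ‖z‖ := by
  rw [toLp_eq_add]
  exact (norm_add_le _ _).trans (by rw [WithLp.norm_toLp_fst, WithLp.norm_toLp_snd])

lemma abs_add_abs_le {a b c : ℝ} (h₁ : |a + b| ≤ c) (h₂ : |a - b| ≤ c) : |a| + |b| ≤ c := by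
  rw [abs_le] at h₁ h₂
  rcases abs_cases a with ⟨ha, -⟩ | ⟨ha, -⟩ <;> rcases abs_cases b with ⟨hb, -⟩ | ⟨hb, -⟩ <;>
    rw [ha, hb] <;> linarith

section DirectSums

variable {X Z : Type*} [NormedAddCommGroup X] [NormedSpace ℝ X] [NormedAddCommGroup Z]
  [NormedSpace ℝ Z]

/-- The diagonal operator on a direct sum. -/
noncomputable def diagonalCLM (p : ℝ≥0∞) [Fact (1 ≤ p)] (P : X →L[ℝ] X) (Q : Z →L[ℝ] Z) :
    WithLp p (X × Z) →L[ℝ] WithLp p (X × Z) :=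
  (WithLp.prodContinuousLinearEquiv p ℝ X Z).symm.toContinuousLinearMap ∘L P.prodMap Q ∘L
    (WithLp.prodContinuousLinearEquiv p ℝ X Z).toContinuousLinearMap

/-- The functional on a direct sum given by functionals on the summands. -/
noncomputable def sumFunctional (p : ℝ≥0∞) [Fact (1 ≤ p)] (f : X →L[ℝ] ℝ) (g : Z →L[ℝ] ℝ) :
    WithLp p (X × Z) →L[ℝ] ℝ :=
  f ∘L WithLp.fstL p ℝ X Z + g ∘L WithLp.sndL p ℝ X Z

/-- The restriction of a functional to the first summand. -/
noncomputable def restrictFst (p : ℝ≥0∞) [Fact (1 ≤ p)] (g : WithLp p (X × Z) →L[ℝ] ℝ) :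
    X →L[ℝ] ℝ :=
  g ∘L (WithLp.prodContinuousLinearEquiv p ℝ X Z).symm.toContinuousLinearMap ∘L
    ContinuousLinearMap.inl ℝ X Z

/-- The restriction of a functional to the second summand. -/
noncomputable def restrictSnd (p : ℝ≥0∞) [Fact (1 ≤ p)] (g : WithLp p (X × Z) →L[ℝ] ℝ) :
    Z →L[ℝ] ℝ :=
  g ∘L (WithLp.prodContinuousLinearEquiv p ℝ X Z).symm.toContinuousLinearMap ∘L
    ContinuousLinearMap.inr ℝ X Z

variable {p : ℝ≥0∞} [Fact (1 ≤ p)]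

@[simp] lemma diagonalCLM_apply (P : X →L[ℝ] X) (Q : Z →L[ℝ] Z) (x : WithLp p (X × Z)) :
    diagonalCLM p P Q x = WithLp.toLp p (P x.fst, Q x.snd) := rfl

@[simp] lemma sumFunctional_apply (f : X →L[ℝ] ℝ) (g : Z →L[ℝ] ℝ) (x : WithLp p (X × Z)) :
    sumFunctional p f g x = f x.fst + g x.snd := rfl

@[simp] lemma restrictFst_apply (g : WithLp p (X × Z) →L[ℝ] ℝ) (x : X) :
    restrictFst p g x = g (WithLp.toLp p (x, 0)) := rfl

@[simp] lemma restrictSnd_apply (g : WithLp p (X × Z) →L[ℝ] ℝ) (z : Z) :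
    restrictSnd p g z = g (WithLp.toLp p (0, z)) := rfl

lemma apply_toLp (g : WithLp p (X × Z) →L[ℝ] ℝ) (x : X) (z : Z) :
    g (WithLp.toLp p (x, z)) = restrictFst p g x + restrictSnd p g z := by
  rw [toLp_eq_add, map_add]; rfl

lemma IsFramed.diagonalCLM_zero {P : X →L[ℝ] X} {V : Set X} {F : Set (X →L[ℝ] ℝ)}
    (h : IsFramed P V F) :
    IsFramed (diagonalCLM p P (0 : Z →L[ℝ] Z)) ((fun v => WithLp.toLp p (v, 0)) '' V)
      ((fun f => sumFunctional p f 0) '' F) where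
  finite_vectors := h.finite_vectors.image _
  finite_functionals := h.finite_functionals.image _
  nonempty_vectors := h.nonempty_vectors.image _
  nonempty_functionals := h.nonempty_functionals.image _
  norm_vector_le := by
    rintro _ ⟨v, hv, rfl⟩
    simpa only [WithLp.norm_toLp_fst] using h.norm_vector_le v hv
  norm_functional_le := by
    rintro _ ⟨f, hf, rfl⟩ x
    simpa using (h.norm_functional_le f hf x.fst).trans (WithLp.norm_fst_le _ x)
  map_vector := by
    rintro _ ⟨v, hv, rfl⟩
    simp [h.map_vector v hv]
  functional_comp := by
    rintro _ ⟨f, hf, rfl⟩ x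
    simp [h.functional_comp f hf]
  abs_apply := by
    rintro _ ⟨f, hf, rfl⟩ _ ⟨v, hv, rfl⟩
    simp [h.abs_apply f hf v hv]
  generating := by
    intro g c hg x
    obtain ⟨v₀, hv₀⟩ := h.nonempty_vectors
    have hc : 0 ≤ c := (abs_nonneg _).trans (hg _ ⟨v₀, hv₀, rfl⟩)
    have := h.generating (restrictFst p g) c (fun v hv => hg _ ⟨v, hv, rfl⟩) x.fst
    exact this.trans (mul_le_mul_of_nonneg_left (WithLp.norm_fst_le _ x) hc)
  norming := by
    intro y c hc
    have := h.norming y.fst c (fun f hf => by simpa using hc _ ⟨f, hf, rfl⟩)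
    simpa only [diagonalCLM_apply, zero_apply, WithLp.norm_toLp_fst] using this

lemma IsFramed.diagonalCLM_one {P : X →L[ℝ] X} {V : Set X} {F : Set (X →L[ℝ] ℝ)}
    {Q : Z →L[ℝ] Z} {W : Set Z} {G : Set (Z →L[ℝ] ℝ)}
    (h : IsFramed P V F) (k : IsFramed Q W G) :
    IsFramed (diagonalCLM 1 P Q)
      ((fun v => WithLp.toLp 1 (v, 0)) '' V ∪ (fun w => WithLp.toLp 1 (0, w)) '' W)
      (Set.image2 (fun f g => sumFunctional 1 f g) F G ∪
        Set.image2 (fun f g => sumFunctional 1 f (-g)) F G) where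
  finite_vectors := (h.finite_vectors.image _).union (k.finite_vectors.image _)
  finite_functionals := (h.finite_functionals.image2 _ k.finite_functionals).union
    (h.finite_functionals.image2 _ k.finite_functionals)
  nonempty_vectors := (h.nonempty_vectors.image _).inl
  nonempty_functionals := (h.nonempty_functionals.image2 k.nonempty_functionals).inl
  norm_vector_le := by
    rintro _ (⟨v, hv, rfl⟩ | ⟨v, hv, rfl⟩)
    · simpa only [WithLp.norm_toLp_fst] using h.norm_vector_le v hv
    · simpa only [WithLp.norm_toLp_snd] using k.norm_vector_le v hv
  norm_functional_le := by
    rintro _ (⟨f, hf, g, hg, rfl⟩ | ⟨f, hf, g, hg, rfl⟩) x <;> rw [WithLp.prod_norm_eq_of_L1]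
    · exact (abs_add_le _ _).trans
        (add_le_add (h.norm_functional_le f hf _) (k.norm_functional_le g hg _))
    · refine (abs_add_le _ _).trans (add_le_add (h.norm_functional_le f hf _) ?_)
      simpa using k.norm_functional_le g hg _
  map_vector := by
    rintro _ (⟨v, hv, rfl⟩ | ⟨v, hv, rfl⟩)
    · simp [h.map_vector v hv]
    · simp [k.map_vector v hv]
  functional_comp := by
    rintro _ (⟨f, hf, g, hg, rfl⟩ | ⟨f, hf, g, hg, rfl⟩) x <;>
      simp [h.functional_comp f hf, k.functional_comp g hg]
  abs_apply := by
    rintro _ (⟨f, hf, g, hg, rfl⟩ | ⟨f, hf, g, hg, rfl⟩) _ (⟨v, hv, rfl⟩ | ⟨v, hv, rfl⟩)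
    · simp [h.abs_apply f hf v hv]
    · simp [k.abs_apply g hg v hv]
    · simp [h.abs_apply f hf v hv]
    · simp [k.abs_apply g hg v hv]
  generating := by
    intro g c hg x
    have h1 := h.generating (restrictFst 1 g) c (fun v hv => hg _ (.inl ⟨v, hv, rfl⟩)) x.fst
    have h2 := k.generating (restrictSnd 1 g) c (fun v hv => hg _ (.inr ⟨v, hv, rfl⟩)) x.snd
    rw [diagonalCLM_apply, apply_toLp, WithLp.prod_norm_eq_of_L1, mul_add]
    exact (abs_add_le _ _).trans (add_le_add h1 h2)
  norming := by
    intro y c hc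
    have key : ∀ f ∈ F, ∀ g ∈ G, |f y.fst| + |g y.snd| ≤ c := fun f hf g hg =>
      abs_add_abs_le (by simpa using hc _ (.inl ⟨f, hf, g, hg, rfl⟩))
        (by simpa [sub_eq_add_neg] using hc _ (.inr ⟨f, hf, g, hg, rfl⟩))
    have h1 : ∀ f ∈ F, |f y.fst| ≤ c - ‖Q y.snd‖ := fun f hf => by
      have := k.norming y.snd (c - |f y.fst|) fun g hg => by linarith [key f hf g hg]
      linarith
    have := h.norming y.fst _ h1
    rw [diagonalCLM_apply, WithLp.prod_norm_eq_of_L1]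
    simpa using by linarith

lemma IsFramed.diagonalCLM_top {P : X →L[ℝ] X} {V : Set X} {F : Set (X →L[ℝ] ℝ)}
    {Q : Z →L[ℝ] Z} {W : Set Z} {G : Set (Z →L[ℝ] ℝ)}
    (h : IsFramed P V F) (k : IsFramed Q W G) :
    IsFramed (diagonalCLM ∞ P Q)
      (Set.image2 (fun v w => WithLp.toLp ∞ (v, w)) V W ∪
        Set.image2 (fun v w => WithLp.toLp ∞ (v, -w)) V W)
      ((fun f => sumFunctional ∞ f 0) '' F ∪ (fun g => sumFunctional ∞ 0 g) '' G) where
  finite_vectors := (h.finite_vectors.image2 _ k.finite_vectors).union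
    (h.finite_vectors.image2 _ k.finite_vectors)
  finite_functionals := (h.finite_functionals.image _).union (k.finite_functionals.image _)
  nonempty_vectors := (h.nonempty_vectors.image2 k.nonempty_vectors).inl
  nonempty_functionals := (h.nonempty_functionals.image _).inl
  norm_vector_le := by
    rintro _ (⟨v, hv, w, hw, rfl⟩ | ⟨v, hv, w, hw, rfl⟩) <;>
      simp [WithLp.prod_norm_eq_sup, h.norm_vector_le v hv, k.norm_vector_le w hw]
  norm_functional_le := by
    rintro _ (⟨f, hf, rfl⟩ | ⟨f, hf, rfl⟩) x
    · simpa using (h.norm_functional_le f hf x.fst).trans (WithLp.norm_fst_le _ x)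
    · simpa using (k.norm_functional_le f hf x.snd).trans (WithLp.norm_snd_le _ x)
  map_vector := by
    rintro _ (⟨v, hv, w, hw, rfl⟩ | ⟨v, hv, w, hw, rfl⟩) <;>
      simp [h.map_vector v hv, k.map_vector w hw]
  functional_comp := by
    rintro _ (⟨f, hf, rfl⟩ | ⟨f, hf, rfl⟩) x
    · simp [h.functional_comp f hf]
    · simp [k.functional_comp f hf]
  abs_apply := by
    rintro _ (⟨f, hf, rfl⟩ | ⟨f, hf, rfl⟩) _ (⟨v, hv, w, hw, rfl⟩ | ⟨v, hv, w, hw, rfl⟩)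
    · simp [h.abs_apply f hf v hv]
    · simp [h.abs_apply f hf v hv]
    · simp [k.abs_apply f hf w hw]
    · simp [k.abs_apply f hf w hw]
  generating := by
    intro g c hg x
    have key : ∀ v ∈ V, ∀ w ∈ W, |restrictFst ∞ g v| + |restrictSnd ∞ g w| ≤ c := by
      intro v hv w hw
      refine abs_add_abs_le ?_ ?_
      · rw [← apply_toLp]; exact hg _ (.inl ⟨v, hv, w, hw, rfl⟩)
      · rw [sub_eq_add_neg, ← map_neg, ← apply_toLp]
        exact hg _ (.inr ⟨v, hv, w, hw, rfl⟩)
    obtain ⟨v₀, hv₀⟩ := h.nonempty_vectors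
    obtain ⟨w₀, hw₀⟩ := k.nonempty_vectors
    rw [diagonalCLM_apply, apply_toLp]
    refine (abs_add_le _ _).trans ?_
    have hx1 := WithLp.norm_fst_le _ x
    have hx2 := WithLp.norm_snd_le _ x
    rcases (norm_nonneg x).eq_or_lt with h0 | h0
    · have e1 : x.fst = 0 := norm_le_zero_iff.1 (h0 ▸ hx1)
      have e2 : x.snd = 0 := norm_le_zero_iff.1 (h0 ▸ hx2)
      rw [e1, e2, ← h0]
      simp only [map_zero, abs_zero, add_zero, mul_zero, le_refl]
    set α := |restrictSnd ∞ g (Q x.snd)| with hα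
    have h1 : ∀ v ∈ V, |restrictFst ∞ g v| ≤ c - α / ‖x‖ := by
      intro v hv
      have h2 := k.generating (restrictSnd ∞ g) (c - |restrictFst ∞ g v|)
        (fun w hw => by linarith [key v hv w hw]) x.snd
      have h3 : 0 ≤ c - |restrictFst ∞ g v| := by
        linarith [key v hv w₀ hw₀, abs_nonneg (restrictSnd ∞ g w₀)]
      have h4 : α / ‖x‖ ≤ c - |restrictFst ∞ g v| := by
        rw [div_le_iff₀ h0]
        exact h2.trans (mul_le_mul_of_nonneg_left hx2 h3)
      linarith
    have h5 : 0 ≤ c - α / ‖x‖ := (abs_nonneg _).trans (h1 v₀ hv₀)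
    have h6 := (h.generating (restrictFst ∞ g) _ h1 x.fst).trans
      (mul_le_mul_of_nonneg_left hx1 h5)
    rw [sub_mul, div_mul_cancel₀ _ h0.ne'] at h6
    linarith
  norming := by
    intro y c hc
    rw [diagonalCLM_apply, WithLp.prod_norm_eq_sup]
    exact sup_le (h.norming y.fst c fun f hf => by simpa using hc _ (.inl ⟨f, hf, rfl⟩))
      (k.norming y.snd c fun f hf => by simpa using hc _ (.inr ⟨f, hf, rfl⟩))

lemma HasFramedApproximation.withLp_prod
    (hdiag : ∀ (P : X →L[ℝ] X) (Q : Z →L[ℝ] Z), (∃ V F, IsFramed P V F) →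
      (∃ W G, IsFramed Q W G) → ∃ V F, IsFramed (diagonalCLM p P Q) V F)
    (hX : HasFramedApproximation X) (hZ : Subsingleton Z ∨ HasFramedApproximation Z) :
    HasFramedApproximation (WithLp p (X × Z)) := by
  intro A B hA hB ε hε
  obtain ⟨P, hP, hPA, hPB⟩ := hX (WithLp.fst '' A) (restrictFst p '' B) (hA.image _) (hB.image _)
    (ε / 2) (by positivity)
  obtain ⟨Q, hPQ, hQA, hQB⟩ : ∃ Q : Z →L[ℝ] Z, (∃ V F, IsFramed (diagonalCLM p P Q) V F) ∧
      (∀ a ∈ WithLp.snd '' A, ‖Q a - a‖ ≤ ε / 2) ∧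
      ∀ φ ∈ restrictSnd p '' B, ∀ z, |φ (Q z) - φ z| ≤ ε / 2 * ‖z‖ := by
    rcases hZ with hZ | hZ
    · obtain ⟨V, F, hVF⟩ := hP
      refine ⟨0, ⟨_, _, hVF.diagonalCLM_zero⟩, fun a _ => ?_, fun φ _ z => ?_⟩
      · rw [Subsingleton.elim a 0]; simpa using (half_pos hε).le
      · rw [Subsingleton.elim z 0]; simp
    · obtain ⟨Q, hQ, hQA, hQB⟩ := hZ (WithLp.snd '' A) (restrictSnd p '' B) (hA.image _)
        (hB.image _) (ε / 2) (by positivity)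
      exact ⟨Q, hdiag P Q hP hQ, hQA, hQB⟩
  refine ⟨diagonalCLM p P Q, hPQ, fun a ha => ?_, fun φ hφ x => ?_⟩
  · have e : diagonalCLM p P Q a - a = WithLp.toLp p (P a.fst - a.fst, Q a.snd - a.snd) := rfl
    rw [e]
    refine (norm_toLp_le p _ _).trans ?_
    linarith [hPA _ ⟨a, ha, rfl⟩, hQA _ ⟨a, ha, rfl⟩]
  · have e : φ (diagonalCLM p P Q x) - φ x =
        (restrictFst p φ (P x.fst) - restrictFst p φ x.fst) +
          (restrictSnd p φ (Q x.snd) - restrictSnd p φ x.snd) := by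
      have hx : φ x = restrictFst p φ x.fst + restrictSnd p φ x.snd := apply_toLp φ x.fst x.snd
      rw [diagonalCLM_apply, apply_toLp, hx]; ring
    rw [e]
    refine (abs_add_le _ _).trans ?_
    have h1 := hPB _ ⟨φ, hφ, rfl⟩ x.fst
    have h2 := hQB _ ⟨φ, hφ, rfl⟩ x.snd
    have h3 := mul_le_mul_of_nonneg_left (WithLp.norm_fst_le _ x) hε.le
    have h4 := mul_le_mul_of_nonneg_left (WithLp.norm_snd_le _ x) hε.le
    linarith

end DirectSums

section Biorthogonal

variable {X : Type*} [NormedAddCommGroup X] [NormedSpace ℝ X] {ι : Type*} [Fintype ι]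

/-- The finite rank operator `x ↦ ∑ i, b i x • a i`. -/
noncomputable def finiteRankCLM (a : ι → X) (b : ι → X →L[ℝ] ℝ) : X →L[ℝ] X :=
  ∑ i, (b i).smulRight (a i)

lemma finiteRankCLM_apply (a : ι → X) (b : ι → X →L[ℝ] ℝ) (x : X) :
    finiteRankCLM a b x = ∑ i, b i x • a i := by
  simp [finiteRankCLM, sum_apply]

/-- The real number `1` or `-1` attached to a Boolean. -/
def boolSign (s : Bool) : ℝ := if s then 1 else -1

lemma abs_boolSign (s : Bool) : |boolSign s| = 1 := by
  cases s <;> simp [boolSign]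

lemma exists_boolSign_mul_eq_abs (t : ℝ) : ∃ s, boolSign s * t = |t| := by
  rcases abs_cases t with ⟨h, -⟩ | ⟨h, -⟩
  · exact ⟨true, by simp [boolSign, h]⟩
  · exact ⟨false, by simp [boolSign, h]⟩

variable [DecidableEq ι] {a : ι → X} {b : ι → X →L[ℝ] ℝ}

lemma finiteRankCLM_apply_sum (hab : ∀ i j, b i (a j) = if i = j then 1 else 0) (y : ι → ℝ) :
    finiteRankCLM a b (∑ j, y j • a j) = ∑ j, y j • a j := by
  simp [finiteRankCLM_apply, hab]

lemma sum_mul_apply_finiteRankCLM (hab : ∀ i j, b i (a j) = if i = j then 1 else 0) (y : ι → ℝ)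
    (x : X) : ∑ i, y i * b i (finiteRankCLM a b x) = ∑ i, y i * b i x := by
  simp [finiteRankCLM_apply, hab]

lemma isFramed_of_biorthogonal_sup [Nonempty ι]
    (hab : ∀ i j, b i (a j) = if i = j then 1 else 0) (hb : ∀ i x, |b i x| ≤ ‖x‖)
    (ha : ∀ (y : ι → ℝ) (c : ℝ), (∀ i, |y i| ≤ c) → ‖∑ i, y i • a i‖ ≤ c) :
    IsFramed (finiteRankCLM a b)
      (Set.range fun s : ι → Bool => ∑ i, boolSign (s i) • a i) (Set.range b) where
  finite_vectors := Set.finite_range _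
  finite_functionals := Set.finite_range _
  nonempty_vectors := Set.range_nonempty _
  nonempty_functionals := Set.range_nonempty _
  norm_vector_le := by
    rintro _ ⟨s, rfl⟩
    exact ha _ _ fun i => (abs_boolSign _).le
  norm_functional_le := by
    rintro _ ⟨i, rfl⟩
    exact hb i
  map_vector := by
    rintro _ ⟨s, rfl⟩
    exact finiteRankCLM_apply_sum hab _
  functional_comp := by
    rintro _ ⟨i, rfl⟩ x
    simp [finiteRankCLM_apply, hab]
  abs_apply := by
    rintro _ ⟨i, rfl⟩ _ ⟨s, rfl⟩
    simp [hab, abs_boolSign]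
  generating := by
    intro g c hg x
    choose s hs using fun i => exists_boolSign_mul_eq_abs (g (a i))
    have h1 : ∑ i, |g (a i)| ≤ c := by
      have := (le_abs_self _).trans (hg _ ⟨s, rfl⟩)
      simpa [hs] using this
    calc |g (finiteRankCLM a b x)| = |∑ i, b i x * g (a i)| := by
          simp [finiteRankCLM_apply]
      _ ≤ ∑ i, |b i x * g (a i)| := Finset.abs_sum_le_sum_abs _ _
      _ ≤ ∑ i, ‖x‖ * |g (a i)| := Finset.sum_le_sum fun i _ => by
          rw [abs_mul]
          exact mul_le_mul_of_nonneg_right (hb i x) (abs_nonneg _)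
      _ ≤ c * ‖x‖ := by
          rw [← Finset.mul_sum, mul_comm]
          exact mul_le_mul_of_nonneg_right h1 (norm_nonneg _)
  norming := by
    intro y c hc
    rw [finiteRankCLM_apply]
    exact ha _ _ fun i => hc _ ⟨i, rfl⟩

lemma isFramed_of_biorthogonal_sum [Nonempty ι]
    (hab : ∀ i j, b i (a j) = if i = j then 1 else 0) (ha : ∀ i, ‖a i‖ ≤ 1)
    (hb : ∀ x, ∑ i, |b i x| ≤ ‖x‖) :
    IsFramed (finiteRankCLM a b) (Set.range a)
      (Set.range fun s : ι → Bool => ∑ i, boolSign (s i) • b i) where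
  finite_vectors := Set.finite_range _
  finite_functionals := Set.finite_range _
  nonempty_vectors := Set.range_nonempty _
  nonempty_functionals := Set.range_nonempty _
  norm_vector_le := by
    rintro _ ⟨i, rfl⟩
    exact ha i
  norm_functional_le := by
    rintro _ ⟨s, rfl⟩ x
    refine le_trans ?_ (hb x)
    simp only [sum_apply, smul_apply]
    refine (Finset.abs_sum_le_sum_abs _ _).trans (Finset.sum_le_sum fun i _ => ?_)
    rw [smul_eq_mul, abs_mul, abs_boolSign, one_mul]
  map_vector := by
    rintro _ ⟨i, rfl⟩
    simp [finiteRankCLM_apply, hab]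
  functional_comp := by
    rintro _ ⟨s, rfl⟩ x
    simpa [sum_apply] using sum_mul_apply_finiteRankCLM hab _ x
  abs_apply := by
    rintro _ ⟨s, rfl⟩ _ ⟨i, rfl⟩
    simp [sum_apply, hab, abs_boolSign]
  generating := by
    intro g c hg x
    have hc : 0 ≤ c := (abs_nonneg _).trans (hg _ ⟨Classical.arbitrary ι, rfl⟩)
    calc |g (finiteRankCLM a b x)| = |∑ i, b i x * g (a i)| := by
          simp [finiteRankCLM_apply]
      _ ≤ ∑ i, |b i x * g (a i)| := Finset.abs_sum_le_sum_abs _ _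
      _ ≤ ∑ i, c * |b i x| := Finset.sum_le_sum fun i _ => by
          rw [abs_mul, mul_comm]
          exact mul_le_mul_of_nonneg_right (hg _ ⟨i, rfl⟩) (abs_nonneg _)
      _ ≤ c * ‖x‖ := by
          rw [← Finset.mul_sum]
          exact mul_le_mul_of_nonneg_left (hb x) hc
  norming := by
    intro y c hc
    choose s hs using fun i => exists_boolSign_mul_eq_abs (b i y)
    have h1 : ∑ i, |b i y| ≤ c := by
      have := (le_abs_self _).trans (hc _ ⟨s, rfl⟩)
      simpa [sum_apply, hs] using this
    rw [finiteRankCLM_apply]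
    refine (norm_sum_le _ _).trans (le_trans (Finset.sum_le_sum fun i _ => ?_) h1)
    rw [norm_smul, Real.norm_eq_abs]
    exact mul_le_of_le_one_right (abs_nonneg _) (ha i)

/-- A framed operator attached to a biorthogonal system almost fixes everything close to the spans
of the system. -/
lemma hasFramedApproximation_of_biorthogonal
    (h : ∀ (A : Set X) (B : Set (X →L[ℝ] ℝ)), A.Finite → B.Finite → ∀ ε > 0,
      ∃ (n : Type) (_ : Fintype n) (_ : DecidableEq n) (a : n → X) (b : n → X →L[ℝ] ℝ),
        (∀ i j, b i (a j) = if i = j then 1 else 0) ∧ (∃ V F, IsFramed (finiteRankCLM a b) V F) ∧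
        (∀ x ∈ A, ∃ y : n → ℝ, ‖x - ∑ i, y i • a i‖ ≤ ε) ∧
        ∀ φ ∈ B, ∃ y : n → ℝ, ∀ x, |φ x - ∑ i, y i * b i x| ≤ ε * ‖x‖) :
    HasFramedApproximation X := by
  intro A B hA hB ε hε
  obtain ⟨n, _, _, a, b, hab, ⟨V, F, hVF⟩, hA', hB'⟩ := h A B hA hB (ε / 2) (half_pos hε)
  refine ⟨finiteRankCLM a b, ⟨V, F, hVF⟩, fun x hx => ?_, fun φ hφ x => ?_⟩
  · obtain ⟨y, hy⟩ := hA' x hx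
    have e : finiteRankCLM a b x - x =
        finiteRankCLM a b (x - ∑ i, y i • a i) - (x - ∑ i, y i • a i) := by
      rw [map_sub, finiteRankCLM_apply_sum hab]; abel
    rw [e]
    linarith [norm_sub_le (finiteRankCLM a b (x - ∑ i, y i • a i)) (x - ∑ i, y i • a i),
      hVF.norm_apply_le (x - ∑ i, y i • a i)]
  · obtain ⟨y, hy⟩ := hB' φ hφ
    have h1 := hy (finiteRankCLM a b x)
    rw [sum_mul_apply_finiteRankCLM hab] at h1
    have h2 := hy x
    have h3 := mul_le_mul_of_nonneg_left (hVF.norm_apply_le x) hε.le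
    calc |φ (finiteRankCLM a b x) - φ x|
        = |(φ (finiteRankCLM a b x) - ∑ i, y i * b i x) - (φ x - ∑ i, y i * b i x)| := by
          congr 1; ring
      _ ≤ |φ (finiteRankCLM a b x) - ∑ i, y i * b i x| + |φ x - ∑ i, y i * b i x| := abs_sub _ _
      _ ≤ ε * ‖x‖ := by linarith

end Biorthogonal


section DualOfLebesgueSpace

open MeasureTheory

variable {Ω : Type*} [MeasurableSpace Ω] {μ : Measure Ω}

lemma integrable_bounded_mul {h x : Ω → ℝ} {c : ℝ} (hm : Measurable h) (hc : ∀ ω, |h ω| ≤ c)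
    (hx : Integrable x μ) : Integrable (fun ω => h ω * x ω) μ :=
  hx.bdd_mul hm.aestronglyMeasurable (Filter.Eventually.of_forall fun ω => by simpa using hc ω)

lemma abs_integral_mul_le {h : Ω → ℝ} {c : ℝ} (hm : Measurable h) (hc : ∀ ω, |h ω| ≤ c)
    (x : Lp ℝ 1 μ) : |∫ ω, h ω * x ω ∂μ| ≤ c * ‖x‖ := by
  have hx : Integrable x μ := L1.integrable_coeFn x
  calc |∫ ω, h ω * x ω ∂μ| ≤ ∫ ω, |h ω * x ω| ∂μ := abs_integral_le_integral_abs
    _ ≤ ∫ ω, c * |x ω| ∂μ := by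
        refine integral_mono (integrable_bounded_mul hm hc hx).abs (hx.abs.const_mul c) fun ω => ?_
        simp only [abs_mul]
        exact mul_le_mul_of_nonneg_right (hc ω) (abs_nonneg _)
    _ = c * ‖x‖ := by
        rw [integral_const_mul, L1.norm_eq_integral_norm]
        simp

/-- Integration against a bounded measurable function, as a functional on `L¹`. -/
noncomputable def mulIntegralCLM (μ : Measure Ω) (h : Ω → ℝ) (c : ℝ) (hm : Measurable h)
    (hc : ∀ ω, |h ω| ≤ c) : Lp ℝ 1 μ →L[ℝ] ℝ :=
  LinearMap.mkContinuous
    { toFun := fun x => ∫ ω, h ω * x ω ∂μ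
      map_add' := fun x y => by
        rw [← integral_add (integrable_bounded_mul hm hc (L1.integrable_coeFn x))
          (integrable_bounded_mul hm hc (L1.integrable_coeFn y))]
        refine integral_congr_ae ?_
        filter_upwards [Lp.coeFn_add x y] with ω hω
        rw [hω, Pi.add_apply, mul_add]
      map_smul' := fun r x => by
        rw [RingHom.id_apply, smul_eq_mul, ← integral_const_mul]
        refine integral_congr_ae ?_
        filter_upwards [Lp.coeFn_smul r x] with ω hω
        rw [hω, Pi.smul_apply, smul_eq_mul]
        ring } c
    (fun x => abs_integral_mul_le hm hc x)

lemma mulIntegralCLM_apply {h : Ω → ℝ} {c : ℝ} (hm : Measurable h) (hc : ∀ ω, |h ω| ≤ c)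
    (x : Lp ℝ 1 μ) : mulIntegralCLM μ h c hm hc x = ∫ ω, h ω * x ω ∂μ := rfl

/-- The inclusion of `L²` into `L¹` over a finite measure. -/
noncomputable def lpTwoToOne (ν : Measure Ω) [IsFiniteMeasure ν] : Lp ℝ 2 ν →L[ℝ] Lp ℝ 1 ν :=
  LinearMap.mkContinuous
    { toFun := fun u => ((Lp.memLp u).mono_exponent (by norm_num : (1 : ℝ≥0∞) ≤ 2)).toLp u
      map_add' := fun u v => by
        ext1
        refine (MemLp.coeFn_toLp _).trans ?_
        filter_upwards [Lp.coeFn_add u v, Lp.coeFn_add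
          (((Lp.memLp u).mono_exponent (by norm_num : (1 : ℝ≥0∞) ≤ 2)).toLp u)
          (((Lp.memLp v).mono_exponent (by norm_num : (1 : ℝ≥0∞) ≤ 2)).toLp v),
          ((Lp.memLp u).mono_exponent (by norm_num : (1 : ℝ≥0∞) ≤ 2)).coeFn_toLp,
          ((Lp.memLp v).mono_exponent (by norm_num : (1 : ℝ≥0∞) ≤ 2)).coeFn_toLp]
          with ω h1 h2 h3 h4
        rw [h1, h2, Pi.add_apply, Pi.add_apply, h3, h4]
      map_smul' := fun r u => by
        ext1
        refine (MemLp.coeFn_toLp _).trans ?_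
        filter_upwards [Lp.coeFn_smul r u, Lp.coeFn_smul r
          (((Lp.memLp u).mono_exponent (by norm_num : (1 : ℝ≥0∞) ≤ 2)).toLp u),
          ((Lp.memLp u).mono_exponent (by norm_num : (1 : ℝ≥0∞) ≤ 2)).coeFn_toLp]
          with ω h1 h2 h3
        rw [h1, RingHom.id_apply, h2, Pi.smul_apply, Pi.smul_apply, h3] }
    ((ν Set.univ) ^ (1 / (1 : ℝ≥0∞).toReal - 1 / (2 : ℝ≥0∞).toReal)).toReal
    (fun u => by
      have h := eLpNorm_le_eLpNorm_mul_rpow_measure_univ (μ := ν)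
        (by norm_num : (1 : ℝ≥0∞) ≤ 2) (Lp.memLp u).1
      change ‖((Lp.memLp u).mono_exponent (by norm_num : (1 : ℝ≥0∞) ≤ 2)).toLp u‖ ≤ _
      rw [Lp.norm_toLp, Lp.norm_def, ← ENNReal.toReal_mul, mul_comm]
      refine ENNReal.toReal_mono (ENNReal.mul_ne_top (Lp.eLpNorm_ne_top u) ?_) h
      refine ENNReal.rpow_ne_top_of_nonneg ?_ (measure_ne_top _ _)
      norm_num)

lemma coeFn_lpTwoToOne (ν : Measure Ω) [IsFiniteMeasure ν] (u : Lp ℝ 2 ν) :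
    lpTwoToOne ν u =ᵐ[ν] u :=
  ((Lp.memLp u).mono_exponent (by norm_num : (1 : ℝ≥0∞) ≤ 2)).coeFn_toLp

/-- Functionals on `L¹` of a finite measure are integrals against bounded measurable functions. -/
lemma exists_integral_representation {ν : Measure Ω} [IsFiniteMeasure ν] (f : Lp ℝ 1 ν →L[ℝ] ℝ) :
    ∃ h : Ω → ℝ, Measurable h ∧ (∀ ω, |h ω| ≤ ‖f‖) ∧ ∀ x : Lp ℝ 1 ν, f x = ∫ ω, h ω * x ω ∂ν := by
  set h₂ : Lp ℝ 2 ν := (InnerProductSpace.toDual ℝ (Lp ℝ 2 ν)).symm (f.comp (lpTwoToOne ν))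
    with hh₂
  have hset : ∀ s (hs : MeasurableSet s),
      f (indicatorConstLp 1 hs (measure_ne_top ν s) 1) = ∫ ω in s, h₂ ω ∂ν := by
    intro s hs
    have h1 : inner ℝ h₂ (indicatorConstLp 2 hs (measure_ne_top ν s) 1) =
        f (lpTwoToOne ν (indicatorConstLp 2 hs (measure_ne_top ν s) 1)) := by
      rw [hh₂, InnerProductSpace.toDual_symm_apply]
      rfl
    rw [real_inner_comm, L2.inner_indicatorConstLp_one] at h1
    rw [h1]
    congr 1
    ext1
    exact indicatorConstLp_coeFn.trans
      ((coeFn_lpTwoToOne ν _).trans indicatorConstLp_coeFn).symm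
  have hint : Integrable h₂ ν := (Lp.memLp h₂).integrable (by norm_num)
  have hbound : ∀ s, MeasurableSet s → |∫ ω in s, h₂ ω ∂ν| ≤ ∫ _ in s, ‖f‖ ∂ν := by
    intro s hs
    rw [← hset s hs, setIntegral_const, smul_eq_mul, mul_comm]
    refine (f.le_opNorm _).trans_eq ?_
    rw [norm_indicatorConstLp (by norm_num) (by norm_num)]
    simp
  have hle : ∀ᵐ ω ∂ν, h₂ ω ≤ ‖f‖ :=
    ae_le_of_forall_setIntegral_le hint (integrable_const _) fun s hs _ =>
      (le_abs_self _).trans (hbound s hs)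
  have hge : ∀ᵐ ω ∂ν, -‖f‖ ≤ h₂ ω := by
    refine ae_le_of_forall_setIntegral_le (integrable_const _) hint fun s hs _ => ?_
    rw [integral_neg]
    linarith [neg_abs_le (∫ ω in s, h₂ ω ∂ν), hbound s hs]
  let h : Ω → ℝ := fun ω => max (-‖f‖) (min ‖f‖ (h₂ ω))
  have hm : Measurable h :=
    measurable_const.max (measurable_const.min (Lp.stronglyMeasurable h₂).measurable)
  have hc : ∀ ω, |h ω| ≤ ‖f‖ := fun ω =>
    abs_le.2 ⟨le_max_left _ _, max_le (by linarith [norm_nonneg f]) (min_le_left _ _)⟩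
  have hae : h =ᵐ[ν] h₂ := by
    filter_upwards [hle, hge] with ω h1 h2
    simp only [h]
    rw [min_eq_right h1, max_eq_right h2]
  refine ⟨h, hm, hc, fun x => ?_⟩
  rw [← mulIntegralCLM_apply hm hc x]
  induction x using Lp.induction ENNReal.one_ne_top with
  | @indicatorConst c s hs hμs =>
    have e : (Lp.simpleFunc.indicatorConst 1 hs hμs.ne c : Lp ℝ 1 ν) =
        c • indicatorConstLp 1 hs (measure_ne_top ν s) (1 : ℝ) := by
      rw [Lp.simpleFunc.coe_indicatorConst]
      ext1
      filter_upwards [indicatorConstLp_coeFn (p := 1) (hs := hs) (hμs := hμs.ne) (c := c),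
        indicatorConstLp_coeFn (p := 1) (hs := hs) (hμs := hμs.ne) (c := (1 : ℝ)),
        Lp.coeFn_smul c (indicatorConstLp 1 hs hμs.ne (1 : ℝ))] with ω h1 h2 h3
      rw [h1, h3, Pi.smul_apply, h2]
      by_cases hω : ω ∈ s <;> simp [hω]
    rw [e, map_smul, map_smul, hset s hs, mulIntegralCLM_apply, ← integral_indicator hs]
    congr 1
    refine integral_congr_ae ?_
    filter_upwards [hae, indicatorConstLp_coeFn (p := 1) (hs := hs)
      (hμs := measure_ne_top ν s) (c := (1 : ℝ))] with ω h1 h2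
    rw [h1, h2]
    by_cases hω : ω ∈ s <;> simp [hω]
  | add hf hg _ h1 h2 => rw [map_add, map_add, h1, h2]
  | isClosed => exact isClosed_eq f.continuous (mulIntegralCLM ν h _ hm hc).continuous

end DualOfLebesgueSpace

section LebesgueSpace

open MeasureTheory

variable {Ω : Type} [MeasurableSpace Ω] {μ : Measure Ω} {ι : Type}

/-- The bounded measurable function `H` is a density of the functionals `f` on the functions
vanishing wherever `x` vanishes. -/
structure IsDensityOn (f : ι → Lp ℝ 1 μ →L[ℝ] ℝ) (N : ℝ) (x : Lp ℝ 1 μ) (H : Ω → ι → ℝ) :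
    Prop where
  measurable : Measurable H
  bound : ∀ ω k, |H ω k| ≤ N
  apply_eq : ∀ z : Lp ℝ 1 μ, (∀ᵐ ω ∂μ, x ω = 0 → z ω = 0) →
    ∀ k, f k z = ∫ ω, H ω k * z ω ∂μ

lemma exists_density_of_ae_zero (f : Lp ℝ 1 μ →L[ℝ] ℝ) (x : Lp ℝ 1 μ) :
    ∃ h : Ω → ℝ, Measurable h ∧ (∀ ω, |h ω| ≤ ‖f‖) ∧
      ∀ z : Lp ℝ 1 μ, (∀ᵐ ω ∂μ, x ω = 0 → z ω = 0) → f z = ∫ ω, h ω * z ω ∂μ := by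
  have hxm : Measurable fun ω => ‖x ω‖₊ := (Lp.stronglyMeasurable x).measurable.nnnorm
  set ν : Measure Ω := μ.withDensity fun ω => ‖x ω‖₊ with hν
  have hfin : IsFiniteMeasure ν := by
    refine isFiniteMeasure_withDensity ?_
    exact (L1.integrable_coeFn x).2.ne
  set T := withDensitySMulLI (E := ℝ) μ hxm with hT
  obtain ⟨h, hm, hc, hh⟩ := exists_integral_representation (f.comp T.toContinuousLinearMap)
  refine ⟨h, hm, fun ω => (hc ω).trans ?_, fun z hz => ?_⟩
  · refine (f.opNorm_comp_le _).trans ?_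
    exact mul_le_of_le_one_right (norm_nonneg _) T.norm_toContinuousLinearMap_le
  · have hyz : (fun ω => ‖x ω‖₊ • (z ω / |x ω|)) =ᵐ[μ] z := by
      filter_upwards [hz] with ω hω
      rw [NNReal.smul_def, smul_eq_mul, coe_nnnorm, Real.norm_eq_abs]
      by_cases h0 : x ω = 0
      · simp [h0, hω h0]
      · rw [mul_div_cancel₀ _ (abs_ne_zero.2 h0)]
    have hy : Integrable (fun ω => z ω / |x ω|) ν :=
      (integrable_withDensity_iff_integrable_smul hxm).2
        ((L1.integrable_coeFn z).congr hyz.symm)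
    have hyl : MemLp (fun ω => z ω / |x ω|) 1 ν := memLp_one_iff_integrable.2 hy
    have hTy : T (hyl.toLp _) = z := by
      rw [hT, withDensitySMulLI_apply]
      ext1
      refine (MemLp.coeFn_toLp _).trans ?_
      have h1 := (ae_withDensity_iff hxm.coe_nnreal_ennreal).1 hyl.coeFn_toLp
      filter_upwards [h1, hyz, hz] with ω h1 h2 h3
      by_cases h0 : x ω = 0
      · simp [h0, h3 h0]
      · rw [h1 (by simpa using h0), h2]
    have h2 := hh (hyl.toLp _)
    simp only [ContinuousLinearMap.comp_apply, LinearIsometry.coe_toContinuousLinearMap, hTy] at h2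
    rw [h2]
    have h3 : ∫ ω, h ω * hyl.toLp _ ω ∂ν = ∫ ω, h ω * (z ω / |x ω|) ∂ν := by
      refine integral_congr_ae ?_
      filter_upwards [hyl.coeFn_toLp] with ω hω
      rw [hω]
    rw [h3, hν, integral_withDensity_eq_integral_smul hxm]
    refine integral_congr_ae ?_
    filter_upwards [hyz] with ω hω
    conv_rhs => rw [← hω]
    simp only [NNReal.smul_def, smul_eq_mul]
    ring

variable {f : ι → Lp ℝ 1 μ →L[ℝ] ℝ} {N : ℝ} {x z : Lp ℝ 1 μ} {H H' : Ω → ι → ℝ}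

lemma exists_isDensityOn (hf : ∀ k, ‖f k‖ ≤ N) (x : Lp ℝ 1 μ) : ∃ H, IsDensityOn f N x H := by
  choose h hm hc hh using fun k => exists_density_of_ae_zero (f k) x
  exact ⟨fun ω k => h k ω, measurable_pi_lambda _ hm, fun ω k => (hc k ω).trans (hf k),
    fun z hz k => hh k z hz⟩

lemma IsDensityOn.mono (hH : IsDensityOn f N x H) (hz : ∀ᵐ ω ∂μ, x ω = 0 → z ω = 0) :
    IsDensityOn f N z H where
  measurable := hH.measurable
  bound := hH.bound
  apply_eq := fun y hy => hH.apply_eq y (by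
    filter_upwards [hz, hy] with ω h1 h2 h3 using h2 (h1 h3))

lemma abs_indicator_one_le {α : Type*} (C : Set α) (v : α) : |C.indicator (1 : α → ℝ) v| ≤ 1 := by
  by_cases h : v ∈ C <;> simp [h]

lemma IsDensityOn.integrable_indicator {C : Set (ι → ℝ)} (hC : MeasurableSet C)
    (hH : IsDensityOn f N x H) (z : Lp ℝ 1 μ) :
    Integrable (fun ω => C.indicator 1 (H ω) * z ω) μ :=
  integrable_bounded_mul ((measurable_one.indicator hC).comp hH.measurable)
    (fun _ => abs_indicator_one_le C _) (L1.integrable_coeFn z)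

variable [Fintype ι]

lemma IsDensityOn.ae_eq (hH : IsDensityOn f N x H) (hH' : IsDensityOn f N x H') :
    ∀ᵐ ω ∂μ, x ω ≠ 0 → H ω = H' ω := by
  have hx := L1.integrable_coeFn x
  have key : ∀ k, (fun ω => H ω k * x ω) =ᵐ[μ] fun ω => H' ω k * x ω := by
    intro k
    refine Integrable.ae_eq_of_forall_setIntegral_eq _ _
      (integrable_bounded_mul (hH.measurable.eval (a := k)) (fun ω => hH.bound ω k) hx)
      (integrable_bounded_mul (hH'.measurable.eval (a := k)) (fun ω => hH'.bound ω k) hx)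
      fun s hs _ => ?_
    have hsx : MemLp (s.indicator x) 1 μ := (Lp.memLp x).indicator hs
    have hz : ∀ᵐ ω ∂μ, x ω = 0 → hsx.toLp _ ω = 0 := by
      filter_upwards [hsx.coeFn_toLp] with ω hω h0
      rw [hω]
      by_cases h : ω ∈ s <;> simp [h, h0]
    have e : ∀ G : Ω → ι → ℝ, ∫ ω in s, G ω k * x ω ∂μ = ∫ ω, G ω k * hsx.toLp _ ω ∂μ := by
      intro G
      rw [← integral_indicator hs]
      refine integral_congr_ae ?_
      filter_upwards [hsx.coeFn_toLp] with ω hω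
      rw [hω]
      by_cases h : ω ∈ s <;> simp [h]
    rw [e, e, ← hH.apply_eq _ hz, ← hH'.apply_eq _ hz]
  filter_upwards [ae_all_iff.2 key] with ω hω h0
  ext k
  exact mul_right_cancel₀ h0 (hω k)

lemma integral_indicator_congr (C : Set (ι → ℝ)) (hH : IsDensityOn f N x H)
    (hH' : IsDensityOn f N x H') :
    ∫ ω, C.indicator 1 (H ω) * x ω ∂μ = ∫ ω, C.indicator 1 (H' ω) * x ω ∂μ := by
  refine integral_congr_ae ?_
  filter_upwards [hH.ae_eq hH'] with ω hω
  by_cases h0 : x ω = 0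
  · simp [h0]
  · rw [hω h0]

/-- The functional integrating over the set where the density of `f` takes values in `C`. The
density is only defined locally, but these local definitions are compatible. -/
noncomputable def cellFunctional (hf : ∀ k, ‖f k‖ ≤ N) {C : Set (ι → ℝ)} (hC : MeasurableSet C) :
    Lp ℝ 1 μ →L[ℝ] ℝ :=
  LinearMap.mkContinuous
    { toFun := fun x => ∫ ω, C.indicator 1 ((exists_isDensityOn hf x).choose ω) * x ω ∂μ
      map_add' := fun x y => by
        obtain ⟨H, hH⟩ := exists_isDensityOn hf (|x| + |y|)
        have h0 : ∀ᵐ ω ∂μ, (|x| + |y| : Lp ℝ 1 μ) ω = 0 → x ω = 0 ∧ y ω = 0 := by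
          filter_upwards [Lp.coeFn_add |x| |y|, Lp.coeFn_abs x, Lp.coeFn_abs y] with ω h1 h2 h3 h
          rw [h1, Pi.add_apply, h2, h3] at h
          constructor <;> apply abs_eq_zero.1 <;> linarith [abs_nonneg (x ω), abs_nonneg (y ω)]
        have hx : IsDensityOn f N x H := hH.mono (h0.mono fun ω h k => (h k).1)
        have hy : IsDensityOn f N y H := hH.mono (h0.mono fun ω h k => (h k).2)
        have hxy : IsDensityOn f N (x + y) H := by
          refine hH.mono ?_
          filter_upwards [h0, Lp.coeFn_add x y] with ω h1 h2 h
          rw [h2, Pi.add_apply, (h1 h).1, (h1 h).2, add_zero]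
        rw [integral_indicator_congr C (exists_isDensityOn hf x).choose_spec hx,
          integral_indicator_congr C (exists_isDensityOn hf y).choose_spec hy,
          integral_indicator_congr C (exists_isDensityOn hf (x + y)).choose_spec hxy,
          ← integral_add (hx.integrable_indicator hC x) (hx.integrable_indicator hC y)]
        refine integral_congr_ae ?_
        filter_upwards [Lp.coeFn_add x y] with ω hω
        rw [hω, Pi.add_apply, mul_add]
      map_smul' := fun r x => by
        have hx := (exists_isDensityOn hf x).choose_spec
        have hrx : IsDensityOn f N (r • x) (exists_isDensityOn hf x).choose := by
          refine hx.mono ?_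
          filter_upwards [Lp.coeFn_smul r x] with ω h1 h
          rw [h1, Pi.smul_apply, h, smul_zero]
        rw [integral_indicator_congr C (exists_isDensityOn hf (r • x)).choose_spec hrx,
          RingHom.id_apply, smul_eq_mul, ← integral_const_mul]
        refine integral_congr_ae ?_
        filter_upwards [Lp.coeFn_smul r x] with ω hω
        rw [hω, Pi.smul_apply, smul_eq_mul]
        ring } 1
    (fun x => abs_integral_mul_le ((measurable_one.indicator hC).comp
      (exists_isDensityOn hf x).choose_spec.measurable) (fun _ => abs_indicator_one_le C _) x)

lemma cellFunctional_apply (hf : ∀ k, ‖f k‖ ≤ N) {C : Set (ι → ℝ)} (hC : MeasurableSet C)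
    (hH : IsDensityOn f N x H) :
    cellFunctional hf hC x = ∫ ω, C.indicator 1 (H ω) * x ω ∂μ :=
  integral_indicator_congr C (exists_isDensityOn hf x).choose_spec hH

omit [Fintype ι] in
lemma sum_mul_indicator_eq {J : Type} [Fintype J] {C : J → Set (ι → ℝ)}
    (hdisj : ∀ i j v, v ∈ C i → v ∈ C j → i = j) (c : J → ℝ) {v : ι → ℝ} {j : J} (hv : v ∈ C j) :
    ∑ i, c i * (C i).indicator 1 v = c j := by
  rw [Finset.sum_eq_single j]
  · simp [hv]
  · intro i _ hij
    have : v ∉ C i := fun h => hij (hdisj _ _ _ h hv)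
    simp [this]
  · simp

lemma exists_small_cells (ι : Type) [Fintype ι] (N : ℝ) {δ : ℝ} (hδ : 0 < δ) :
    ∃ (J : Type) (_ : Fintype J) (_ : DecidableEq J) (C : J → Set (ι → ℝ)) (c : J → ι → ℝ),
      (∀ j, MeasurableSet (C j)) ∧ (∀ i j v, v ∈ C i → v ∈ C j → i = j) ∧
      (∀ v, (∀ k, |v k| ≤ N) → ∃ j, v ∈ C j) ∧ ∀ j, ∀ v ∈ C j, ∀ k, |v k - c j k| ≤ δ := by
  classical
  let M : ℤ := ⌈N / δ⌉
  let S : Finset (ι → ℤ) := Fintype.piFinset fun _ => Finset.Icc (-M) M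
  refine ⟨S, inferInstance, inferInstance, fun j => {v | ∀ k, ⌊v k / δ⌋ = j.1 k},
    fun j k => δ * j.1 k, fun j => ?_, fun i j v hi hj => ?_, fun v hv => ?_, fun j v hv k => ?_⟩
  · have : {v : ι → ℝ | ∀ k, ⌊v k / δ⌋ = j.1 k} = ⋂ k, {v | ⌊v k / δ⌋ = j.1 k} := by
      ext v
      simp
    change MeasurableSet {v : ι → ℝ | ∀ k, ⌊v k / δ⌋ = j.1 k}
    rw [this]
    refine MeasurableSet.iInter fun k => ?_
    have hk : Measurable fun v : ι → ℝ => v k := measurable_pi_apply k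
    exact (Int.measurable_floor.comp (hk.div_const δ)) (measurableSet_singleton (j.1 k))
  · ext k
    exact (hi k).symm.trans (hj k)
  · refine ⟨⟨fun k => ⌊v k / δ⌋, ?_⟩, fun k => rfl⟩
    rw [Fintype.mem_piFinset]
    intro k
    have h1 : N / δ ≤ M := Int.le_ceil _
    have h2 := abs_le.1 (hv k)
    rw [Finset.mem_Icc]
    constructor
    · rw [Int.le_floor]
      have : -(N / δ) ≤ v k / δ := by
        rw [← neg_div]
        exact div_le_div_of_nonneg_right h2.1 hδ.le
      push_cast
      linarith
    · have h3 : v k / δ ≤ N / δ := div_le_div_of_nonneg_right h2.2 hδ.le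
      have h4 : ((⌊v k / δ⌋ : ℤ) : ℝ) ≤ M := (Int.floor_le _).trans (h3.trans h1)
      exact_mod_cast h4
  · have h1 : ((j.1 k : ℤ) : ℝ) ≤ v k / δ := by rw [← hv k]; exact Int.floor_le _
    have h2 : v k / δ < (j.1 k : ℤ) + 1 := by rw [← hv k]; exact Int.lt_floor_add_one _
    rw [le_div_iff₀ hδ] at h1
    rw [div_lt_iff₀ hδ] at h2
    rw [abs_le]
    constructor <;> linarith

lemma exists_biorthogonal_vector (hf : ∀ k, ‖f k‖ ≤ N) {J : Type} [DecidableEq J]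
    {C : J → Set (ι → ℝ)} (hC : ∀ j, MeasurableSet (C j))
    (hdisj : ∀ i j v, v ∈ C i → v ∈ C j → i = j) (hH : IsDensityOn f N x H) {j : J} (hj : cellFunctional hf (hC j) x ≠ 0) :
    ∃ u : Lp ℝ 1 μ, ‖u‖ ≤ 1 ∧ (∀ i, cellFunctional hf (hC i) u = if i = j then 1 else 0) ∧
      ((∀ᵐ ω ∂μ, 0 ≤ x ω) →
        ∀ᵐ ω ∂μ, cellFunctional hf (hC j) x * u ω = (C j).indicator 1 (H ω) * x ω) := by
  rw [cellFunctional_apply hf (hC j) hH] at hj ⊢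
  have hind : ∀ v, (0 : ℝ) ≤ (C j).indicator 1 v := fun v =>
    Set.indicator_nonneg (fun _ _ => zero_le_one) v
  have hy : Integrable (fun ω => (C j).indicator 1 (H ω) * |x ω|) μ := by
    refine (hH.integrable_indicator (hC j) x).abs.congr (Filter.Eventually.of_forall fun ω => ?_)
    simp only [abs_mul, abs_of_nonneg (hind _)]
  set m := ∫ ω, (C j).indicator 1 (H ω) * |x ω| ∂μ with hm
  have hm0 : 0 < m := by
    refine lt_of_lt_of_le (abs_pos.2 hj) (abs_integral_le_integral_abs.trans_eq ?_)
    simp only [abs_mul, abs_of_nonneg (hind _), hm]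
  have hyl : MemLp (fun ω => m⁻¹ * ((C j).indicator 1 (H ω) * |x ω|)) 1 μ :=
    memLp_one_iff_integrable.2 (hy.const_mul _)
  have hu : IsDensityOn f N (hyl.toLp _) H := by
    refine hH.mono ?_
    filter_upwards [hyl.coeFn_toLp] with ω h1 h2
    rw [h1, h2]
    simp
  refine ⟨hyl.toLp _, ?_, fun i => ?_, fun hx => ?_⟩
  · rw [L1.norm_eq_integral_norm]
    have : ∫ ω, ‖hyl.toLp _ ω‖ ∂μ = ∫ ω, m⁻¹ * ((C j).indicator 1 (H ω) * |x ω|) ∂μ := by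
      refine integral_congr_ae ?_
      filter_upwards [hyl.coeFn_toLp] with ω h1
      rw [h1, Real.norm_eq_abs, abs_of_nonneg]
      exact mul_nonneg (inv_nonneg.2 hm0.le) (mul_nonneg (hind _) (abs_nonneg _))
    rw [this, integral_const_mul, ← hm, inv_mul_cancel₀ hm0.ne']
  · rw [cellFunctional_apply hf (hC i) hu]
    split_ifs with hij
    · subst hij
      have e : m⁻¹ * m = ∫ ω, m⁻¹ * ((C i).indicator 1 (H ω) * |x ω|) ∂μ := by
        rw [integral_const_mul]
      rw [inv_mul_cancel₀ hm0.ne'] at e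
      rw [e]
      refine integral_congr_ae ?_
      filter_upwards [hyl.coeFn_toLp] with ω h1
      rw [h1]
      by_cases h : H ω ∈ C i <;> simp [h]
    · rw [← integral_zero Ω ℝ (μ := μ)]
      refine integral_congr_ae ?_
      filter_upwards [hyl.coeFn_toLp] with ω h1
      rw [h1]
      by_cases h : H ω ∈ C i
      · have : H ω ∉ C j := fun h' => hij (hdisj _ _ _ h h')
        simp [this]
      · simp [h]
  · have hmx : ∫ ω, (C j).indicator 1 (H ω) * x ω ∂μ = m := by
      refine integral_congr_ae ?_
      filter_upwards [hx] with ω h1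
      rw [abs_of_nonneg h1]
    filter_upwards [hyl.coeFn_toLp, hx] with ω h1 h2
    rw [h1, hmx, mul_inv_cancel_left₀ hm0.ne', abs_of_nonneg h2]

lemma sum_abs_cellFunctional_le (hf : ∀ k, ‖f k‖ ≤ N) {J : Type} [Fintype J]
    {C : J → Set (ι → ℝ)} (hC : ∀ j, MeasurableSet (C j))
    (hdisj : ∀ i j v, v ∈ C i → v ∈ C j → i = j) (hcov : ∀ v, (∀ k, |v k| ≤ N) → ∃ j, v ∈ C j)
    (x : Lp ℝ 1 μ) : ∑ j, |cellFunctional hf (hC j) x| ≤ ‖x‖ := by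
  obtain ⟨H, hH⟩ := exists_isDensityOn hf x
  calc ∑ j, |cellFunctional hf (hC j) x|
      ≤ ∑ j, ∫ ω, |(C j).indicator 1 (H ω) * x ω| ∂μ := Finset.sum_le_sum fun j _ => by
        rw [cellFunctional_apply hf (hC j) hH]
        exact abs_integral_le_integral_abs
    _ = ∫ ω, ∑ j, |(C j).indicator 1 (H ω) * x ω| ∂μ :=
        (integral_finsetSum _ fun j _ => (hH.integrable_indicator (hC j) x).abs).symm
    _ = ‖x‖ := by
        rw [L1.norm_eq_integral_norm]
        congr 1
        ext ω
        obtain ⟨j, hj⟩ := hcov _ (hH.bound ω)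
        rw [← one_mul ‖x ω‖, ← sum_mul_indicator_eq hdisj (fun _ => 1) hj, Finset.sum_mul]
        refine Finset.sum_congr rfl fun i _ => ?_
        by_cases h : H ω ∈ C i <;> simp [h]

lemma abs_sub_sum_cellFunctional_le (hf : ∀ k, ‖f k‖ ≤ N) {J : Type} [Fintype J]
    {C : J → Set (ι → ℝ)} (hC : ∀ j, MeasurableSet (C j))
    (hdisj : ∀ i j v, v ∈ C i → v ∈ C j → i = j) (hcov : ∀ v, (∀ k, |v k| ≤ N) → ∃ j, v ∈ C j)
    {c : J → ι → ℝ} {δ : ℝ} (hc : ∀ j, ∀ v ∈ C j, ∀ k, |v k - c j k| ≤ δ) (k : ι)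
    (x : Lp ℝ 1 μ) : |f k x - ∑ j, c j k * cellFunctional hf (hC j) x| ≤ δ * ‖x‖ := by
  obtain ⟨H, hH⟩ := exists_isDensityOn hf x
  have hx := L1.integrable_coeFn x
  have hm : Measurable fun ω => H ω k - ∑ j, c j k * (C j).indicator 1 (H ω) := by
    refine hH.measurable.eval.sub (Finset.measurable_sum _ fun j _ => ?_)
    exact ((measurable_one.indicator (hC j)).comp hH.measurable).const_mul _
  have hb : ∀ ω, |H ω k - ∑ j, c j k * (C j).indicator 1 (H ω)| ≤ δ := by
    intro ω
    obtain ⟨j, hj⟩ := hcov _ (hH.bound ω)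
    rw [sum_mul_indicator_eq hdisj (fun i => c i k) hj]
    exact hc j _ hj k
  refine le_trans (le_of_eq ?_) (abs_integral_mul_le hm hb x)
  congr 1
  rw [hH.apply_eq x (Filter.Eventually.of_forall fun _ h => h)]
  simp only [cellFunctional_apply hf (hC _) hH, ← integral_const_mul]
  rw [← integral_finsetSum _ fun j _ => (hH.integrable_indicator (hC j) x).const_mul _,
    ← integral_sub (integrable_bounded_mul hH.measurable.eval (fun ω => hH.bound ω k) hx)
      (integrable_finsetSum _ fun j _ => (hH.integrable_indicator (hC j) x).const_mul _)]
  congr 1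
  ext ω
  rw [sub_mul, Finset.sum_mul]
  simp only [mul_assoc]


lemma sum_cellFunctional_of_nonneg (hf : ∀ k, ‖f k‖ ≤ N) {J : Type} [Fintype J]
    {C : J → Set (ι → ℝ)} (hC : ∀ j, MeasurableSet (C j))
    (hdisj : ∀ i j v, v ∈ C i → v ∈ C j → i = j) (hcov : ∀ v, (∀ k, |v k| ≤ N) → ∃ j, v ∈ C j)
    (hx : ∀ᵐ ω ∂μ, 0 ≤ x ω) : ∑ j, cellFunctional hf (hC j) x = ‖x‖ := by
  obtain ⟨H, hH⟩ := exists_isDensityOn hf x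
  simp only [cellFunctional_apply hf (hC _) hH]
  rw [← integral_finsetSum _ fun j _ => hH.integrable_indicator (hC j) x,
    L1.norm_eq_integral_norm]
  refine integral_congr_ae ?_
  filter_upwards [hx] with ω hω
  obtain ⟨j, hj⟩ := hcov _ (hH.bound ω)
  have h1 := sum_mul_indicator_eq hdisj (fun _ => 1) hj
  simp only [one_mul] at h1
  rw [Real.norm_eq_abs, abs_of_nonneg hω, ← Finset.sum_mul, h1, one_mul]

omit [Fintype ι] in
lemma coeFn_sum_smul {n : Type} (s : Finset n) (c : n → ℝ) (u : n → Lp ℝ 1 μ) :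
    ∀ᵐ ω ∂μ, (∑ j ∈ s, c j • u j : Lp ℝ 1 μ) ω = ∑ j ∈ s, c j * u j ω := by
  classical
  induction s using Finset.induction_on with
  | empty =>
    filter_upwards [Lp.coeFn_zero ℝ 1 μ] with ω hω
    simpa using hω
  | insert j s hj ih =>
    rw [Finset.sum_insert hj]
    filter_upwards [ih, Lp.coeFn_add (c j • u j) (∑ j ∈ s, c j • u j),
      Lp.coeFn_smul (c j) (u j)] with ω h1 h2 h3
    rw [h2, Pi.add_apply, h1, h3, Pi.smul_apply, smul_eq_mul, Finset.sum_insert hj]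

omit [Fintype ι] in
lemma norm_le_of_ae_abs_le {δ : ℝ} (h : ∀ᵐ ω ∂μ, |x ω| ≤ δ * |z ω|) : ‖x‖ ≤ δ * ‖z‖ := by
  rw [L1.norm_eq_integral_norm, L1.norm_eq_integral_norm, ← integral_const_mul]
  exact integral_mono_ae (L1.integrable_coeFn x).norm ((L1.integrable_coeFn z).norm.const_mul _) h

/-- Finitely many integrable functions are bounded multiples of a single one. -/
lemma exists_common_dominant (A : Set (Lp ℝ 1 μ)) [Fintype A] :
    ∃ (W : Lp ℝ 1 μ) (g : A → Ω → ℝ), (∀ᵐ ω ∂μ, 0 ≤ W ω) ∧ (∀ l, Measurable (g l)) ∧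
      (∀ l ω, |g l ω| ≤ 1) ∧ ∀ l : A, ∀ᵐ ω ∂μ, l.1 ω = g l ω * W ω := by
  let w : Ω → ℝ := fun ω => ∑ l : A, |l.1 ω|
  have hle : ∀ (l : A) ω, |l.1 ω| ≤ w ω := fun l ω =>
    Finset.single_le_sum (f := fun l : A => |l.1 ω|) (fun _ _ => abs_nonneg _) (Finset.mem_univ l)
  have hw0 : ∀ ω, 0 ≤ w ω := fun ω => Finset.sum_nonneg fun _ _ => abs_nonneg _
  have hwl : MemLp w 1 μ := memLp_one_iff_integrable.2
    (integrable_finsetSum _ fun l _ => (L1.integrable_coeFn l.1).abs)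
  have hmeas : ∀ l : A, Measurable l.1 := fun l => (Lp.stronglyMeasurable l.1).measurable
  have hwm : Measurable w := Finset.measurable_sum _ fun l _ => (hmeas l).abs
  refine ⟨hwl.toLp w, fun l ω => l.1 ω / w ω, ?_, fun l => (hmeas l).div hwm, fun l ω => ?_,
    fun l => ?_⟩
  · filter_upwards [hwl.coeFn_toLp] with ω hω
    rw [hω]
    exact hw0 ω
  · rw [abs_div, abs_of_nonneg (hw0 ω)]
    exact div_le_one_of_le₀ (hle l ω) (hw0 ω)
  · filter_upwards [hwl.coeFn_toLp] with ω hω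
    rw [hω]
    by_cases h0 : w ω = 0
    · have := hle l ω
      rw [h0] at this ⊢
      simp [abs_nonpos_iff.1 this]
    · rw [div_mul_cancel₀ _ h0]

lemma hasFramedApproximation_lp (μ : Measure Ω) [Nontrivial (Lp ℝ 1 μ)] :
    HasFramedApproximation (Lp ℝ 1 μ) := by
  classical
  refine hasFramedApproximation_of_biorthogonal fun A B hA hB ε hε => ?_
  have := hA.fintype
  have := hB.fintype
  obtain ⟨W, g, hW, hgm, hg1, hgW⟩ := exists_common_dominant A
  let f : B ⊕ A → Lp ℝ 1 μ →L[ℝ] ℝ :=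
    Sum.elim (fun φ => φ.1) fun l => mulIntegralCLM μ (g l) 1 (hgm l) (hg1 l)
  let N : ℝ := 1 + ∑ k, ‖f k‖
  have hf : ∀ k, ‖f k‖ ≤ N := fun k => by
    have := Finset.single_le_sum (f := fun k => ‖f k‖) (fun _ _ => norm_nonneg _)
      (Finset.mem_univ k)
    simp only [N]
    linarith
  have hN : 1 ≤ N := le_add_of_nonneg_right (Finset.sum_nonneg fun _ _ => norm_nonneg _)
  obtain ⟨H₀, hH₀⟩ := exists_isDensityOn (fun φ => hf (Sum.inl φ)) W
  let H : Ω → B ⊕ A → ℝ := fun ω => Sum.elim (H₀ ω) fun l => g l ω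
  have hH : IsDensityOn f N W H :=
    { measurable := measurable_pi_lambda _ (by
        rintro (φ | l)
        · exact hH₀.measurable.eval
        · exact hgm l)
      bound := by
        rintro ω (φ | l)
        · exact hH₀.bound ω φ
        · exact (hg1 l ω).trans hN
      apply_eq := by
        rintro z hz (φ | l)
        · exact hH₀.apply_eq z hz φ
        · rfl }
  let δ : ℝ := ε / (1 + ‖W‖)
  have hW1 : 0 < 1 + ‖W‖ := by positivity
  have hδ : 0 < δ := div_pos hε hW1
  have hδW : δ * (1 + ‖W‖) = ε := div_mul_cancel₀ _ hW1.ne'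
  obtain ⟨J, _, _, C, c, hC, hdisj, hcov, hc⟩ := exists_small_cells (B ⊕ A) N hδ
  set e : J → Lp ℝ 1 μ →L[ℝ] ℝ := fun j => cellFunctional hf (hC j) with he
  have key : ∀ j : {j // e j ≠ 0}, ∃ u : Lp ℝ 1 μ, ‖u‖ ≤ 1 ∧
      (∀ i, e i u = if i = j.1 then 1 else 0) ∧
      ∀ᵐ ω ∂μ, e j.1 W * u ω = (C j.1).indicator 1 (H ω) * W ω := by
    rintro ⟨j, hj⟩
    by_cases h0 : e j W = 0
    · obtain ⟨x, hx⟩ : ∃ x, e j x ≠ 0 := by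
        by_contra! h
        exact hj (by ext x; simpa using h x)
      obtain ⟨H', hH'⟩ := exists_isDensityOn hf x
      obtain ⟨u, hu1, hu2, -⟩ := exists_biorthogonal_vector hf hC hdisj hH' hx
      refine ⟨u, hu1, hu2, ?_⟩
      have h1 : 0 ≤ᵐ[μ] fun ω => (C j).indicator 1 (H ω) * W ω := by
        filter_upwards [hW] with ω hω
        exact mul_nonneg (Set.indicator_nonneg (fun _ _ => zero_le_one) _) hω
      have h2 : ∫ ω, (C j).indicator 1 (H ω) * W ω ∂μ = 0 := by
        rw [← h0, he, cellFunctional_apply hf (hC j) hH]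
      filter_upwards [(integral_eq_zero_iff_of_nonneg_ae h1
        (hH.integrable_indicator (hC j) W)).1 h2] with ω hω
      simp only [h0, zero_mul]
      exact hω.symm
    · obtain ⟨u, hu1, hu2, hu3⟩ := exists_biorthogonal_vector hf hC hdisj hH h0
      exact ⟨u, hu1, hu2, hu3 hW⟩
  choose u hu1 hu2 hu3 using key
  have hsub : ∀ F : J → ℝ, (∀ j, e j = 0 → F j = 0) → ∑ j : {j // e j ≠ 0}, F j = ∑ j, F j := by
    intro F hF
    rw [← Fintype.sum_subtype_add_sum_subtype (fun j => e j ≠ 0) F, left_eq_add]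
    exact Finset.sum_eq_zero fun j _ => hF _ (not_not.1 j.2)
  have hbi : ∀ i j : {j // e j ≠ 0}, e i (u j) = if i = j then 1 else 0 := fun i j => by
    rw [hu2]
    simp only [Subtype.ext_iff]
  have : Nonempty {j // e j ≠ 0} := by
    by_contra hne
    rw [not_nonempty_iff, isEmpty_subtype] at hne
    obtain ⟨y, hy⟩ := exists_ne (0 : Lp ℝ 1 μ)
    have h1 : ∀ᵐ ω ∂μ, 0 ≤ |y| ω := by
      filter_upwards [Lp.coeFn_abs y] with ω hω
      rw [hω]
      exact abs_nonneg _
    have h2 := sum_cellFunctional_of_nonneg hf hC hdisj hcov h1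
    rw [Finset.sum_eq_zero fun j _ => by
      rw [show cellFunctional hf (hC j) = 0 from not_not.1 (hne j)]; rfl,
      norm_abs_eq_norm] at h2
    exact hy (norm_eq_zero.1 h2.symm)
  refine ⟨{j // e j ≠ 0}, inferInstance, inferInstance, u, fun j => e j, hbi,
    ⟨_, _, isFramed_of_biorthogonal_sum hbi hu1 fun x => ?_⟩, fun l hl => ?_, fun φ hφ => ?_⟩
  · rw [hsub (fun j => |e j x|) fun j hj => by simp [hj]]
    exact sum_abs_cellFunctional_le hf hC hdisj hcov x
  · refine ⟨fun j => c j (Sum.inr ⟨l, hl⟩) * e j W, ?_⟩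
    refine (norm_le_of_ae_abs_le (δ := δ) (z := W) ?_).trans (by nlinarith [norm_nonneg W])
    have h4 : ∀ᵐ ω ∂μ, ∀ j, e j = 0 → (C j).indicator 1 (H ω) * W ω = 0 := by
      refine ae_all_iff.2 fun j => ?_
      by_cases hj : e j = 0
      · have h1 : 0 ≤ᵐ[μ] fun ω => (C j).indicator 1 (H ω) * W ω := by
          filter_upwards [hW] with ω hω
          exact mul_nonneg (Set.indicator_nonneg (fun _ _ => zero_le_one) _) hω
        have h2 : ∫ ω, (C j).indicator 1 (H ω) * W ω ∂μ = 0 := by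
          rw [← cellFunctional_apply hf (hC j) hH]
          exact DFunLike.congr_fun hj W
        filter_upwards [(integral_eq_zero_iff_of_nonneg_ae h1
          (hH.integrable_indicator (hC j) W)).1 h2] with ω hω _ using hω
      · exact Filter.Eventually.of_forall fun ω h => absurd h hj
    filter_upwards [Lp.coeFn_sub l (∑ j : {j // e j ≠ 0},
        (c j (Sum.inr ⟨l, hl⟩) * e j W) • u j), hgW ⟨l, hl⟩, ae_all_iff.2 hu3, h4,
      coeFn_sum_smul Finset.univ
        (fun j : {j // e j ≠ 0} => c j (Sum.inr ⟨l, hl⟩) * e j W) u] with ω h1 h2 h3 h4 h5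
    obtain ⟨j, hj⟩ := hcov _ (hH.bound ω)
    have h6 : ∑ j : {j // e j ≠ 0}, c j (Sum.inr ⟨l, hl⟩) * e j W * u j ω =
        c j (Sum.inr ⟨l, hl⟩) * W ω := by
      rw [← sum_mul_indicator_eq hdisj (fun j => c j (Sum.inr ⟨l, hl⟩)) hj, Finset.sum_mul,
        ← hsub _ fun j hj => by rw [mul_assoc, h4 j hj, mul_zero]]
      refine Finset.sum_congr rfl fun i _ => ?_
      rw [mul_assoc, h3, mul_assoc]
    rw [h1, Pi.sub_apply, h5, h6, h2, ← sub_mul, abs_mul]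
    exact mul_le_mul_of_nonneg_right (hc j _ hj (Sum.inr ⟨l, hl⟩)) (abs_nonneg _)
  · refine ⟨fun j => c j (Sum.inl ⟨φ, hφ⟩), fun x => ?_⟩
    rw [hsub (fun j => c j (Sum.inl ⟨φ, hφ⟩) * e j x) fun j hj => by simp [hj]]
    refine (abs_sub_sum_cellFunctional_le hf hC hdisj hcov hc (Sum.inl ⟨φ, hφ⟩) x).trans ?_
    exact mul_le_mul_of_nonneg_right (by nlinarith [norm_nonneg W]) (norm_nonneg _)

end LebesgueSpace

section DominatingMeasure

open MeasureTheory CompactlySupported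
open scoped NNReal

variable {K : Type*} [TopologicalSpace K] [CompactSpace K]

/-- The total variation of the functional `φ`, evaluated at a nonnegative function `f`. -/
noncomputable def functionalVariation (φ : C(K, ℝ) →L[ℝ] ℝ) (f : K → ℝ) : ℝ :=
  sSup {r | ∃ g : C(K, ℝ), (∀ t, |g t| ≤ f t) ∧ φ g = r}

variable {φ : C(K, ℝ) →L[ℝ] ℝ}

lemma le_functionalVariation (f : C(K, ℝ)) {g : C(K, ℝ)} (hg : ∀ t, |g t| ≤ f t) :
    φ g ≤ functionalVariation φ f := by
  refine le_csSup ⟨‖φ‖ * ‖f‖, ?_⟩ ⟨g, hg, rfl⟩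
  rintro _ ⟨g, hg, rfl⟩
  refine (le_abs_self _).trans ((φ.le_opNorm g).trans ?_)
  refine mul_le_mul_of_nonneg_left ?_ (norm_nonneg _)
  refine (ContinuousMap.norm_le _ (norm_nonneg _)).2 fun t => ?_
  exact (hg t).trans ((le_abs_self _).trans (f.norm_coe_le_norm t))

omit [CompactSpace K] in
lemma functionalVariation_le {f : K → ℝ} (hf : ∀ t, 0 ≤ f t) {c : ℝ}
    (h : ∀ g : C(K, ℝ), (∀ t, |g t| ≤ f t) → φ g ≤ c) : functionalVariation φ f ≤ c := by
  refine csSup_le ⟨0, 0, by simpa using hf, map_zero φ⟩ ?_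
  rintro _ ⟨g, hg, rfl⟩
  exact h g hg

lemma functionalVariation_nonneg (f : C(K, ℝ)) (hf : ∀ t, 0 ≤ f t) :
    0 ≤ functionalVariation φ f := by
  have := le_functionalVariation (φ := φ) f (g := 0) (by simpa using hf)
  rwa [map_zero] at this

lemma functionalVariation_add (f₁ f₂ : C(K, ℝ)) (h₁ : ∀ t, 0 ≤ f₁ t) (h₂ : ∀ t, 0 ≤ f₂ t) :
    functionalVariation φ (f₁ + f₂ : C(K, ℝ)) =
      functionalVariation φ f₁ + functionalVariation φ f₂ := by
  apply le_antisymm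
  · refine functionalVariation_le (fun t => add_nonneg (h₁ t) (h₂ t)) fun g hg => ?_
    let g₁ : C(K, ℝ) := (-f₁) ⊔ (f₁ ⊓ g)
    have e : φ g = φ g₁ + φ (g - g₁) := by rw [← map_add, add_sub_cancel]
    rw [e]
    refine add_le_add (le_functionalVariation f₁ fun t => ?_)
      (le_functionalVariation f₂ fun t => ?_)
    · have : g₁ t = max (-f₁ t) (min (f₁ t) (g t)) := rfl
      rw [this, abs_le]
      exact ⟨le_max_left _ _, max_le (by linarith [h₁ t]) (min_le_left _ _)⟩
    · have e₁ : (g - g₁) t = g t - max (-f₁ t) (min (f₁ t) (g t)) := rfl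
      have e₂ : |g t| ≤ f₁ t + f₂ t := hg t
      rw [abs_le] at e₂
      rw [e₁, abs_le]
      rcases le_total (f₁ t) (g t) with h | h
      · rw [min_eq_left h, max_eq_right (by linarith [h₁ t])]
        constructor <;> linarith [h₂ t]
      · rw [min_eq_right h]
        rcases le_total (-f₁ t) (g t) with h' | h'
        · rw [max_eq_right h']
          constructor <;> linarith [h₂ t]
        · rw [max_eq_left h']
          constructor <;> linarith [h₂ t]
  · rw [← le_sub_iff_add_le]
    refine functionalVariation_le h₁ fun g₁ hg₁ => ?_
    rw [le_sub_comm]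
    refine functionalVariation_le h₂ fun g₂ hg₂ => ?_
    rw [le_sub_iff_add_le, add_comm, ← map_add]
    exact le_functionalVariation _ fun t => (abs_add_le _ _).trans (add_le_add (hg₁ t) (hg₂ t))

lemma functionalVariation_smul (f : C(K, ℝ)) (hf : ∀ t, 0 ≤ f t) {c : ℝ} (hc : 0 ≤ c) :
    functionalVariation φ (c • f : C(K, ℝ)) = c * functionalVariation φ f := by
  rcases hc.eq_or_lt with rfl | hc
  · rw [zero_mul, zero_smul]
    refine le_antisymm (functionalVariation_le (fun _ => le_rfl) fun g hg => ?_)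
      (functionalVariation_nonneg 0 fun _ => le_rfl)
    have : g = 0 := by
      ext t
      exact abs_nonpos_iff.1 (hg t)
    rw [this, map_zero]
  · apply le_antisymm
    · refine functionalVariation_le (fun t => mul_nonneg hc.le (hf t)) fun g hg => ?_
      have h := le_functionalVariation (φ := φ) f (g := c⁻¹ • g) fun t => by
        have h1 : |g t| ≤ c * f t := hg t
        have h2 : (c⁻¹ • g) t = c⁻¹ * g t := rfl
        rw [h2, abs_mul, abs_of_pos (inv_pos.2 hc)]
        exact (inv_mul_le_iff₀ hc).2 h1
      rw [map_smul, smul_eq_mul] at h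
      exact (inv_mul_le_iff₀ hc).1 h
    · rw [← le_div_iff₀' hc]
      refine functionalVariation_le hf fun g hg => ?_
      rw [le_div_iff₀' hc, ← smul_eq_mul, ← map_smul]
      refine le_functionalVariation _ fun t => ?_
      have h2 : (c • g) t = c * g t := rfl
      rw [h2, abs_mul, abs_of_pos hc]
      exact mul_le_mul_of_nonneg_left (hg t) hc.le

/-- A nonnegative compactly supported function, as a real-valued continuous function. -/
def nnrealToReal (f : C_c(K, ℝ≥0)) : C(K, ℝ) := ⟨fun t => f t, by fun_prop⟩

/-- The total variation of a functional on continuous functions is a positive functional. -/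
noncomputable def variationFunctional (φ : C(K, ℝ) →L[ℝ] ℝ) : C_c(K, ℝ≥0) →ₗ[ℝ≥0] ℝ≥0 where
  toFun f := ⟨functionalVariation φ (nnrealToReal f),
    functionalVariation_nonneg _ fun t => (f t).2⟩
  map_add' f₁ f₂ := NNReal.coe_injective
    (functionalVariation_add (nnrealToReal f₁) (nnrealToReal f₂) (fun t => (f₁ t).2)
      fun t => (f₂ t).2)
  map_smul' c f := NNReal.coe_injective
    (functionalVariation_smul (nnrealToReal f) (fun t => (f t).2) c.2)

lemma exists_dominating_measure [T2Space K] [MeasurableSpace K] [BorelSpace K]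
    (φ : C(K, ℝ) →L[ℝ] ℝ) :
    ∃ ν : Measure K, IsFiniteMeasure ν ∧ ∀ f : C(K, ℝ), |φ f| ≤ ∫ t, |f t| ∂ν := by
  refine ⟨NNRealRMK.rieszMeasure (variationFunctional φ), inferInstance, fun f => ?_⟩
  let F : C_c(K, ℝ≥0) := CompactlySupportedContinuousMap.continuousMapEquiv
    ⟨fun t => ‖f t‖₊, by fun_prop⟩
  have hF : ∀ t, ((F t : ℝ≥0) : ℝ) = |f t| := fun t => coe_nnnorm (f t)
  have h := NNRealRMK.integral_rieszMeasure (variationFunctional φ) F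
  simp only [hF] at h
  rw [h]
  have key : ∀ g : C(K, ℝ), (∀ t, |g t| = |f t|) → φ g ≤ variationFunctional φ F := fun g hg =>
    le_functionalVariation (nnrealToReal F) fun t => (hg t).trans_le (hF t).ge
  rw [abs_le']
  refine ⟨key f fun _ => rfl, ?_⟩
  rw [← map_neg]
  exact key (-f) fun t => abs_neg _

end DominatingMeasure

section ContinuousFunctions

open MeasureTheory

variable {K : Type*} [TopologicalSpace K] [CompactSpace K] [MeasurableSpace K] [BorelSpace K]

/-- A functional dominated by a finite measure has an approximately continuous density. -/
lemma exists_continuous_density [NormalSpace K] {ν : Measure K} [IsFiniteMeasure ν]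
    [ν.WeaklyRegular] {φ : C(K, ℝ) →L[ℝ] ℝ} (hφ : ∀ f : C(K, ℝ), |φ f| ≤ ∫ t, |f t| ∂ν) {ε : ℝ}
    (hε : 0 < ε) :
    ∃ γ : C(K, ℝ), ∀ f : C(K, ℝ), |φ f - ∫ t, γ t * f t ∂ν| ≤ ε * ‖f‖ := by
  set e : C(K, ℝ) →L[ℝ] Lp ℝ 1 ν := ContinuousMap.toLp 1 ν ℝ with he
  have hcoe : ∀ f : C(K, ℝ), e f =ᵐ[ν] f := fun f => ContinuousMap.coeFn_toLp ν f
  have hdense : DenseRange e := ContinuousMap.toLp_denseRange ℝ ν ℝ ENNReal.one_ne_top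
  have hnorm : ∀ f : C(K, ℝ), ∫ t, |f t| ∂ν = ‖e f‖ := by
    intro f
    rw [L1.norm_eq_integral_norm]
    refine integral_congr_ae ?_
    filter_upwards [hcoe f] with t ht
    rw [ht, Real.norm_eq_abs]
  obtain ⟨h, hm, hc, hh⟩ := exists_integral_representation
    (φ.toLinearMap.extendOfNorm e.toLinearMap)
  have hrep : ∀ f : C(K, ℝ), φ f = ∫ t, h t * f t ∂ν := by
    intro f
    have h1 := LinearMap.extendOfNorm_eq (f := φ.toLinearMap) (e := e.toLinearMap) hdense
      ⟨1, fun f => by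
        rw [one_mul]
        exact (hφ f).trans_eq (hnorm f)⟩ f
    refine (h1.symm.trans (hh _)).trans (integral_congr_ae ?_)
    filter_upwards [hcoe f] with t ht
    exact congrArg (h t * ·) ht
  have hhi : Integrable h ν := Integrable.of_bound hm.aestronglyMeasurable _
    (Filter.Eventually.of_forall fun t => by simpa using hc t)
  have hhl : MemLp h 1 ν := memLp_one_iff_integrable.2 hhi
  obtain ⟨γ, hγ⟩ := hdense.exists_dist_lt (hhl.toLp h) hε
  refine ⟨γ, fun f => ?_⟩
  have hγi : Integrable γ ν := (L1.integrable_coeFn (e γ)).congr (hcoe γ)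
  have hmul : ∀ g : K → ℝ, Integrable g ν → Integrable (fun t => g t * f t) ν := by
    intro g hg
    refine (integrable_bounded_mul f.continuous.measurable (c := ‖f‖)
      (fun t => f.norm_coe_le_norm t) hg).congr ?_
    exact Filter.Eventually.of_forall fun t => mul_comm _ _
  have hd : ‖hhl.toLp h - e γ‖ = ∫ t, |h t - γ t| ∂ν := by
    rw [L1.norm_eq_integral_norm]
    refine integral_congr_ae ?_
    filter_upwards [hhl.coeFn_toLp, hcoe γ, Lp.coeFn_sub (hhl.toLp h) (e γ)] with t h1 h2 h3
    rw [h3, Pi.sub_apply, h1, h2, Real.norm_eq_abs]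
  rw [dist_eq_norm, hd] at hγ
  calc |φ f - ∫ t, γ t * f t ∂ν| = |∫ t, (h t - γ t) * f t ∂ν| := by
        rw [hrep, ← integral_sub (hmul h hhi) (hmul γ hγi)]
        simp only [sub_mul]
    _ ≤ ∫ t, |(h t - γ t) * f t| ∂ν := abs_integral_le_integral_abs
    _ ≤ ∫ t, |h t - γ t| * ‖f‖ ∂ν := by
        refine integral_mono (hmul _ (hhi.sub hγi)).abs ((hhi.sub hγi).abs.mul_const _) fun t => ?_
        simp only [abs_mul]
        exact mul_le_mul_of_nonneg_left (f.norm_coe_le_norm t) (abs_nonneg _)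
    _ ≤ ε * ‖f‖ := by
        rw [integral_mul_const]
        exact mul_le_mul_of_nonneg_right hγ.le (norm_nonneg _)

/-- A normalized positive functional carried by a nonempty compact set, proportional to the
restriction of a measure to that set. -/
lemma exists_average_functional (ν : Measure K) [IsFiniteMeasure ν] {E : Set K}
    (hE : MeasurableSet E) {t₀ : K} (ht₀ : t₀ ∈ E) :
    ∃ u : C(K, ℝ) →L[ℝ] ℝ, (∀ f, |u f| ≤ ‖f‖) ∧
      (∀ (f : C(K, ℝ)) c, (∀ s ∈ E, f s = c) → u f = c) ∧
      ∀ f : C(K, ℝ), ν.real E * u f = ∫ t in E, f t ∂ν := by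
  have hint : ∀ f : C(K, ℝ), IntegrableOn f E ν := fun f =>
    (Integrable.of_bound f.continuous.measurable.aestronglyMeasurable ‖f‖
      (Filter.Eventually.of_forall f.norm_coe_le_norm)).integrableOn
  by_cases h0 : ν.real E = 0
  · refine ⟨ContinuousMap.evalCLM ℝ t₀, fun f => f.norm_coe_le_norm t₀,
      fun f c hf => hf t₀ ht₀, fun f => ?_⟩
    rw [h0, zero_mul, setIntegral_measure_zero]
    exact (measureReal_eq_zero_iff (measure_ne_top ν E)).1 h0
  · have hpos : 0 < ν.real E := lt_of_le_of_ne measureReal_nonneg (Ne.symm h0)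
    have hbd : ∀ f : C(K, ℝ), |(ν.real E)⁻¹ * ∫ t in E, f t ∂ν| ≤ ‖f‖ := by
      intro f
      rw [abs_mul, abs_of_pos (inv_pos.2 hpos), inv_mul_le_iff₀ hpos, mul_comm]
      exact norm_setIntegral_le_of_norm_le_const (measure_lt_top ν E)
        fun t _ => f.norm_coe_le_norm t
    refine ⟨LinearMap.mkContinuous
      { toFun := fun f => (ν.real E)⁻¹ * ∫ t in E, f t ∂ν
        map_add' := fun f g => by
          simp only [ContinuousMap.add_apply]
          rw [integral_add (hint f) (hint g), mul_add]
        map_smul' := fun c f => by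
          simp only [ContinuousMap.smul_apply, smul_eq_mul, RingHom.id_apply]
          rw [integral_const_mul]
          ring } 1 (fun f => by simpa using hbd f), hbd, fun f c hf => ?_, fun f => ?_⟩
    · change (ν.real E)⁻¹ * ∫ t in E, f t ∂ν = c
      rw [setIntegral_congr_fun hE hf, setIntegral_const, smul_eq_mul, inv_mul_cancel_left₀ h0]
    · change ν.real E * ((ν.real E)⁻¹ * ∫ t in E, f t ∂ν) = _
      rw [mul_inv_cancel_left₀ h0]

end ContinuousFunctions

section CompactMetric

open MeasureTheory

variable {K : Type} [MetricSpace K] [CompactSpace K]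

lemma exists_common_modulus {S : Set C(K, ℝ)} (hS : S.Finite) {ε : ℝ} (hε : 0 < ε) :
    ∃ δ > 0, ∀ a ∈ S, ∀ s s', dist s s' < δ → |a s - a s'| ≤ ε := by
  have h : ∀ᶠ p : K × K in uniformity K, ∀ a ∈ S, dist (a p.1) (a p.2) < ε :=
    (Filter.eventually_all_finite hS).2 fun a _ =>
      CompactSpace.uniformContinuous_of_continuous a.continuous (Metric.dist_mem_uniformity hε)
  obtain ⟨δ, hδ, h⟩ := Metric.uniformity_basis_dist.eventually_iff.1 h
  exact ⟨δ, hδ, fun a ha s s' hs => (h (x := (s, s')) hs a ha).le⟩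

lemma norm_sub_sum_smul_le {n : Type*} [Fintype n] {e : n → C(K, ℝ)} {t : n → K} {δ ε : ℝ}
    (he : ∀ i s, 0 ≤ e i s) (hsum : ∀ s, ∑ i, e i s = 1)
    (hsupp : ∀ i s, e i s ≠ 0 → dist s (t i) < δ) (hε : 0 ≤ ε) {a : C(K, ℝ)}
    (ha : ∀ s s', dist s s' < δ → |a s - a s'| ≤ ε) : ‖a - ∑ i, a (t i) • e i‖ ≤ ε := by
  refine (ContinuousMap.norm_le _ hε).2 fun s => ?_
  have h1 : (a - ∑ i, a (t i) • e i) s = ∑ i, e i s * (a s - a (t i)) := by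
    simp only [ContinuousMap.sub_apply, ContinuousMap.sum_apply, ContinuousMap.smul_apply,
      smul_eq_mul, mul_sub, Finset.sum_sub_distrib]
    rw [← Finset.sum_mul, hsum, one_mul]
    simp only [mul_comm]
  rw [h1]
  calc ‖∑ i, e i s * (a s - a (t i))‖ ≤ ∑ i, ‖e i s * (a s - a (t i))‖ := norm_sum_le _ _
    _ ≤ ∑ i, e i s * ε := Finset.sum_le_sum fun i _ => by
        rw [norm_mul, Real.norm_eq_abs, Real.norm_eq_abs, abs_of_nonneg (he i s)]
        rcases eq_or_ne (e i s) 0 with h | h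
        · simp [h]
        · exact mul_le_mul_of_nonneg_left (ha _ _ (hsupp i s h)) (he i s)
    _ = ε := by rw [← Finset.sum_mul, hsum, one_mul]

variable [MeasurableSpace K] [BorelSpace K]

lemma exists_measurable_partition [Nonempty K] {δ : ℝ} (hδ : 0 < δ) :
    ∃ (n : Type) (_ : Fintype n) (_ : DecidableEq n) (_ : Nonempty n) (D : n → Set K) (t : n → K),
      (∀ i, MeasurableSet (D i)) ∧ (∀ s, ∃ i, s ∈ D i) ∧ Pairwise (Function.onFun Disjoint D) ∧
      (∀ i, t i ∈ D i) ∧ ∀ i, ∀ s ∈ D i, dist s (t i) < δ := by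
  classical
  obtain ⟨N, hN⟩ : ∃ N : ℕ, ∀ x : K, ∃ k ≤ N,
      dist (TopologicalSpace.denseSeq K k) x < δ / 2 := by
    obtain ⟨F, hF⟩ := isCompact_univ.elim_finite_subcover
      (fun k => Metric.ball (TopologicalSpace.denseSeq K k) (δ / 2)) (fun _ => Metric.isOpen_ball)
      fun x _ => by
        obtain ⟨k, hk⟩ := (TopologicalSpace.denseRange_denseSeq K).exists_dist_lt x (half_pos hδ)
        exact Set.mem_iUnion.2 ⟨k, hk⟩
    refine ⟨F.sup id, fun x => ?_⟩
    obtain ⟨k, hk, hx⟩ := Set.mem_iUnion₂.1 (hF (Set.mem_univ x))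
    exact ⟨k, Finset.le_sup (f := id) hk, by rwa [dist_comm]⟩
  set f := SimpleFunc.nearestPt (TopologicalSpace.denseSeq K) N
  have hf : ∀ x, dist (f x) x < δ / 2 := by
    intro x
    obtain ⟨k, hk, hx⟩ := hN x
    have h := SimpleFunc.edist_nearestPt_le (TopologicalSpace.denseSeq K) x hk
    rw [edist_dist, edist_dist, ENNReal.ofReal_le_ofReal_iff dist_nonneg] at h
    exact h.trans_lt hx
  choose t ht using fun i : f.range => SimpleFunc.mem_range.1 i.2
  refine ⟨f.range, inferInstance, inferInstance,
    ⟨⟨f (Classical.arbitrary K), SimpleFunc.mem_range_self f _⟩⟩, fun i => f ⁻¹' {(i : K)}, t,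
    fun i => f.measurableSet_fiber i, fun s => ⟨⟨f s, SimpleFunc.mem_range_self f s⟩, rfl⟩, ?_,
    ht, ?_⟩
  · intro i j hij
    refine Set.disjoint_left.2 fun s hi hj => hij (Subtype.ext ?_)
    exact (Set.mem_singleton_iff.1 hi).symm.trans (Set.mem_singleton_iff.1 hj)
  · intro i s hs
    have h1 := hf s
    have h2 := hf (t i)
    rw [show f s = i from hs, dist_comm] at h1
    rw [ht i] at h2
    linarith [dist_triangle s i (t i)]

/-- Shrinking a measurable partition into small pieces to compact sets, up to a small measure, and
finding a continuous partition of unity that is constant on each of these compact sets. -/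
lemma exists_partition_of_unity_of_partition (ν : Measure K) [IsFiniteMeasure ν] {n : Type*}
    [Fintype n] {D : n → Set K} {t : n → K} (hD : ∀ i, MeasurableSet (D i))
    (hcover : ∀ s, ∃ i, s ∈ D i) (hdisj : Pairwise (Function.onFun Disjoint D))
    (ht : ∀ i, t i ∈ D i) {δ : ℝ} (hdist : ∀ i, ∀ s ∈ D i, dist s (t i) < δ) {η : ℝ}
    (hη : 0 < η) :
    ∃ (E : n → Set K) (e : n → C(K, ℝ)), (∀ i, E i ⊆ D i) ∧ (∀ i, MeasurableSet (E i)) ∧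
      (∀ i, t i ∈ E i) ∧ (∀ i, ν.real (D i \ E i) ≤ η) ∧ (∀ i s, 0 ≤ e i s) ∧
      (∀ s, ∑ i, e i s = 1) ∧ (∀ i s, e i s ≠ 0 → dist s (t i) < δ) ∧
      ∀ i j, i ≠ j → ∀ s ∈ E i, e j s = 0 := by
  have hE : ∀ i, ∃ E ⊆ D i, IsCompact E ∧ t i ∈ E ∧ ν.real (D i \ E) ≤ η := by
    intro i
    obtain ⟨E, hED, hE, hlt⟩ := (hD i).exists_isCompact_sdiff_lt (measure_ne_top ν _)
      (ENNReal.ofReal_pos.2 hη).ne'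
    refine ⟨insert (t i) E, Set.insert_subset (ht i) hED, hE.insert _, Set.mem_insert _ _, ?_⟩
    refine ENNReal.toReal_le_of_le_ofReal hη.le (le_trans (measure_mono ?_) hlt.le)
    exact Set.sdiff_subset_sdiff_right (Set.subset_insert _ _)
  choose E hED hEc htE hEη using hE
  have hsub : ∀ i j, i ≠ j → ∀ s ∈ E i, s ∉ E j := fun i j hij s hi hj =>
    Set.disjoint_left.1 (hdisj hij) (hED i hi) (hED j hj)
  obtain ⟨ρ, hρ⟩ := PartitionOfUnity.exists_isSubordinate (s := (Set.univ : Set K)) isClosed_univ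
    (fun i => Metric.ball (t i) δ ∩ ⋂ j, ⋂ (_ : j ≠ i), (E j)ᶜ)
    (fun i => Metric.isOpen_ball.inter (isOpen_iInter_of_finite fun j =>
      isOpen_iInter_of_finite fun _ => (hEc j).isClosed.isOpen_compl))
    (fun s _ => by
      rw [Set.mem_iUnion]
      by_cases hs : ∃ i, s ∈ E i
      · obtain ⟨i, hi⟩ := hs
        exact ⟨i, hdist i s (hED i hi), Set.mem_iInter₂.2 fun j hj => hsub i j hj.symm s hi⟩
      · obtain ⟨i, hi⟩ := hcover s
        exact ⟨i, hdist i s hi, Set.mem_iInter₂.2 fun j _ hj => hs ⟨j, hj⟩⟩)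
  have hsupp : ∀ i s, ρ i s ≠ 0 → s ∈ Metric.ball (t i) δ ∩ ⋂ j, ⋂ (_ : j ≠ i), (E j)ᶜ :=
    fun i s hs => hρ i (subset_tsupport _ hs)
  refine ⟨E, fun i => ρ i, hED, fun i => (hEc i).isClosed.measurableSet, htE, hEη, ρ.nonneg,
    fun s => ?_, fun i s hs => (hsupp i s hs).1, fun i j hij s hs => ?_⟩
  · rw [← finsum_eq_sum_of_fintype]
    exact ρ.sum_eq_one (Set.mem_univ s)
  · by_contra h
    exact Set.mem_iInter₂.1 (hsupp j s h).2 i hij hs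


lemma abs_integral_mul_sub_sum_le (ν : Measure K) [IsFiniteMeasure ν] {n : Type*} [Fintype n]
    {D E : n → Set K} {t : n → K} (hD : ∀ i, MeasurableSet (D i)) (hcover : ∀ s, ∃ i, s ∈ D i)
    (hdisj : Pairwise (Function.onFun Disjoint D)) {δ : ℝ}
    (hdist : ∀ i, ∀ s ∈ D i, dist s (t i) < δ) {η : ℝ} (hED : ∀ i, E i ⊆ D i)
    (hE : ∀ i, MeasurableSet (E i)) (hη : ∀ i, ν.real (D i \ E i) ≤ η) {γ : C(K, ℝ)} {ε : ℝ}
    (hγ : ∀ s s', dist s s' < δ → |γ s - γ s'| ≤ ε) (f : C(K, ℝ)) :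
    |∫ s, γ s * f s ∂ν - ∑ i, γ (t i) * ∫ s in E i, f s ∂ν| ≤
      (ε * ν.real Set.univ + ‖γ‖ * (Fintype.card n * η)) * ‖f‖ := by
  have hU : ⋃ i, D i = Set.univ := Set.eq_univ_of_forall fun s => Set.mem_iUnion.2 (hcover s)
  have hint : ∀ g : C(K, ℝ), Integrable g ν := fun g =>
    Integrable.of_bound g.continuous.measurable.aestronglyMeasurable ‖g‖
      (Filter.Eventually.of_forall g.norm_coe_le_norm)
  have hsplit : ∫ s, γ s * f s ∂ν = ∑ i, ∫ s in D i, γ s * f s ∂ν := by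
    rw [← setIntegral_univ, ← hU]
    exact integral_iUnion_fintype hD hdisj fun i => (hint (γ * f)).integrableOn
  have hmeas : ν.real Set.univ = ∑ i, ν.real (D i) := by
    rw [← hU, measureReal_iUnion_fintype hdisj hD]
  have hpiece : ∀ i, ∫ s in D i, γ s * f s ∂ν - γ (t i) * ∫ s in E i, f s ∂ν =
      ∫ s in D i, (γ s - γ (t i)) * f s ∂ν + γ (t i) * ∫ s in D i \ E i, f s ∂ν := by
    intro i
    rw [setIntegral_sdiff (hE i) (hint f).integrableOn (hED i)]
    have h1 : ∫ s in D i, (γ s - γ (t i)) * f s ∂ν =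
        ∫ s in D i, γ s * f s ∂ν - γ (t i) * ∫ s in D i, f s ∂ν := by
      rw [← integral_const_mul, ← integral_sub (f := fun s => γ s * f s) (hint (γ * f)).integrableOn
        ((hint f).const_mul _).integrableOn]
      simp only [sub_mul]
    rw [h1]
    ring
  have hbound : ∀ i, |∫ s in D i, γ s * f s ∂ν - γ (t i) * ∫ s in E i, f s ∂ν| ≤
      ε * ‖f‖ * ν.real (D i) + ‖γ‖ * (‖f‖ * η) := by
    intro i
    rw [hpiece]
    refine (abs_add_le _ _).trans (add_le_add ?_ ?_)
    · rw [← Real.norm_eq_abs]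
      refine norm_setIntegral_le_of_norm_le_const (measure_lt_top ν _) fun s hs => ?_
      rw [norm_mul]
      have h2 := hγ _ _ (hdist i s hs)
      exact mul_le_mul h2 (f.norm_coe_le_norm s) (norm_nonneg _) ((abs_nonneg _).trans h2)
    · rw [abs_mul]
      refine mul_le_mul (γ.norm_coe_le_norm _) ?_ (abs_nonneg _) (norm_nonneg _)
      refine (norm_setIntegral_le_of_norm_le_const (measure_lt_top ν _) fun s _ =>
        f.norm_coe_le_norm s).trans ?_
      exact mul_le_mul_of_nonneg_left (hη i) (norm_nonneg _)
  rw [hsplit, ← Finset.sum_sub_distrib]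
  refine (Finset.abs_sum_le_sum_abs _ _).trans ((Finset.sum_le_sum fun i _ => hbound i).trans ?_)
  rw [Finset.sum_add_distrib, ← Finset.mul_sum, ← hmeas, Finset.sum_const, Finset.card_univ,
    nsmul_eq_mul]
  apply le_of_eq
  ring

lemma exists_common_dominating_measure {B : Set (C(K, ℝ) →L[ℝ] ℝ)} (hB : B.Finite) :
    ∃ ν : Measure K, IsFiniteMeasure ν ∧ ∀ φ ∈ B, ∀ f : C(K, ℝ), |φ f| ≤ ∫ t, |f t| ∂ν := by
  have hint : ∀ (ν : Measure K) [IsFiniteMeasure ν] (f : C(K, ℝ)), Integrable (fun t => |f t|) ν :=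
    fun ν _ f => (Integrable.of_bound f.continuous.measurable.aestronglyMeasurable ‖f‖
      (Filter.Eventually.of_forall f.norm_coe_le_norm)).abs
  induction B, hB using Set.Finite.induction_on with
  | empty => exact ⟨0, inferInstance, by simp⟩
  | @insert φ B _ _ ih =>
    obtain ⟨ν, _, hν⟩ := ih
    obtain ⟨ν', _, hν'⟩ := exists_dominating_measure φ
    refine ⟨ν + ν', inferInstance, fun ψ hψ f => ?_⟩
    rw [integral_add_measure (hint ν f) (hint ν' f)]
    have h1 : 0 ≤ ∫ t, |f t| ∂ν := integral_nonneg fun _ => abs_nonneg _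
    have h2 : 0 ≤ ∫ t, |f t| ∂ν' := integral_nonneg fun _ => abs_nonneg _
    rcases hψ with rfl | hψ
    · linarith [hν' f]
    · linarith [hν ψ hψ f]

lemma hasFramedApproximation_continuousMap [Nonempty K] : HasFramedApproximation C(K, ℝ) := by
  refine hasFramedApproximation_of_biorthogonal fun A B hA hB ε hε => ?_
  obtain ⟨ν, _, hν⟩ := exists_common_dominating_measure hB
  choose! γ hγ using fun φ hφ => exists_continuous_density (hν φ hφ) (half_pos hε)
  obtain ⟨G, hG⟩ := (hB.image fun φ => ‖γ φ‖).bddAbove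
  set m := ν.real Set.univ
  have hm : 0 ≤ m := measureReal_nonneg
  have hε₁ : 0 < ε / (4 * (m + 1)) := by positivity
  obtain ⟨δ, hδ, hmod⟩ := exists_common_modulus (hA.union (hB.image γ)) hε₁
  obtain ⟨n, _, _, _, D, t, hD, hcover, hdisj, ht, hdist⟩ :=
    exists_measurable_partition (K := K) hδ
  have hη : 0 < ε / (4 * (|G| + 1) * (Fintype.card n + 1)) := by positivity
  obtain ⟨E, e, hED, hE, htE, hEη, he, hsum, hsupp, hzero⟩ :=
    exists_partition_of_unity_of_partition ν hD hcover hdisj ht hdist hη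
  have hone : ∀ i, ∀ s ∈ E i, e i s = 1 := by
    intro i s hs
    rw [← hsum s, Finset.sum_eq_single i (fun j _ hj => hzero i j hj.symm s hs) (by simp)]
  choose u hu huc hui using fun i => exists_average_functional ν (hE i) (htE i)
  have hbi : ∀ i j, u i (e j) = if i = j then 1 else 0 := by
    intro i j
    split_ifs with h
    · exact huc i _ _ (h ▸ hone i)
    · exact huc i _ _ (hzero i j h)
  refine ⟨n, inferInstance, inferInstance, e, u, hbi,
    ⟨_, _, isFramed_of_biorthogonal_sup hbi hu fun y c hy => ?_⟩, fun a ha => ?_, fun φ hφ => ?_⟩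
  · have hc : 0 ≤ c := (abs_nonneg _).trans (hy (Classical.arbitrary n))
    refine (ContinuousMap.norm_le _ hc).2 fun s => ?_
    rw [ContinuousMap.sum_apply]
    calc ‖∑ i, (y i • e i) s‖ ≤ ∑ i, ‖(y i • e i) s‖ := norm_sum_le _ _
      _ ≤ ∑ i, c * e i s := Finset.sum_le_sum fun i _ => by
          rw [ContinuousMap.smul_apply, norm_smul, Real.norm_eq_abs, Real.norm_eq_abs,
            abs_of_nonneg (he i s)]
          exact mul_le_mul_of_nonneg_right (hy i) (he i s)
      _ = c := by rw [← Finset.mul_sum, hsum, mul_one]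
  · refine ⟨fun i => a (t i), (norm_sub_sum_smul_le he hsum hsupp hε₁.le
      (hmod a (Or.inl ha))).trans (div_le_self hε.le ?_)⟩
    linarith
  · refine ⟨fun i => γ φ (t i) * ν.real (E i), fun f => ?_⟩
    have h1 := abs_integral_mul_sub_sum_le ν hD hcover hdisj hdist hED hE hEη
      (hmod (γ φ) (Or.inr ⟨φ, hφ, rfl⟩)) f
    have h2 : ∑ i, γ φ (t i) * ν.real (E i) * u i f = ∑ i, γ φ (t i) * ∫ s in E i, f s ∂ν :=
      Finset.sum_congr rfl fun i _ => by rw [mul_assoc, hui]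
    have h3 : ε / (4 * (m + 1)) * m ≤ ε / 4 := by
      rw [div_mul_eq_mul_div, div_le_div_iff₀ (by positivity) (by positivity)]
      nlinarith
    have h4 : ‖γ φ‖ * (Fintype.card n * (ε / (4 * (|G| + 1) * (Fintype.card n + 1)))) ≤ ε / 4 := by
      have h5 : ‖γ φ‖ ≤ |G| + 1 :=
        ((hG ⟨φ, hφ, rfl⟩).trans (le_abs_self G)).trans (by linarith)
      have h6 : (Fintype.card n : ℝ) ≤ Fintype.card n + 1 := by linarith
      calc _ ≤ (|G| + 1) * ((Fintype.card n + 1) *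
            (ε / (4 * (|G| + 1) * (Fintype.card n + 1)))) := by gcongr
        _ = ε / 4 := by field_simp
    rw [h2]
    have h7 := abs_sub_le (φ f) (∫ s, γ φ s * f s ∂ν) (∑ i, γ φ (t i) * ∫ s in E i, f s ∂ν)
    have h8 := mul_le_mul_of_nonneg_right (add_le_add h3 h4) (norm_nonneg f)
    linarith [hγ φ hφ f]

end CompactMetric

/-- On both `X = C[0,1] ⊕₁ L₁[0,1]` and `Y = C[0,1] ⊕∞ L₁[0,1]`, the numerical radius
attaining compact operators are dense in the compact operators. -/
theorem NRA_compact_dense_on_C_sum_L1 :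
    (∀ T : CLM (WithLp 1 (C(I, ℝ) × MeasureTheory.Lp ℝ 1 (volume : MeasureTheory.Measure I))),
      IsCompactOperator T →
        T ∈ closure {S : CLM (WithLp 1 (C(I, ℝ) ×
            MeasureTheory.Lp ℝ 1 (volume : MeasureTheory.Measure I))) |
          AttainsNumRadius S ∧ IsCompactOperator S}) ∧
    (∀ T : CLM (WithLp ∞ (C(I, ℝ) × MeasureTheory.Lp ℝ 1 (volume : MeasureTheory.Measure I))),
      IsCompactOperator T →
        T ∈ closure {S : CLM (WithLp ∞ (C(I, ℝ) ×
            MeasureTheory.Lp ℝ 1 (volume : MeasureTheory.Measure I))) |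
          AttainsNumRadius S ∧ IsCompactOperator S}) := by
  have hC : HasFramedApproximation C(I, ℝ) := hasFramedApproximation_continuousMap
  have hL : Subsingleton (MeasureTheory.Lp ℝ 1 volume) ∨
      HasFramedApproximation (MeasureTheory.Lp ℝ 1 volume) := by
    rcases subsingleton_or_nontrivial (MeasureTheory.Lp ℝ 1 volume) with h | h
    · exact Or.inl h
    · exact Or.inr (hasFramedApproximation_lp volume)
  exact ⟨fun T hT => HasFramedApproximation.mem_closure (HasFramedApproximation.withLp_prod
      (fun P Q ⟨_, _, h⟩ ⟨_, _, k⟩ => ⟨_, _, h.diagonalCLM_one k⟩) hC hL) hT,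
    fun T hT => HasFramedApproximation.mem_closure (HasFramedApproximation.withLp_prod
      (fun P Q ⟨_, _, h⟩ ⟨_, _, k⟩ => ⟨_, _, h.diagonalCLM_top k⟩) hC hL) hT⟩
end
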